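/- arXiv:2107.14748 — 4 statements merged into one kernel-verified Lean document; each statement's English description precedes it below -/
import Mathlib

section
/- For every fixed δ > 0 there exists a constant c > 0 such that for every T₀ ≥ 16 there exists T ≥ T₀ with ∫_T^{T+δ} |ζ(1+it)| dt ≥ c · log log log T. (Equivalently, ∫_T^{T+δ} |ζ(1+it)| dt = Ω(log log log T) as T → ∞.) -/
open Complex Real Filter MeasureTheory intervalIntegral

/-- Integration by parts against an exponential. -/
theorem integral_mul_cexp_eq_of_hasDerivAt {f f' : ℝ → ℂ} (hf : ∀ x, HasDerivAt f (f' x) x)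
    (hf' : Continuous f') (a b : ℝ) {c : ℂ} (hc : c ≠ 0) :
    ∫ u in a..b, f u * Complex.exp (c * u) =
      (f b * Complex.exp (c * b) - f a * Complex.exp (c * a)
        - ∫ u in a..b, f' u * Complex.exp (c * u)) / c := by
  have hv : ∀ x : ℝ, HasDerivAt (fun u : ℝ ↦ Complex.exp (c * u) / c) (Complex.exp (c * x)) x := by
    intro x
    have h : HasDerivAt (fun u : ℝ ↦ c * (u : ℂ)) c x := by
      simpa using (Complex.ofRealCLM.hasDerivAt (x := x)).const_mul c
    simpa [hc] using (h.cexp.div_const c)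
  rw [integral_mul_deriv_eq_deriv_mul (fun x _ ↦ hf x) (fun x _ ↦ hv x)
    (hf'.intervalIntegrable _ _) (Continuous.intervalIntegrable (by fun_prop) _ _)]
  simp_rw [mul_div_assoc', intervalIntegral.integral_div]
  ring

/-- Quadratic decay of the Fourier transform of a `C²` function on `[0, δ]` that vanishes at the
endpoints. -/
theorem norm_integral_mul_cexp_le {f f' f'' : ℝ → ℂ} (hf : ∀ x, HasDerivAt f (f' x) x)
    (hf' : ∀ x, HasDerivAt f' (f'' x) x) (hf'' : Continuous f'') {δ B₁ B₂ : ℝ} (hδ : 0 ≤ δ)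
    (h0 : f 0 = 0) (h1 : f δ = 0) (hB₁ : ∀ x ∈ Set.Icc 0 δ, ‖f' x‖ ≤ B₁)
    (hB₂ : ∀ x ∈ Set.Icc 0 δ, ‖f'' x‖ ≤ B₂) {y : ℝ} (hy : y ≠ 0) :
    ‖∫ u in (0 : ℝ)..δ, f u * Complex.exp (-(y * Complex.I) * u)‖
      ≤ (2 * B₁ + B₂ * δ) / y ^ 2 := by
  have hc : -((y : ℂ) * Complex.I) ≠ 0 := by simp [hy]
  have hcont : Continuous f' := continuous_iff_continuousAt.2 fun x ↦ (hf' x).continuousAt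
  have hexp : ∀ u : ℝ, ‖Complex.exp (-(y * Complex.I) * u)‖ = 1 := by
    intro u; simp [Complex.norm_exp]
  rw [integral_mul_cexp_eq_of_hasDerivAt hf hcont _ _ hc,
    integral_mul_cexp_eq_of_hasDerivAt hf' hf'' _ _ hc, h0, h1]
  have hint : ‖∫ u in (0 : ℝ)..δ, f'' u * Complex.exp (-(y * Complex.I) * u)‖ ≤ B₂ * δ := by
    have := intervalIntegral.norm_integral_le_of_norm_le_const (a := 0) (b := δ) (C := B₂)
      (f := fun u ↦ f'' u * Complex.exp (-(y * Complex.I) * u)) (fun x hx ↦ by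
        rw [norm_mul, hexp, mul_one]
        rw [Set.uIoc_of_le hδ] at hx
        exact hB₂ x ⟨hx.1.le, hx.2⟩)
    simpa [abs_of_nonneg hδ] using this
  have e1 := hB₁ 0 ⟨le_rfl, hδ⟩
  have e2 := hB₁ δ ⟨hδ, le_rfl⟩
  rw [zero_mul, zero_mul, sub_zero, zero_sub, norm_div, norm_neg, norm_div, div_div]
  have : ‖-((y : ℂ) * Complex.I)‖ * ‖-((y : ℂ) * Complex.I)‖ = y ^ 2 := by
    simp [← sq]
  rw [this]
  gcongr
  refine (norm_sub_le _ _).trans ?_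
  refine add_le_add ((norm_sub_le _ _).trans ?_) hint
  rw [norm_mul, norm_mul, hexp, hexp]
  linarith

/-- Simultaneous Dirichlet approximation, with multiples of a prescribed step `τ`. -/
theorem exists_nat_norm_cexp_sub_one_le (N M : ℕ) (hM : 0 < M) (τ : ℝ) (y : ℕ → ℝ) :
    ∃ k : ℕ, 1 ≤ k ∧ k ≤ M ^ N ∧ ∀ n < N,
      ‖Complex.exp (-(y n * Complex.I) * (k * τ : ℝ)) - 1‖ ≤ 2 * π / M := by
  have hM' : (0 : ℝ) < M := by exact_mod_cast hM
  let θ : ℕ → ℝ := fun n ↦ τ * y n / (2 * π)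
  have hlt : ∀ r : ℝ, ⌊M * Int.fract r⌋₊ < M := by
    intro r
    rw [Nat.floor_lt (by positivity)]
    nlinarith [Int.fract_lt_one r]
  let g : Fin (M ^ N + 1) → (Fin N → Fin M) := fun j n ↦ ⟨⌊M * Int.fract (j * θ n)⌋₊, hlt _⟩
  obtain ⟨i, j, hij, hg⟩ := Fintype.exists_ne_map_eq_of_card_lt g (by simp)
  wlog hlt' : i < j generalizing i j
  · exact this j i hij.symm hg.symm (lt_of_le_of_ne (not_lt.1 hlt') hij.symm)
  have hlt'' : (i : ℕ) < j := hlt'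
  refine ⟨j - i, by omega, by have := j.2; omega, fun n hn ↦ ?_⟩
  have h1 : ⌊M * Int.fract (i * θ n)⌋₊ = ⌊M * Int.fract (j * θ n)⌋₊ := by
    have := congrFun hg ⟨n, hn⟩
    simpa [g] using this
  set a := Int.fract (i * θ n)
  set b := Int.fract (j * θ n)
  have ha0 : 0 ≤ M * a := mul_nonneg hM'.le (Int.fract_nonneg _)
  have hb0 : 0 ≤ M * b := mul_nonneg hM'.le (Int.fract_nonneg _)
  have h2 : |b - a| ≤ 1 / M := by
    have e : |b - a| * M = |(b - a) * M| := by rw [abs_mul, abs_of_pos hM']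
    rw [le_div_iff₀ hM', e, abs_le]
    have q1 := Nat.floor_le ha0
    have q2 := Nat.floor_le hb0
    have q3 := Nat.lt_floor_add_one (M * a)
    have q4 := Nat.lt_floor_add_one (M * b)
    rw [h1] at q1 q3
    constructor <;> linarith
  have h3 : -(y n * Complex.I) * (((j - i : ℕ) : ℝ) * τ : ℝ) =
      Complex.I * ((-(2 * π) * (b - a) : ℝ) : ℂ)
        + ((⌊i * θ n⌋ - ⌊j * θ n⌋ : ℤ) : ℂ) * (2 * π * Complex.I) := by
    have e : y n * (((j - i : ℕ) : ℝ) * τ) =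
        2 * π * (b - a) + (⌊j * θ n⌋ - ⌊i * θ n⌋ : ℤ) * (2 * π) := by
      have e1 : b + ⌊j * θ n⌋ = j * θ n := Int.fract_add_floor _
      have e2 : a + ⌊i * θ n⌋ = i * θ n := Int.fract_add_floor _
      have e3 : 2 * π * θ n = τ * y n := by simp only [θ]; field_simp
      push_cast [Nat.cast_sub hlt''.le]
      linear_combination (-2 * π) * e1 + 2 * π * e2 - ((j : ℝ) - i) * e3
    have e' : (y n : ℂ) * ((((j - i : ℕ) : ℝ) * τ : ℝ) : ℂ) =
        ((2 * π * (b - a) + (⌊j * θ n⌋ - ⌊i * θ n⌋ : ℤ) * (2 * π) : ℝ) : ℂ) := by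
      rw [← e]; push_cast; ring
    linear_combination (norm := (push_cast; ring)) (-Complex.I) * e'
  rw [h3, Complex.exp_add, Complex.exp_int_mul_two_pi_mul_I, mul_one]
  refine Real.norm_exp_I_mul_ofReal_sub_one_le.trans ?_
  rw [Real.norm_eq_abs, abs_mul, abs_neg, abs_of_pos (by positivity : 0 < 2 * π), ← mul_one_div]
  gcongr


/-- Termwise integration of the Dirichlet series of `ζ` to the right of the line `Re s = 1`. -/
theorem hasSum_integral_mul_riemannZeta {f : ℝ → ℂ} (hf : Continuous f) {δ : ℝ} (hδ : 0 ≤ δ)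
    (hf1 : ∀ x ∈ Set.Icc 0 δ, ‖f x‖ ≤ 1) {σ : ℝ} (hσ : 1 < σ) (T : ℝ) :
    HasSum (fun n : ℕ ↦ ((n + 1 : ℝ) ^ (-σ) : ℝ)
        * Complex.exp (-(Real.log (n + 1) * Complex.I) * T)
        * ∫ u in (0 : ℝ)..δ, f u * Complex.exp (-(Real.log (n + 1) * Complex.I) * u))
      (∫ u in (0 : ℝ)..δ, f u * riemannZeta (σ + (T + u : ℝ) * Complex.I)) := by
  have hsum : Summable fun n : ℕ ↦ (n + 1 : ℝ) ^ (-σ) := by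
    have := (summable_nat_add_iff 1).2 (Real.summable_nat_rpow.2 (by linarith : -σ < -1))
    simpa using this
  have hterm : ∀ (n : ℕ) (u : ℝ), 1 / (n + 1 : ℂ) ^ (σ + (T + u : ℝ) * Complex.I : ℂ) =
      ((n + 1 : ℝ) ^ (-σ) : ℝ) * Complex.exp (-(Real.log (n + 1) * Complex.I) * T)
        * Complex.exp (-(Real.log (n + 1) * Complex.I) * u) := by
    intro n u
    have hn : (0 : ℝ) < n + 1 := by positivity
    have hn' : (n + 1 : ℂ) ≠ 0 := by exact_mod_cast hn.ne'
    have hl : Complex.log (n + 1 : ℂ) = (Real.log (n + 1) : ℝ) := by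
      rw [Complex.ofReal_log hn.le]; push_cast; rfl
    rw [Real.rpow_def_of_pos hn, one_div, ← Complex.cpow_neg, Complex.cpow_def_of_ne_zero hn', hl,
      Complex.ofReal_exp, ← Complex.exp_add, ← Complex.exp_add]
    congr 1
    push_cast
    ring
  have hexp : ∀ (n : ℕ) (u : ℝ), ‖Complex.exp (-(Real.log (n + 1) * Complex.I) * u)‖ = 1 := by
    intro n u; simp [Complex.norm_exp]
  have key := intervalIntegral.hasSum_integral_of_dominated_convergence (μ := volume)
    (a := 0) (b := δ)
    (F := fun (n : ℕ) (u : ℝ) ↦ f u * (1 / (n + 1 : ℂ) ^ (σ + (T + u : ℝ) * Complex.I : ℂ)))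
    (f := fun u ↦ f u * riemannZeta (σ + (T + u : ℝ) * Complex.I))
    (fun n _ ↦ (n + 1 : ℝ) ^ (-σ))
    (fun n ↦ by
      simp_rw [hterm]
      exact Continuous.aestronglyMeasurable (by fun_prop))
    (fun n ↦ .of_forall fun u hu ↦ by
      rw [Set.uIoc_of_le hδ] at hu
      rw [hterm, norm_mul, norm_mul, norm_mul, hexp, hexp, mul_one, mul_one, Complex.norm_real,
        Real.norm_of_nonneg (by positivity)]
      exact mul_le_of_le_one_left (by positivity) (hf1 u ⟨hu.1.le, hu.2⟩))
    (.of_forall fun _ _ ↦ hsum) intervalIntegrable_const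
    (.of_forall fun u _ ↦ by
      have hre : 1 < (σ + (T + u : ℝ) * Complex.I : ℂ).re := by simpa using hσ
      rw [zeta_eq_tsum_one_div_nat_add_one_cpow hre]
      refine (Summable.hasSum ?_).mul_left _
      refine Summable.of_norm_bounded hsum fun n ↦ ?_
      rw [hterm, norm_mul, norm_mul, hexp, hexp, mul_one, mul_one, Complex.norm_real,
        Real.norm_of_nonneg (by positivity)])
  refine (congrArg (HasSum · _) (funext fun n ↦ ?_)).mpr key
  rw [← intervalIntegral.integral_const_mul]
  refine intervalIntegral.integral_congr fun u _ ↦ ?_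
  simp only [hterm]
  ring

theorem inv_mul_inv_log_sq_le {n : ℕ} (hn : 2 ≤ n) :
    ((n : ℝ) + 1)⁻¹ * (1 / Real.log (n + 1) ^ 2) ≤
      1 / Real.log n - 1 / Real.log (n + 1) := by
  have hn' : (2 : ℝ) ≤ n := by exact_mod_cast hn
  have h1 : 0 < Real.log n := Real.log_pos (by linarith)
  have h2 : Real.log n ≤ Real.log (n + 1) := Real.log_le_log (by linarith) (by linarith)
  have h3 : 0 < Real.log (n + 1) := h1.trans_le h2
  have h4 : ((n : ℝ) + 1)⁻¹ ≤ Real.log (n + 1) - Real.log n := by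
    rw [← Real.log_div (by linarith) (by linarith)]
    refine le_trans (le_of_eq ?_) (Real.one_sub_inv_le_log_of_pos (by positivity))
    field_simp
    ring
  rw [div_sub_div _ _ h1.ne' h3.ne', one_mul, mul_one, mul_one_div]
  gcongr
  nlinarith

/-- Shifting by an almost period of `n ↦ n ^ (-it)`, `n ≤ N`, changes a smooth average of `ζ` little,
uniformly in `σ > 1`. -/
theorem norm_integral_mul_riemannZeta_sub_le {f : ℝ → ℂ} (hf : Continuous f) {δ C η : ℝ}
    (hδ : 0 ≤ δ) (hC : 0 ≤ C) (hf1 : ∀ x ∈ Set.Icc 0 δ, ‖f x‖ ≤ 1)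
    (hdecay : ∀ y : ℝ, y ≠ 0 →
      ‖∫ u in (0 : ℝ)..δ, f u * Complex.exp (-(y * Complex.I) * u)‖ ≤ C / y ^ 2)
    {T : ℝ} {N : ℕ} (hN : 2 ≤ N)
    (hT : ∀ n < N, ‖Complex.exp (-(Real.log (n + 1) * Complex.I) * T) - 1‖ ≤ η)
    {σ : ℝ} (hσ : 1 < σ) :
    ‖(∫ u in (0 : ℝ)..δ, f u * riemannZeta (σ + (T + u : ℝ) * Complex.I))
        - ∫ u in (0 : ℝ)..δ, f u * riemannZeta (σ + (0 + u : ℝ) * Complex.I)‖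
      ≤ N * (η * δ) + 2 * C / Real.log N := by
  have hη : 0 ≤ η := (norm_nonneg _).trans (hT 0 (by omega))
  have h := (hasSum_integral_mul_riemannZeta hf hδ hf1 hσ T).sub
    (hasSum_integral_mul_riemannZeta hf hδ hf1 hσ 0)
  rw [← h.tsum_eq]
  set c : ℕ → ℂ := fun n ↦
    ∫ u in (0 : ℝ)..δ, f u * Complex.exp (-(Real.log (n + 1) * Complex.I) * u)
  have hexp : ∀ (n : ℕ) (u : ℝ), ‖Complex.exp (-(Real.log (n + 1) * Complex.I) * u)‖ = 1 := by
    intro n u; simp [Complex.norm_exp]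
  have hcδ : ∀ n, ‖c n‖ ≤ δ := by
    intro n
    have := intervalIntegral.norm_integral_le_of_norm_le_const (a := 0) (b := δ) (C := 1)
      (f := fun u ↦ f u * Complex.exp (-(Real.log (n + 1) * Complex.I) * u)) (fun x hx ↦ by
        rw [norm_mul, hexp, mul_one]
        rw [Set.uIoc_of_le hδ] at hx
        exact hf1 x ⟨hx.1.le, hx.2⟩)
    rwa [sub_zero, abs_of_nonneg hδ, one_mul] at this
  set t : ℕ → ℂ := fun n ↦ ((n + 1 : ℝ) ^ (-σ) : ℝ)
        * Complex.exp (-(Real.log (n + 1) * Complex.I) * T) * c n -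
      ((n + 1 : ℝ) ^ (-σ) : ℝ)
        * Complex.exp (-(Real.log (n + 1) * Complex.I) * (0 : ℝ)) * c n with ht
  have htn : ∀ n : ℕ, ‖t n‖ ≤
      (n + 1 : ℝ)⁻¹ * ‖Complex.exp (-(Real.log (n + 1) * Complex.I) * T) - 1‖ * ‖c n‖ := by
    intro n
    have e : t n = ((n + 1 : ℝ) ^ (-σ) : ℝ)
        * (Complex.exp (-(Real.log (n + 1) * Complex.I) * T) - 1) * c n := by
      simp only [ht, Complex.ofReal_zero, mul_zero, Complex.exp_zero]; ring
    rw [e, norm_mul, norm_mul, Complex.norm_real, Real.norm_of_nonneg (by positivity)]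
    gcongr
    rw [← Real.rpow_neg_one]
    exact Real.rpow_le_rpow_of_exponent_le (by linarith [Nat.cast_nonneg (α := ℝ) n]) (by linarith)
  have hsmall : ∀ n < N, ‖t n‖ ≤ η * δ := by
    intro n hn
    refine (htn n).trans ?_
    have : (n + 1 : ℝ)⁻¹ ≤ 1 := inv_le_one_of_one_le₀ (by linarith [Nat.cast_nonneg (α := ℝ) n])
    calc _ ≤ 1 * η * δ := by
          gcongr
          · exact hT n hn
          · exact hcδ n
      _ = η * δ := by ring
  have hlarge : ∀ n ≥ N, ‖t n‖ ≤ 2 * C * (1 / Real.log n - 1 / Real.log (n + 1)) := by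
    intro n hn
    have hn2 : (2 : ℝ) ≤ n := by exact_mod_cast hN.trans hn
    have hl : Real.log (n + 1) ≠ 0 := (Real.log_pos (by linarith)).ne'
    refine (htn n).trans ?_
    have h2 : ‖Complex.exp (-(Real.log (n + 1) * Complex.I) * T) - 1‖ ≤ 2 := by
      refine (norm_sub_le _ _).trans ?_
      rw [hexp, norm_one]; norm_num
    calc _ ≤ (n + 1 : ℝ)⁻¹ * 2 * (C / Real.log (n + 1) ^ 2) := by
          gcongr
          exact hdecay _ hl
      _ = 2 * C * ((n + 1 : ℝ)⁻¹ * (1 / Real.log (n + 1) ^ 2)) := by ring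
      _ ≤ _ := by
          gcongr
          exact inv_mul_inv_log_sq_le (hN.trans hn)
  have hnorm : Summable fun n ↦ ‖t n‖ := h.summable.norm
  refine (norm_tsum_le_tsum_norm hnorm).trans
    (Real.tsum_le_of_sum_range_le (fun _ ↦ norm_nonneg _) fun K ↦ ?_)
  have hbelow : ∀ K ≤ N, ∑ n ∈ Finset.range K, ‖t n‖ ≤ N * (η * δ) := by
    intro K hK
    calc _ ≤ ∑ n ∈ Finset.range K, η * δ :=
          Finset.sum_le_sum fun n hn ↦ hsmall n ((Finset.mem_range.1 hn).trans_le hK)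
      _ = K * (η * δ) := by simp
      _ ≤ _ := by gcongr
  have habove : ∀ K ≥ N, ∑ n ∈ Finset.range K, ‖t n‖ ≤
      N * (η * δ) + 2 * C * (1 / Real.log N - 1 / Real.log K) := by
    intro K hK
    induction K, hK using Nat.le_induction with
    | base => simpa using hbelow N le_rfl
    | succ K hK ih =>
      rw [Finset.sum_range_succ]
      have := hlarge K hK
      push_cast
      linarith
  have hlogN : 0 ≤ Real.log N := Real.log_natCast_nonneg N
  rcases le_total K N with hK | hK
  · have : 0 ≤ 2 * C / Real.log N := by positivity
    linarith [hbelow K hK]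
  · refine (habove K hK).trans ?_
    have : 0 ≤ 2 * C * (1 / Real.log K) := by
      have := Real.log_natCast_nonneg K
      positivity
    have e : 2 * C * (1 / Real.log N - 1 / Real.log K) =
      2 * C / Real.log N - 2 * C * (1 / Real.log K) := by ring
    linarith


theorem tendsto_integral_mul_riemannZeta {f : ℝ → ℂ} (hf : Continuous f) {δ T : ℝ}
    (hδ : 0 ≤ δ) (hT : 0 < T) :
    Tendsto (fun a : ℝ ↦ ∫ u in (0 : ℝ)..δ,
        f u * riemannZeta ((1 + a : ℝ) + (T + u : ℝ) * Complex.I)) (nhds 0)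
      (nhds (∫ u in (0 : ℝ)..δ, f u * riemannZeta (1 + (T + u : ℝ) * Complex.I))) := by
  have hcont : Continuous (Function.uncurry fun (a u : ℝ) ↦
      f u * riemannZeta ((1 + a : ℝ) + (T + |u| : ℝ) * Complex.I)) := by
    simp only [Function.uncurry_def]
    refine (hf.comp continuous_snd).mul (continuous_iff_continuousAt.2 fun p ↦ ?_)
    refine ContinuousAt.comp (g := riemannZeta) (differentiableAt_riemannZeta ?_).continuousAt
      (Continuous.continuousAt (by fun_prop))
    intro h
    have := congrArg Complex.im h
    simp at this
    linarith [abs_nonneg p.2]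
  have key := (continuous_parametric_intervalIntegral_of_continuous (μ := volume) (a₀ := 0) hcont
    (continuous_const (y := δ))).tendsto 0
  have e : ∀ a : ℝ, ∫ u in (0 : ℝ)..δ, f u * riemannZeta ((1 + a : ℝ) + (T + |u| : ℝ) * Complex.I)
      = ∫ u in (0 : ℝ)..δ, f u * riemannZeta ((1 + a : ℝ) + (T + u : ℝ) * Complex.I) := by
    intro a
    refine intervalIntegral.integral_congr fun u hu ↦ ?_
    rw [Set.uIcc_of_le hδ] at hu
    simp only [abs_of_nonneg hu.1]
  simp only [e] at key
  simpa using key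

theorem exists_norm_riemannZeta_sub_inv_le (δ : ℝ) :
    ∃ K : ℝ, 0 ≤ K ∧ ∀ a ∈ Set.Ioc (0 : ℝ) 1, ∀ u ∈ Set.Icc 0 δ,
      ‖riemannZeta ((1 + a : ℝ) + (u : ℝ) * Complex.I) - ((a : ℂ) + u * Complex.I)⁻¹‖ ≤ K := by
  have hc : Continuous fun p : ℝ × ℝ ↦ riemannZeta₀ ((1 + p.1 : ℝ) + (p.2 : ℝ) * Complex.I) :=
    differentiable_riemannZeta₀.continuous.comp (by fun_prop)
  obtain ⟨K, hK⟩ := (isCompact_Icc.prod isCompact_Icc :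
    IsCompact (Set.Icc (0 : ℝ) 1 ×ˢ Set.Icc (0 : ℝ) δ)).exists_bound_of_continuousOn hc.continuousOn
  refine ⟨max K 0, le_max_right _ _, fun a ha u hu ↦ ?_⟩
  have hne : ((1 + a : ℝ) + (u : ℝ) * Complex.I : ℂ) ≠ 1 := by
    intro h
    have := congrArg Complex.re h
    simp at this
    exact ha.1.ne' this
  rw [riemannZeta_eq_inv_sub_add hne]
  have e : ((1 + a : ℝ) + (u : ℝ) * Complex.I : ℂ) - 1 = (a : ℂ) + u * Complex.I := by
    push_cast; ring
  rw [e, add_sub_cancel_left]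
  exact (hK (a, u) ⟨⟨ha.1.le, ha.2⟩, hu⟩).trans (le_max_left _ _)

theorem tendsto_integral_mul_div_add_sq {q : ℝ → ℝ} (hq : Continuous q) (δ : ℝ) :
    Tendsto (fun a : ℝ ↦ ∫ u in (0 : ℝ)..δ, q u * (u ^ 2 / (a ^ 2 + u ^ 2)))
      (nhds 0) (nhds (∫ u in (0 : ℝ)..δ, q u)) := by
  refine intervalIntegral.tendsto_integral_filter_of_dominated_convergence (fun u ↦ ‖q u‖)
    (.of_forall fun a ↦ Measurable.aestronglyMeasurable (hq.measurable.mul (by fun_prop)))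
    (.of_forall fun a ↦ .of_forall fun u _ ↦ ?_) (hq.norm.intervalIntegrable _ _) ?_
  · rw [norm_mul]
    refine mul_le_of_le_one_right (norm_nonneg _) ?_
    rw [Real.norm_of_nonneg (by positivity)]
    exact div_le_one_of_le₀ (by nlinarith [sq_nonneg a]) (by positivity)
  · have h0 : ∀ᵐ u : ℝ, u ≠ 0 := by simp [ae_iff]
    filter_upwards [h0] with u hu _
    have hc : ContinuousAt (fun a : ℝ ↦ q u * (u ^ 2 / (a ^ 2 + u ^ 2))) 0 := by
      refine continuousAt_const.mul (continuousAt_const.div (by fun_prop) ?_)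
      positivity
    have := hc.tendsto
    simpa [hu] using this

theorem integral_sub_le_norm_integral_mul_riemannZeta {q : ℝ → ℝ} (hq : Continuous q) {δ K a : ℝ}
    (hδ : 0 ≤ δ) (hf1 : ∀ x ∈ Set.Icc 0 δ, |x * q x| ≤ 1) (ha : 0 < a)
    (hK : ∀ u ∈ Set.Icc 0 δ,
      ‖riemannZeta ((1 + a : ℝ) + (u : ℝ) * Complex.I) - ((a : ℂ) + u * Complex.I)⁻¹‖ ≤ K) :
    (∫ u in (0 : ℝ)..δ, q u * (u ^ 2 / (a ^ 2 + u ^ 2))) - K * δ ≤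
      ‖∫ u in (0 : ℝ)..δ, ((u * q u : ℝ) : ℂ)
        * riemannZeta ((1 + a : ℝ) + (u : ℝ) * Complex.I)‖ := by
  set z : ℝ → ℂ := fun u ↦ riemannZeta ((1 + a : ℝ) + (u : ℝ) * Complex.I)
  have hne : ∀ u : ℝ, ((a : ℂ) + u * Complex.I) ≠ 0 := by
    intro u h
    have := congrArg Complex.re h
    simp at this
    exact ha.ne' this
  have hzc : Continuous z := by
    refine continuous_iff_continuousAt.2 fun u ↦ ?_
    refine ContinuousAt.comp (g := riemannZeta) (differentiableAt_riemannZeta ?_).continuousAt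
      (Continuous.continuousAt (by fun_prop))
    intro h
    have := congrArg Complex.re h
    simp at this
    exact ha.ne' this
  have hinv : Continuous fun u : ℝ ↦ ((a : ℂ) + u * Complex.I)⁻¹ :=
    Continuous.inv₀ (by fun_prop) hne
  have hqc : Continuous fun u : ℝ ↦ ((u * q u : ℝ) : ℂ) := by fun_prop
  have hmain : Continuous fun u : ℝ ↦ ((u * q u : ℝ) : ℂ) * ((a : ℂ) + u * Complex.I)⁻¹ :=
    hqc.mul hinv
  have hrest : Continuous fun u : ℝ ↦
      ((u * q u : ℝ) : ℂ) * (z u - ((a : ℂ) + u * Complex.I)⁻¹) := hqc.mul (hzc.sub hinv)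
  have hsplit : ∫ u in (0 : ℝ)..δ, ((u * q u : ℝ) : ℂ) * z u =
      (∫ u in (0 : ℝ)..δ, ((u * q u : ℝ) : ℂ) * ((a : ℂ) + u * Complex.I)⁻¹) +
      ∫ u in (0 : ℝ)..δ, ((u * q u : ℝ) : ℂ) * (z u - ((a : ℂ) + u * Complex.I)⁻¹) := by
    rw [← intervalIntegral.integral_add (hmain.intervalIntegrable _ _)
      (hrest.intervalIntegrable _ _)]
    refine intervalIntegral.integral_congr fun u _ ↦ ?_
    ring
  have herr : ‖∫ u in (0 : ℝ)..δ, ((u * q u : ℝ) : ℂ) * (z u - ((a : ℂ) + u * Complex.I)⁻¹)‖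
      ≤ K * δ := by
    have := intervalIntegral.norm_integral_le_of_norm_le_const (a := 0) (b := δ) (C := K)
      (f := fun u ↦ ((u * q u : ℝ) : ℂ) * (z u - ((a : ℂ) + u * Complex.I)⁻¹)) (fun x hx ↦ by
        rw [Set.uIoc_of_le hδ] at hx
        have hx' : x ∈ Set.Icc 0 δ := ⟨hx.1.le, hx.2⟩
        rw [norm_mul, Complex.norm_real]
        exact (mul_le_of_le_one_left (norm_nonneg _) (hf1 x hx')).trans (hK x hx'))
    rwa [sub_zero, abs_of_nonneg hδ] at this
  have him : (∫ u in (0 : ℝ)..δ, q u * (u ^ 2 / (a ^ 2 + u ^ 2))) =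
      -(∫ u in (0 : ℝ)..δ, ((u * q u : ℝ) : ℂ) * ((a : ℂ) + u * Complex.I)⁻¹).im := by
    have h := Complex.imCLM.intervalIntegral_comp_comm
      (hmain.intervalIntegrable (μ := volume) 0 δ)
    simp only [Complex.imCLM_apply] at h
    rw [← h, ← intervalIntegral.integral_neg]
    refine intervalIntegral.integral_congr fun u _ ↦ ?_
    simp only [Complex.im_ofReal_mul, Complex.inv_im, Complex.normSq_apply]
    simp
    ring
  have h1 := Complex.abs_im_le_norm
    (∫ u in (0 : ℝ)..δ, ((u * q u : ℝ) : ℂ) * ((a : ℂ) + u * Complex.I)⁻¹)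
  have h2 := neg_le_abs
    (∫ u in (0 : ℝ)..δ, ((u * q u : ℝ) : ℂ) * ((a : ℂ) + u * Complex.I)⁻¹).im
  have h3 := norm_sub_le_norm_add
    (∫ u in (0 : ℝ)..δ, ((u * q u : ℝ) : ℂ) * ((a : ℂ) + u * Complex.I)⁻¹)
    (∫ u in (0 : ℝ)..δ, ((u * q u : ℝ) : ℂ) * (z u - ((a : ℂ) + u * Complex.I)⁻¹))
  rw [← hsplit] at h3
  linarith

theorem norm_integral_mul_riemannZeta_le {f : ℝ → ℂ} (hf : Continuous f) {δ T : ℝ}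
    (hδ : 0 ≤ δ) (hT : 0 < T) (hf1 : ∀ x ∈ Set.Icc 0 δ, ‖f x‖ ≤ 1) :
    ‖∫ u in (0 : ℝ)..δ, f u * riemannZeta (1 + (T + u : ℝ) * Complex.I)‖ ≤
      ∫ t in T..(T + δ), ‖riemannZeta (1 + t * Complex.I)‖ := by
  have hcont : ContinuousOn (fun u : ℝ ↦ riemannZeta (1 + (T + u : ℝ) * Complex.I))
      (Set.uIcc 0 δ) := by
    intro u hu
    rw [Set.uIcc_of_le hδ] at hu
    refine ContinuousAt.continuousWithinAt ?_
    refine ContinuousAt.comp (g := riemannZeta) (differentiableAt_riemannZeta ?_).continuousAt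
      (Continuous.continuousAt (by fun_prop))
    intro h
    have := congrArg Complex.im h
    simp at this
    linarith [hu.1]
  have e := intervalIntegral.integral_comp_add_left (a := 0) (b := δ)
    (fun t : ℝ ↦ ‖riemannZeta (1 + t * Complex.I)‖) T
  rw [add_zero] at e
  rw [← e]
  refine (intervalIntegral.norm_integral_le_integral_norm hδ).trans ?_
  refine intervalIntegral.integral_mono_on hδ (hf.continuousOn.mul hcont).norm.intervalIntegrable
    hcont.norm.intervalIntegrable fun u hu ↦ ?_
  rw [norm_mul]
  exact mul_le_of_le_one_left (norm_nonneg _) (hf1 u hu)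

theorem mul_inv_mul_sum_pow_eq {δ : ℝ} (hδ : δ ≠ 0) (m : ℕ) (u : ℝ) :
    u * (δ⁻¹ * ∑ k ∈ Finset.range m, (1 - u / δ) ^ (k + 1)) =
      (1 - u / δ) - (1 - u / δ) ^ (m + 1) := by
  have h := mul_neg_geom_sum (1 - u / δ) m
  have e : ∑ k ∈ Finset.range m, (1 - u / δ) ^ (k + 1) =
      (1 - u / δ) * ∑ k ∈ Finset.range m, (1 - u / δ) ^ k := by
    rw [Finset.mul_sum]
    exact Finset.sum_congr rfl fun k _ ↦ by ring
  rw [e]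
  have e2 : u * (δ⁻¹ * ((1 - u / δ) * ∑ k ∈ Finset.range m, (1 - u / δ) ^ k)) =
      (1 - u / δ) * ((1 - (1 - u / δ)) * ∑ k ∈ Finset.range m, (1 - u / δ) ^ k) := by
    field_simp
    ring
  rw [e2, h]
  ring

theorem log_sub_one_le_integral_sum_pow {δ : ℝ} (hδ : 0 < δ) (m : ℕ) :
    Real.log (m + 2) - 1 ≤
      ∫ u in (0 : ℝ)..δ, δ⁻¹ * ∑ k ∈ Finset.range m, (1 - u / δ) ^ (k + 1) := by
  have hint : ∀ k : ℕ, ∫ u in (0 : ℝ)..δ, (1 - u / δ) ^ (k + 1) = δ * (1 / (k + 2)) := by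
    intro k
    rw [intervalIntegral.integral_comp_sub_div (fun x ↦ x ^ (k + 1)) hδ.ne']
    simp [hδ.ne']
    ring_nf
  rw [intervalIntegral.integral_const_mul, intervalIntegral.integral_finsetSum
    fun k _ ↦ Continuous.intervalIntegrable (by fun_prop) _ _]
  simp_rw [hint]
  rw [← Finset.mul_sum, ← mul_assoc, inv_mul_cancel₀ hδ.ne', one_mul]
  have h := log_add_one_le_harmonic (m + 1)
  rw [harmonic, Finset.sum_range_succ'] at h
  push_cast at h
  have e : ∑ k ∈ Finset.range m, (1 : ℝ) / (k + 2) =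
      ∑ k ∈ Finset.range m, ((k : ℝ) + 1 + 1)⁻¹ :=
    Finset.sum_congr rfl fun k _ ↦ by rw [one_div]; ring
  rw [e]
  have e2 : (m : ℝ) + 1 + 1 = m + 2 := by ring
  rw [e2] at h
  norm_num at h
  linarith

theorem norm_integral_sub_pow_mul_cexp_le {δ : ℝ} (hδ : 0 < δ) (m : ℕ) {y : ℝ} (hy : y ≠ 0) :
    ‖∫ u in (0 : ℝ)..δ, (((1 - u / δ) - (1 - u / δ) ^ (m + 1) : ℝ) : ℂ)
        * Complex.exp (-(y * Complex.I) * u)‖ ≤ ((m + 2) ^ 2 / δ) / y ^ 2 := by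
  have hx : ∀ u : ℝ, HasDerivAt (fun u : ℝ ↦ 1 - u / δ) (-(1 / δ)) u := fun u ↦ by
    simpa using ((hasDerivAt_id u).div_const δ).const_sub 1
  have h1 : ∀ u : ℝ, HasDerivAt (fun u : ℝ ↦ (1 - u / δ) - (1 - u / δ) ^ (m + 1))
      (((m + 1) * (1 - u / δ) ^ m - 1) / δ) u := fun u ↦ by
    refine ((hx u).sub ((hx u).pow (m + 1))).congr_deriv ?_
    simp
    ring
  have h2 : ∀ u : ℝ, HasDerivAt (fun u : ℝ ↦ ((m + 1) * (1 - u / δ) ^ m - 1) / δ)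
      (-((m + 1) * m * (1 - u / δ) ^ (m - 1)) / δ ^ 2) u := fun u ↦ by
    refine (((((hx u).pow m).const_mul ((m : ℝ) + 1)).sub_const 1).div_const δ).congr_deriv ?_
    field_simp
  have hx01 : ∀ x ∈ Set.Icc 0 δ, 0 ≤ 1 - x / δ ∧ 1 - x / δ ≤ 1 := fun x hx ↦
    ⟨sub_nonneg.2 (div_le_one_of_le₀ hx.2 hδ.le), sub_le_self _ (div_nonneg hx.1 hδ.le)⟩
  refine (norm_integral_mul_cexp_le (B₁ := (m + 1) / δ) (B₂ := (m + 1) * m / δ ^ 2)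
    (fun x ↦ (h1 x).ofReal_comp) (fun x ↦ (h2 x).ofReal_comp)
    (by fun_prop) hδ.le (by simp) (by simp [hδ.ne']) (fun x hx ↦ ?_) (fun x hx ↦ ?_) hy).trans ?_
  · obtain ⟨p0, p1⟩ := hx01 x hx
    have q0 : 0 ≤ (1 - x / δ) ^ m := by positivity
    have q1 : (1 - x / δ) ^ m ≤ 1 := pow_le_one₀ p0 p1
    rw [Complex.norm_real, Real.norm_eq_abs, abs_div, abs_of_pos hδ]
    gcongr
    have hm : (0 : ℝ) ≤ m := m.cast_nonneg
    rw [abs_le]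
    constructor <;> nlinarith
  · obtain ⟨p0, p1⟩ := hx01 x hx
    have q1 : (1 - x / δ) ^ (m - 1) ≤ 1 := pow_le_one₀ p0 p1
    rw [Complex.norm_real, Real.norm_eq_abs, neg_div, abs_neg, abs_of_nonneg (by positivity)]
    gcongr ?_ / _
    exact mul_le_of_le_one_right (by positivity) q1
  · gcongr
    have e : 2 * ((m + 1) / δ) + (m + 1) * m / δ ^ 2 * δ = ((m + 1) * (m + 2) : ℝ) / δ := by
      field_simp
      ring
    rw [e]
    gcongr
    nlinarith [m.cast_nonneg (α := ℝ)]

/-- Along the times produced by Dirichlet approximation, the short `L¹` norms of `ζ` on the line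
`Re s = 1` are large. -/
theorem exists_log_sub_le_integral_norm_riemannZeta {δ : ℝ} (hδ : 0 < δ) :
    ∃ K : ℝ, ∀ (m : ℕ) (τ : ℝ), 0 < τ → ∃ T : ℝ, τ ≤ T ∧
      T ≤ ((7 * ⌈Real.exp ((m + 2) ^ 2)⌉₊ : ℕ) : ℝ) ^ ⌈Real.exp ((m + 2) ^ 2)⌉₊ * τ ∧
      Real.log (m + 2) - K ≤ ∫ t in T..(T + δ), ‖riemannZeta (1 + t * Complex.I)‖ := by
  obtain ⟨K, -, hK⟩ := exists_norm_riemannZeta_sub_inv_le δ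
  refine ⟨1 + K * δ + δ + 2 / δ, fun m τ hτ ↦ ?_⟩
  set N := ⌈Real.exp ((m + 2) ^ 2)⌉₊
  have hNe : Real.exp ((m + 2) ^ 2) ≤ N := Nat.le_ceil _
  have hm0 : (0 : ℝ) ≤ m := m.cast_nonneg
  have hN2 : 2 ≤ N := by
    have h1 := Real.add_one_le_exp (((m : ℝ) + 2) ^ 2)
    have : (2 : ℝ) ≤ N := by nlinarith
    exact_mod_cast this
  obtain ⟨k, hk1, hk2, hk⟩ := exists_nat_norm_cexp_sub_one_le N (7 * N) (by omega) τ
    (fun n ↦ Real.log (n + 1))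
  have hk1' : (1 : ℝ) ≤ k := by exact_mod_cast hk1
  set T : ℝ := k * τ with hT
  have hTpos : 0 < T := by positivity
  refine ⟨T, le_mul_of_one_le_left hτ.le hk1', ?_, ?_⟩
  · rw [hT]
    gcongr
    exact_mod_cast hk2
  set q : ℝ → ℝ := fun u ↦ δ⁻¹ * ∑ k ∈ Finset.range m, (1 - u / δ) ^ (k + 1)
  set f : ℝ → ℂ := fun u ↦ ((u * q u : ℝ) : ℂ) with hf
  have hfe : ∀ u, f u = (((1 - u / δ) - (1 - u / δ) ^ (m + 1) : ℝ) : ℂ) := fun u ↦ by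
    rw [hf, ← mul_inv_mul_sum_pow_eq hδ.ne']
  have hqc : Continuous q := by fun_prop
  have hfc : Continuous f := by fun_prop
  have hf1 : ∀ x ∈ Set.Icc 0 δ, ‖f x‖ ≤ 1 := by
    intro x hx
    have p0 : 0 ≤ 1 - x / δ := sub_nonneg.2 (div_le_one_of_le₀ hx.2 hδ.le)
    have p1 : 1 - x / δ ≤ 1 := sub_le_self _ (div_nonneg hx.1 hδ.le)
    have q0 : (1 - x / δ) ^ (m + 1) ≤ 1 - x / δ := pow_le_of_le_one p0 p1 (by omega)
    have q1 : 0 ≤ (1 - x / δ) ^ (m + 1) := by positivity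
    rw [hfe, Complex.norm_real, Real.norm_of_nonneg (by linarith)]
    linarith
  have hdecay : ∀ y : ℝ, y ≠ 0 →
      ‖∫ u in (0 : ℝ)..δ, f u * Complex.exp (-(y * Complex.I) * u)‖
        ≤ ((m + 2) ^ 2 / δ) / y ^ 2 := by
    intro y hy
    simp_rw [hfe]
    exact norm_integral_sub_pow_mul_cexp_le hδ m hy
  have herr : N * (2 * π / (7 * N : ℕ) * δ) + 2 * ((m + 2) ^ 2 / δ) / Real.log N
      ≤ δ + 2 / δ := by
    have hNpos : (0 : ℝ) < N := by positivity
    refine add_le_add ?_ ?_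
    · have e : N * (2 * π / (7 * N : ℕ) * δ) = 2 * π / 7 * δ := by push_cast; field_simp
      rw [e]
      refine mul_le_of_le_one_left hδ.le ?_
      have := Real.pi_lt_d2
      linarith
    · have hl : ((m : ℝ) + 2) ^ 2 ≤ Real.log N := (Real.le_log_iff_exp_le hNpos).2 hNe
      have hl0 : 0 < Real.log N := lt_of_lt_of_le (by positivity) hl
      rw [div_le_iff₀ hl0, mul_div_assoc', div_mul_eq_mul_div]
      gcongr
  have hlow : ∀ a ∈ Set.Ioc (0 : ℝ) 1,
      (∫ u in (0 : ℝ)..δ, q u * (u ^ 2 / (a ^ 2 + u ^ 2))) - K * δ ≤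
        ‖∫ u in (0 : ℝ)..δ, f u * riemannZeta ((1 + a : ℝ) + (T + u : ℝ) * Complex.I)‖
          + (δ + 2 / δ) := by
    intro a ha
    have h1 := integral_sub_le_norm_integral_mul_riemannZeta hqc hδ.le
      (fun x hx ↦ by simpa [hf] using hf1 x hx) ha.1 (hK a ha)
    have h2 := (norm_integral_mul_riemannZeta_sub_le hfc hδ.le (by positivity) hf1 hdecay
      hN2 hk (by linarith [ha.1] : 1 < 1 + a)).trans herr
    rw [norm_sub_rev] at h2
    have h3 := norm_sub_norm_le
      (∫ u in (0 : ℝ)..δ, f u * riemannZeta ((1 + a : ℝ) + (0 + u : ℝ) * Complex.I))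
      (∫ u in (0 : ℝ)..δ, f u * riemannZeta ((1 + a : ℝ) + (T + u : ℝ) * Complex.I))
    simp only [zero_add] at h2 h3
    linarith
  have hlim1 := ((tendsto_integral_mul_div_add_sq hqc δ).sub_const (K * δ)).mono_left
    (nhdsWithin_le_nhds (s := Set.Ioi 0))
  have hlim2 := ((tendsto_integral_mul_riemannZeta hfc hδ.le hTpos).norm.add_const
    (δ + 2 / δ)).mono_left (nhdsWithin_le_nhds (s := Set.Ioi 0))
  have hle := le_of_tendsto_of_tendsto hlim1 hlim2 (by
    filter_upwards [Ioc_mem_nhdsGT (zero_lt_one (α := ℝ))] with a ha using hlow a ha)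
  have hq1 := log_sub_one_le_integral_sum_pow hδ m
  have hup := norm_integral_mul_riemannZeta_le hfc hδ.le hTpos hf1
  linarith

theorem log_log_log_le {A τ T : ℝ} (hA : 3 ≤ A) (hτ : τ ≤ A) (hT : 16 ≤ T)
    (h : T ≤ ((7 * ⌈Real.exp (A ^ 2)⌉₊ : ℕ) : ℝ) ^ ⌈Real.exp (A ^ 2)⌉₊ * τ) :
    Real.log (Real.log (Real.log T)) ≤ 3 * Real.log A := by
  have he : (2.7 : ℝ) ≤ Real.exp 1 := by linarith [Real.exp_one_gt_d9]
  have hl1 : 1 < Real.log T :=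
    (Real.lt_log_iff_exp_lt (by linarith)).2 (by linarith [Real.exp_one_lt_d9])
  have hl2 : 0 < Real.log (Real.log T) := Real.log_pos hl1
  set N := ⌈Real.exp (A ^ 2)⌉₊
  have hN0 : (0 : ℝ) ≤ N := N.cast_nonneg
  have hNle : (N : ℝ) ≤ 2 * Real.exp (A ^ 2) := by
    have h1 := Nat.ceil_lt_add_one (Real.exp_pos (A ^ 2)).le
    have h2 := Real.one_le_exp (sq_nonneg A)
    linarith
  have hTle : T ≤ Real.exp (N * (7 * N) + A) := by
    refine h.trans ?_
    rw [Real.exp_add, Real.exp_nat_mul]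
    have h1 := Real.add_one_le_exp A
    have h2 := Real.add_one_le_exp (7 * N : ℝ)
    push_cast
    calc (7 * N : ℝ) ^ N * τ ≤ (7 * N : ℝ) ^ N * Real.exp A := by
          gcongr
          linarith
      _ ≤ _ := by
          gcongr
          linarith
  have h1 : N * (7 * N) + A ≤ Real.exp (A ^ 3) := by
    have e1 : Real.exp (A ^ 2) * Real.exp (A ^ 2) = Real.exp (2 * A ^ 2) := by
      rw [← Real.exp_add]; ring_nf
    have e2 : N * (7 * N) ≤ 28 * Real.exp (2 * A ^ 2) := by
      calc N * (7 * N) ≤ (2 * Real.exp (A ^ 2)) * (7 * (2 * Real.exp (A ^ 2))) := by gcongr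
        _ = 28 * Real.exp (2 * A ^ 2) := by rw [← e1]; ring
    have e3 : A ≤ Real.exp (2 * A ^ 2) := by nlinarith [Real.add_one_le_exp (2 * A ^ 2)]
    have e4 : (29 : ℝ) ≤ Real.exp 4 := by
      have : Real.exp 4 = Real.exp 1 ^ 4 := by rw [← Real.exp_nat_mul]; norm_num
      rw [this]
      calc (29 : ℝ) ≤ 2.7 ^ 4 := by norm_num
        _ ≤ _ := by gcongr
    calc N * (7 * N) + A ≤ 29 * Real.exp (2 * A ^ 2) := by linarith
      _ ≤ Real.exp 4 * Real.exp (2 * A ^ 2) := by gcongr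
      _ = Real.exp (4 + 2 * A ^ 2) := (Real.exp_add _ _).symm
      _ ≤ Real.exp (A ^ 3) := by
          refine Real.exp_le_exp.2 ?_
          nlinarith [mul_nonneg (sub_nonneg.2 hA) (sq_nonneg A)]
  have h2 : Real.log T ≤ Real.exp (A ^ 3) :=
    ((Real.log_le_iff_le_exp (by linarith)).2 hTle).trans h1
  have h3 : Real.log (Real.log T) ≤ A ^ 3 := (Real.log_le_iff_le_exp (by linarith)).2 h2
  calc _ ≤ Real.log (A ^ 3) := Real.log_le_log hl2 h3
    _ = 3 * Real.log A := by rw [Real.log_pow]; norm_num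

theorem stmt_16 (δ : ℝ) (hδ : 0 < δ)  :
    ∃ c > (0 : ℝ), ∀ T₀ : ℝ, (16 : ℝ) ≤ T₀ → ∃ T : ℝ, T₀ ≤ T ∧
      c * Real.log (Real.log (Real.log T)) ≤ ∫ t in T..(T + δ), ‖riemannZeta (1 + t * Complex.I)‖ ^ ((1 : ℝ)) := by
  obtain ⟨K, hK⟩ := exists_log_sub_le_integral_norm_riemannZeta hδ
  refine ⟨1 / 6, by norm_num, fun T₀ hT₀ ↦ ?_⟩
  obtain ⟨m, hm⟩ := exists_nat_ge (max T₀ (Real.exp (2 * K)))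
  have hm1 : T₀ ≤ m := (le_max_left _ _).trans hm
  have hm2 : Real.exp (2 * K) ≤ m := (le_max_right _ _).trans hm
  obtain ⟨T, hT1, hT2, hT3⟩ := hK m T₀ (by linarith)
  refine ⟨T, hT1, ?_⟩
  have h1 := log_log_log_le (by linarith : (3 : ℝ) ≤ m + 2) (by linarith) (hT₀.trans hT1) hT2
  have h2 : 2 * K ≤ Real.log (m + 2) := (Real.le_log_iff_exp_le (by linarith)).2 (by linarith)
  simp only [Real.rpow_one]
  linarith
end

section
/- For every fixed δ > 0 there exists a constant c > 0 such that for every T₀ ≥ 16 there exists T ≥ T₀ with ∫_T^{T+δ} |ζ(1+it)|^{−1} dt ≥ c · log log log T. (Equivalently, ∫_T^{T+δ} |ζ(1+it)|^{−1} dt = Ω(log log log T) as T → ∞.) -/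
open Complex Real Filter MeasureTheory intervalIntegral

lemma norm_integral_exp_mul_I_le (θ a b : ℝ) (hθ : θ ≠ 0) :
    ‖∫ t in a..b, cexp ((θ * t : ℝ) * I)‖ ≤ 2 / |θ| := by
  have hc : (θ * I : ℂ) ≠ 0 := mul_ne_zero (by exact_mod_cast hθ) I_ne_zero
  have h : ∀ t : ℝ, cexp ((θ * t : ℝ) * I) = cexp ((θ * I) * t) := fun t ↦ by
    congr 1; push_cast; ring
  have hn : ∀ t : ℝ, ‖cexp ((θ * I) * t)‖ = 1 := fun t ↦ by
    rw [← h]; exact norm_exp_ofReal_mul_I _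
  simp_rw [h]
  rw [integral_exp_mul_complex hc, norm_div, norm_mul, norm_I, mul_one, norm_real, Real.norm_eq_abs]
  gcongr
  exact (norm_sub_le _ _).trans (by rw [hn, hn]; norm_num)

lemma one_le_mul_abs_log_div {a b : ℕ} (ha : 0 < a) (hb : 0 < b) (hab : a ≠ b) :
    1 ≤ (a + 1 : ℝ) * |Real.log a - Real.log b| := by
  have ha' : (0 : ℝ) < a := by exact_mod_cast ha
  have hb' : (0 : ℝ) < b := by exact_mod_cast hb
  rcases lt_or_gt_of_ne hab with h | h
  · have h1 : (a : ℝ) + 1 ≤ b := by exact_mod_cast h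
    have h2 := Real.one_sub_inv_le_log_of_pos (div_pos hb' ha')
    rw [Real.log_div hb'.ne' ha'.ne', inv_div] at h2
    have h3 : (a : ℝ) / b ≤ a / (a + 1) := by gcongr
    have h4 : (a + 1 : ℝ) * (1 - a / (a + 1)) = 1 := by field_simp; ring
    rw [abs_sub_comm]
    calc (1 : ℝ) = (a + 1 : ℝ) * (1 - a / (a + 1)) := h4.symm
      _ ≤ (a + 1 : ℝ) * |Real.log b - Real.log a| := by
        gcongr
        exact le_trans (by linarith) (le_abs_self _)
  · have h1 : (b : ℝ) + 1 ≤ a := by exact_mod_cast h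
    have h2 := Real.one_sub_inv_le_log_of_pos (div_pos ha' hb')
    rw [Real.log_div ha'.ne' hb'.ne', inv_div] at h2
    have h4 : 1 ≤ (a + 1 : ℝ) * (1 - b / a) := by
      have : (a + 1 : ℝ) * (1 - b / a) = 1 + (a * (a - b - 1) + (a - b)) / a := by
        field_simp; ring
      rw [this]
      have : 0 ≤ ((a : ℝ) * (a - b - 1) + (a - b)) / a :=
        div_nonneg (by nlinarith) ha'.le
      linarith
    exact h4.trans (by gcongr; exact h2.trans (le_abs_self _))

lemma one_add_log_le_mul_abs {a b n Q : ℕ} (ha : 0 < a) (hb : 0 < b) (hn : 0 < n)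
    (haQ : a ≤ Q) (hne : a ≠ b * n) :
    1 + Real.log n ≤ (Q + 1 : ℝ) ^ 2 * |Real.log a - Real.log b - Real.log n| := by
  have hb' : (0 : ℝ) < b := by exact_mod_cast hb
  have hn' : (0 : ℝ) < n := by exact_mod_cast hn
  have ha' : (0 : ℝ) < a := by exact_mod_cast ha
  have haQ' : (a : ℝ) ≤ Q := by exact_mod_cast haQ
  have h := one_le_mul_abs_log_div ha (Nat.mul_pos hb hn) hne
  push_cast at h
  rw [Real.log_mul hb'.ne' hn'.ne', ← sub_sub] at h
  set x := |Real.log a - Real.log b - Real.log n| with hx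
  have h1 : 1 ≤ (Q + 1 : ℝ) * x := h.trans (by gcongr)
  have h2 : Real.log a ≤ Q - 1 := (Real.log_le_sub_one_of_pos ha').trans (by linarith)
  have h3 : 0 ≤ Real.log b := Real.log_nonneg (by exact_mod_cast hb)
  have h4 : -(Real.log a - Real.log b - Real.log n) ≤ x := neg_le_abs _
  have hQ : (1 : ℝ) ≤ Q := le_trans (by exact_mod_cast ha) haQ'
  nlinarith [mul_le_mul_of_nonneg_left h1 (by linarith : (0 : ℝ) ≤ Q),
    abs_nonneg (Real.log a - Real.log b - Real.log n)]

lemma sum_one_div_mul_sq_one_add_log_le (s : Finset ℕ) :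
    ∑ n ∈ s, 1 / ((n : ℝ) * (1 + Real.log n) ^ 2) ≤ 2 := by
  have key : ∀ m : ℕ, ∑ n ∈ Finset.range (m + 2), 1 / ((n : ℝ) * (1 + Real.log n) ^ 2)
      ≤ 2 - 1 / (1 + Real.log (m + 1 : ℕ)) := by
    intro m
    induction m with
    | zero => norm_num [Finset.sum_range_succ]
    | succ m ih =>
      rw [Finset.sum_range_succ]
      refine (add_le_add_left ih _).trans ?_
      set x : ℝ := Real.log (m + 1 : ℕ) with hx
      set y : ℝ := Real.log (m + 1 + 1 : ℕ) with hy
      have hx0 : 0 ≤ x := Real.log_natCast_nonneg _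
      have hxy : x ≤ y := Real.log_le_log (by positivity) (by push_cast; linarith)
      have h1 : 1 / ((m + 1 + 1 : ℕ) : ℝ) ≤ y - x := by
        rw [hx, hy, ← Real.log_div (by positivity) (by positivity)]
        refine le_trans ?_ (Real.one_sub_inv_le_log_of_pos (by positivity))
        apply le_of_eq
        push_cast
        field_simp
        ring
      have h2 : 1 / (((m + 1 + 1 : ℕ) : ℝ) * (1 + y) ^ 2) ≤ 1 / (1 + x) - 1 / (1 + y) := by
        have : 1 / (1 + x) - 1 / (1 + y) = (y - x) / ((1 + x) * (1 + y)) := by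
          have : 1 + x ≠ 0 := by positivity
          have : 1 + y ≠ 0 := by linarith
          field_simp; ring
        rw [this, ← div_div, sq]
        gcongr
      show 2 - 1 / (1 + x) + 1 / (((m + 1 + 1 : ℕ) : ℝ) * (1 + y) ^ 2) ≤ 2 - 1 / (1 + y)
      linarith
  obtain ⟨m, hm⟩ := s.exists_nat_subset_range
  refine (Finset.sum_le_sum_of_subset_of_nonneg
    (hm.trans (Finset.range_mono (Nat.le_add_right m 2)))
    (fun i _ _ ↦ by positivity)).trans ((key m).trans ?_)
  have : 0 ≤ Real.log (m + 1 : ℕ) := Real.log_natCast_nonneg _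
  have : 0 ≤ 1 / (1 + Real.log (m + 1 : ℕ)) := by positivity
  linarith

lemma log_one_add_log_le_sum (N : ℕ) :
    Real.log (1 + Real.log N) ≤ ∑ n ∈ Finset.Icc 1 N, 1 / ((n : ℝ) * (1 + Real.log n)) := by
  suffices h : ∀ m : ℕ, Real.log (1 + Real.log (m + 1 : ℕ)) ≤
      ∑ n ∈ Finset.Icc 1 m, 1 / ((n : ℝ) * (1 + Real.log n)) by
    rcases Nat.eq_zero_or_pos N with rfl | hN
    · simp
    refine le_trans ?_ (h N)
    have h1 : 0 ≤ Real.log N := Real.log_nonneg (by exact_mod_cast hN)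
    have h0 : (0 : ℝ) < N := by exact_mod_cast hN
    gcongr
    simp
  intro m
  induction m with
  | zero => simp
  | succ m ih =>
    rw [Finset.sum_Icc_succ_top (by omega)]
    refine le_trans ?_ (add_le_add_left ih _)
    set x : ℝ := Real.log (m + 1 : ℕ) with hx
    set y : ℝ := Real.log (m + 1 + 1 : ℕ) with hy
    have hx0 : 0 ≤ x := Real.log_natCast_nonneg _
    have hxy : x ≤ y := Real.log_le_log (by positivity) (by push_cast; linarith)
    have h1 : y - x ≤ 1 / ((m + 1 : ℕ) : ℝ) := by
      rw [hx, hy, ← Real.log_div (by positivity) (by positivity)]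
      refine (Real.log_le_sub_one_of_pos (by positivity)).trans (le_of_eq ?_)
      push_cast
      field_simp
      ring
    have h2 : Real.log (1 + y) - Real.log (1 + x) ≤ (y - x) / (1 + x) := by
      rw [← Real.log_div (by positivity) (by positivity)]
      refine (Real.log_le_sub_one_of_pos (by positivity)).trans (le_of_eq ?_)
      field_simp
      ring
    have h3 : (y - x) / (1 + x) ≤ 1 / (((m + 1 : ℕ) : ℝ) * (1 + x)) := by
      rw [← div_div]; gcongr
    linarith

lemma sum_one_div_sq_le (N : ℕ) : ∑ d ∈ Finset.Icc 1 N, 1 / (d : ℝ) ^ 2 ≤ 2 := by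
  suffices h : ∀ m : ℕ, ∑ d ∈ Finset.Icc 1 (m + 1), 1 / (d : ℝ) ^ 2 ≤ 2 - 1 / ((m : ℝ) + 1) by
    rcases N with _ | N
    · simp
    · have := h N
      have : (0 : ℝ) ≤ 1 / ((N : ℝ) + 1) := by positivity
      linarith
  intro m
  induction m with
  | zero => norm_num
  | succ m ih =>
    rw [Finset.sum_Icc_succ_top (by omega)]
    refine (add_le_add_left ih _).trans ?_
    push_cast
    have : 1 / ((m : ℝ) + 1 + 1) ^ 2 ≤ 1 / ((m : ℝ) + 1) - 1 / ((m : ℝ) + 1 + 1) := by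
      rw [div_sub_div _ _ (by positivity) (by positivity),
        div_le_div_iff₀ (by positivity) (by positivity)]
      nlinarith [(Nat.cast_nonneg m : (0:ℝ) ≤ m)]
    linarith

lemma log_one_add_log_le_sum_squarefree (N : ℕ) :
    Real.log (1 + Real.log N) ≤
      2 * ∑ n ∈ Finset.Icc 1 N with Squarefree n, 1 / ((n : ℝ) * (1 + Real.log n)) := by
  refine (log_one_add_log_le_sum N).trans ?_
  refine le_trans ?_ (mul_le_mul_of_nonneg_right (sum_one_div_sq_le N)
    (Finset.sum_nonneg fun n _ ↦ by positivity))
  rw [Finset.sum_mul_sum, ← Finset.sum_product']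
  choose g f hfg using fun n : ℕ ↦ Nat.sq_mul_squarefree n
  have hpos : ∀ n, 1 ≤ n → 1 ≤ g n ∧ 1 ≤ f n := by
    intro n hn
    have := (hfg n).1
    constructor <;> · rw [Nat.one_le_iff_ne_zero]; intro h0; simp [h0] at this; omega
  refine (Finset.sum_le_sum (g := fun n ↦
    1 / (f n : ℝ) ^ 2 * (1 / ((g n : ℝ) * (1 + Real.log (g n))))) ?_).trans ?_
  · intro n hn
    obtain ⟨hg, hf⟩ := hpos n (Finset.mem_Icc.1 hn).1
    have hg' : (1 : ℝ) ≤ g n := by exact_mod_cast hg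
    have hf' : (1 : ℝ) ≤ f n := by exact_mod_cast hf
    have he : (n : ℝ) = (f n : ℝ) ^ 2 * g n := by exact_mod_cast (hfg n).1.symm
    have hl : 0 ≤ Real.log (g n) := Real.log_nonneg hg'
    rw [he, div_mul_div_comm, one_mul, ← mul_assoc]
    gcongr
    exact le_mul_of_one_le_left (by linarith) (one_le_pow₀ hf')
  · rw [← Finset.sum_image (f := fun x : ℕ × ℕ ↦
        1 / (x.1 : ℝ) ^ 2 * (1 / ((x.2 : ℝ) * (1 + Real.log x.2))))
      (g := fun n ↦ (f n, g n)) (s := Finset.Icc 1 N)]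
    · apply Finset.sum_le_sum_of_subset_of_nonneg
      · intro x hx
        obtain ⟨n, hn, rfl⟩ := Finset.mem_image.1 hx
        obtain ⟨hg, hf⟩ := hpos n (Finset.mem_Icc.1 hn).1
        have hN := (Finset.mem_Icc.1 hn).2
        have := (hfg n).1
        simp only [Finset.mem_product, Finset.mem_Icc, Finset.mem_filter]
        refine ⟨⟨hf, ?_⟩, ⟨hg, ?_⟩, (hfg n).2⟩
        · nlinarith [Nat.mul_le_mul hf hg, Nat.le_self_pow two_ne_zero (f n)]
        · nlinarith [Nat.one_le_pow 2 (f n) hf]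
      · intro i _ _; positivity
    · intro a _ b _ hab
      simp only [Prod.mk.injEq] at hab
      rw [← (hfg a).1, ← (hfg b).1, hab.1, hab.2]

lemma one_add_inv_pow_self_le_three (N : ℕ) : (1 + 1 / (N : ℝ)) ^ N ≤ 3 := by
  rcases Nat.eq_zero_or_pos N with rfl | hN
  · norm_num
  have h : (N : ℝ) ≠ 0 := by positivity
  calc (1 + 1 / (N : ℝ)) ^ N ≤ (Real.exp (1 / N)) ^ N := by
        gcongr; linarith [Real.add_one_le_exp (1 / (N : ℝ))]
    _ = Real.exp 1 := by rw [← Real.exp_nat_mul]; congr 1; field_simp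
    _ ≤ 3 := by linarith [Real.exp_one_lt_d9]

lemma card_divisors_le_three_mul {N n : ℕ} (hn : Squarefree n) (hnN : n ≤ N) :
    ((N.factorial ^ N).divisors.card : ℝ) ≤
      3 * (((N.factorial ^ N).divisors.filter
        fun b ↦ b * n ∈ (N.factorial ^ N).divisors).card : ℝ) := by
  set Q := N.factorial ^ N with hQ
  have hQ0 : Q ≠ 0 := pow_ne_zero _ (Nat.factorial_ne_zero N)
  have hn0 : n ≠ 0 := hn.ne_zero
  have hN : 0 < N := by omega
  have hv : ∀ p, p ∣ n → p.Prime → N ≤ Q.factorization p := by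
    intro p hp hpp
    have : 1 ≤ N.factorial.factorization p :=
      (hpp.dvd_iff_one_le_factorization (Nat.factorial_ne_zero N)).1
        ((hpp.dvd_factorial).2 ((Nat.le_of_dvd (by omega) hp).trans hnN))
    rw [hQ, Nat.factorization_pow]
    simpa using Nat.mul_le_mul_left N this
  have hnQ : n ∣ Q := (Nat.dvd_factorial (by omega) hnN).trans (dvd_pow_self _ hN.ne')
  have hfilter : (Q.divisors.filter fun b ↦ b * n ∈ Q.divisors) = (Q / n).divisors := by
    ext b
    have h1 : Q / n ≠ 0 := (Nat.div_pos (Nat.le_of_dvd (by omega) hnQ) (by omega)).ne'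
    simp only [Finset.mem_filter, Nat.mem_divisors, Nat.dvd_div_iff_mul_dvd hnQ]
    rw [mul_comm n b]
    exact ⟨fun h ↦ ⟨h.2.1, h1⟩, fun h ↦ ⟨⟨(Dvd.intro _ rfl).trans h.1, hQ0⟩, h.1, hQ0⟩⟩
  have hcard : ((Q / n).divisors.card) =
      ∏ p ∈ Q.primeFactors, (Q.factorization p - n.factorization p + 1) := by
    have h1 : Q / n ≠ 0 := (Nat.div_pos (Nat.le_of_dvd (by omega) hnQ) (by omega)).ne'
    rw [Nat.card_divisors h1]
    rw [Finset.prod_subset (Nat.primeFactors_mono (Nat.div_dvd_of_dvd hnQ) hQ0)]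
    · simp [Nat.factorization_div hnQ]
    · intro p _ hp
      rw [← Nat.support_factorization, Finsupp.notMem_support_iff] at hp
      simp [hp]
  rw [hfilter, hcard, Nat.card_divisors hQ0]
  push_cast
  have hN' : (0 : ℝ) < N := by exact_mod_cast hN
  calc ∏ p ∈ Q.primeFactors, ((Q.factorization p : ℝ) + 1)
      ≤ ∏ p ∈ Q.primeFactors, ((if p ∈ n.primeFactors then 1 + 1 / (N : ℝ) else 1) *
          (((Q.factorization p - n.factorization p : ℕ) : ℝ) + 1)) := by
        refine Finset.prod_le_prod (fun _ _ ↦ by positivity) fun p hp ↦ ?_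
        split_ifs with h
        · have h1 := Nat.prime_of_mem_primeFactors h
          have h2 := hv p (Nat.dvd_of_mem_primeFactors h) h1
          have h3 : n.factorization p = 1 :=
            Nat.factorization_eq_one_of_squarefree hn h1 (Nat.dvd_of_mem_primeFactors h)
          rw [h3, Nat.cast_sub (by omega)]
          have h4 : (N : ℝ) ≤ Q.factorization p := by exact_mod_cast h2
          have h5 : 1 ≤ 1 / (N : ℝ) * Q.factorization p := by
            rw [one_div, inv_mul_eq_div, one_le_div hN']; exact h4
          push_cast
          linarith
        · have h3 : n.factorization p = 0 := by
            rwa [← Nat.support_factorization, Finsupp.notMem_support_iff] at h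
          simp [h3]
    _ = (1 + 1 / (N : ℝ)) ^ (Q.primeFactors ∩ n.primeFactors).card *
          ∏ p ∈ Q.primeFactors, (((Q.factorization p - n.factorization p : ℕ) : ℝ) + 1) := by
        rw [Finset.prod_mul_distrib, Finset.prod_ite_mem, Finset.prod_const]
    _ ≤ 3 * ∏ p ∈ Q.primeFactors, (((Q.factorization p - n.factorization p : ℕ) : ℝ) + 1) := by
        gcongr
        refine le_trans (pow_le_pow_right₀ (by simp) ?_) (one_add_inv_pow_self_le_three N)
        have hs : Q.primeFactors ∩ n.primeFactors ⊆ Finset.Icc 1 N := by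
          intro p hp
          have hp' := (Finset.mem_inter.1 hp).2
          exact Finset.mem_Icc.2 ⟨(Nat.prime_of_mem_primeFactors hp').one_le,
            (Nat.le_of_mem_primeFactors hp').trans hnN⟩
        simpa using Finset.card_le_card hs

/-- The Fourier transform of the kernel `u ↦ i (1 - u / δ)` on `[0, δ]`. -/
noncomputable def kernelTransform (δ ξ : ℝ) : ℂ :=
  ∫ u in (0 : ℝ)..δ, I * (1 - u / δ) * cexp ((-ξ * u : ℝ) * I)

lemma kernelTransform_zero_re (δ : ℝ) : (kernelTransform δ 0).re = 0 := by
  have : kernelTransform δ 0 = I * ((∫ u in (0 : ℝ)..δ, (1 - u / δ) : ℝ) : ℂ) := by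
    rw [kernelTransform, ← intervalIntegral.integral_ofReal, ← intervalIntegral.integral_const_mul]
    simp
  rw [this, I_mul_re, ofReal_im, neg_zero]

lemma kernelTransform_eq {δ ξ : ℝ} (hδ : 0 < δ) (hξ : 0 < ξ) :
    kernelTransform δ ξ = 1 / ξ - I * (cexp (I * (-ξ * δ : ℝ)) - 1) / (δ * ξ ^ 2) := by
  have hδ' : (δ : ℂ) ≠ 0 := by exact_mod_cast hδ.ne'
  have hξ' : (ξ : ℂ) ≠ 0 := by exact_mod_cast hξ.ne'
  have hF : ∀ u : ℝ, HasDerivAt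
      (fun u : ℝ ↦ (-(1 - u / δ) / ξ - I / (δ * ξ ^ 2)) * cexp ((-ξ * u : ℝ) * I))
      (I * (1 - u / δ) * cexp ((-ξ * u : ℝ) * I)) u := by
    intro u
    have h1 : HasDerivAt (fun u : ℝ ↦ (u : ℂ)) 1 u := Complex.ofRealCLM.hasDerivAt
    have h2 : HasDerivAt (fun u : ℝ ↦ (-(1 - u / δ) / ξ - I / (δ * ξ ^ 2) : ℂ))
        (-(-(1 / δ)) / ξ : ℂ) u :=
      ((((h1.div_const (δ : ℂ)).const_sub 1).neg).div_const (ξ : ℂ)).sub_const _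
    have h3 : HasDerivAt (fun u : ℝ ↦ cexp ((-ξ * u : ℝ) * I))
        (cexp ((-ξ * u : ℝ) * I) * (-ξ * I)) u := by
      have := ((h1.const_mul (-ξ : ℂ)).mul_const I).cexp
      simpa using this
    refine (h2.mul h3).congr_deriv ?_
    field_simp
    linear_combination I_sq
  rw [kernelTransform, intervalIntegral.integral_eq_sub_of_hasDerivAt (fun u _ ↦ hF u)
    (Continuous.intervalIntegrable (by fun_prop) _ _)]
  rw [mul_comm I ((-ξ * δ : ℝ) : ℂ)]
  simp only [mul_zero, ofReal_zero, zero_mul, Complex.exp_zero]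
  field_simp
  ring

lemma kernelTransform_re_eq {δ ξ : ℝ} (hδ : 0 < δ) (hξ : 0 < ξ) :
    (kernelTransform δ ξ).re = 1 / ξ - Real.sin (ξ * δ) / (δ * ξ ^ 2) := by
  rw [kernelTransform_eq hδ hξ]
  have : (1 / ξ - I * (cexp (I * (-ξ * δ : ℝ)) - 1) / (δ * ξ ^ 2) : ℂ) =
      ((1 / ξ : ℝ) : ℂ) - (I * (cexp ((-ξ * δ : ℝ) * I) - 1)) / ((δ * ξ ^ 2 : ℝ) : ℂ) := by
    push_cast; rw [mul_comm I (_ * _ : ℂ)]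
  rw [this, sub_re, ofReal_re, div_ofReal_re, I_mul_re, sub_im, exp_ofReal_mul_I_im]
  simp

lemma kernelTransform_re_nonneg {δ ξ : ℝ} (hδ : 0 < δ) (hξ : 0 ≤ ξ) :
    0 ≤ (kernelTransform δ ξ).re := by
  rcases hξ.eq_or_lt with rfl | hξ
  · rw [kernelTransform_zero_re]
  rw [kernelTransform_re_eq hδ hξ, sub_nonneg, div_le_div_iff₀ (by positivity) hξ]
  have := Real.sin_le (by positivity : 0 ≤ ξ * δ)
  nlinarith

lemma le_kernelTransform_re {δ ξ : ℝ} (hδ : 0 < δ) (hξ : 0 < ξ) (h : 2 ≤ δ * ξ) :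
    1 / (2 * ξ) ≤ (kernelTransform δ ξ).re := by
  rw [kernelTransform_re_eq hδ hξ]
  have : Real.sin (ξ * δ) / (δ * ξ ^ 2) ≤ 1 / (2 * ξ) := by
    rw [div_le_div_iff₀ (by positivity) (by positivity)]
    nlinarith [Real.sin_le_one (ξ * δ)]
  have h2 : 1 / ξ = 1 / (2 * ξ) + 1 / (2 * ξ) := by field_simp; norm_num
  linarith

lemma norm_one_sub_div_le {δ u : ℝ} (hδ : 0 < δ) (hu : 0 ≤ u) (huδ : u ≤ δ) :
    ‖(1 - u / δ : ℂ)‖ ≤ 1 := by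
  have : (1 - u / δ : ℂ) = ((1 - u / δ : ℝ) : ℂ) := by push_cast; ring
  rw [this, norm_real, Real.norm_eq_abs, abs_le]
  have h0 : 0 ≤ u / δ := div_nonneg hu hδ.le
  have h1 : u / δ ≤ 1 := (div_le_one hδ).2 huδ
  constructor <;> linarith

lemma norm_kernelTransform_le {δ ξ : ℝ} (hδ : 0 < δ) (hξ : 0 ≤ ξ) :
    ‖kernelTransform δ ξ‖ ≤ (δ + 2) / (1 + ξ) := by
  have h1 : ‖kernelTransform δ ξ‖ ≤ δ := by
    have := intervalIntegral.norm_integral_le_of_norm_le_const (a := 0) (b := δ) (C := 1)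
      (f := fun u : ℝ ↦ I * (1 - u / δ) * cexp ((-ξ * u : ℝ) * I)) ?_
    · simpa [abs_of_pos hδ, kernelTransform] using this
    · intro u hu
      rw [Set.uIoc_of_le hδ.le] at hu
      rw [norm_mul, norm_mul, norm_I, norm_exp_ofReal_mul_I, one_mul, mul_one]
      exact norm_one_sub_div_le hδ hu.1.le hu.2
  have h2 : ξ * ‖kernelTransform δ ξ‖ ≤ 2 := by
    rcases hξ.eq_or_lt with rfl | hξ
    · simp
    rw [kernelTransform_eq hδ hξ]
    have h3 : ‖(1 / ξ : ℂ)‖ = 1 / ξ := by simp [abs_of_pos hξ]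
    have h4 : ‖I * (cexp (I * (-ξ * δ : ℝ)) - 1) / (δ * ξ ^ 2)‖ ≤ 1 / ξ := by
      rw [norm_div, norm_mul, norm_I, one_mul]
      have : ‖(δ * ξ ^ 2 : ℂ)‖ = δ * ξ ^ 2 := by simp [abs_of_pos hδ]
      rw [this, div_le_div_iff₀ (by positivity) hξ]
      have := Real.norm_exp_I_mul_ofReal_sub_one_le (x := -ξ * δ)
      rw [Real.norm_eq_abs, abs_mul, abs_neg, abs_of_pos hξ, abs_of_pos hδ] at this
      nlinarith
    calc _ ≤ ξ * (1 / ξ + 1 / ξ) := by gcongr; exact (norm_sub_le _ _).trans (by rw [h3]; gcongr)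
      _ = 2 := by field_simp; norm_num
  rw [le_div_iff₀ (by positivity)]
  linarith

/-- The Liouville function `(-1) ^ Ω(n)`, complex valued. -/
noncomputable def liouvilleC (n : ℕ) : ℂ := (-1) ^ ArithmeticFunction.cardFactors n

lemma norm_liouvilleC (n : ℕ) : ‖liouvilleC n‖ = 1 := by simp [liouvilleC]

/-- The Dirichlet polynomial `∑ λ(a) a ^ (i t)` over the divisors `a` of `Q`. -/
noncomputable def resonator (Q : ℕ) (t : ℝ) : ℂ :=
  ∑ a ∈ Q.divisors, liouvilleC a * cexp ((Real.log a * t : ℝ) * I)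

lemma continuous_resonator (Q : ℕ) : Continuous (resonator Q) := by
  unfold resonator; fun_prop

lemma norm_resonator_le (Q : ℕ) (t : ℝ) : ‖resonator Q t‖ ≤ Q.divisors.card := by
  refine (norm_sum_le _ _).trans (le_of_eq ?_)
  simp only [norm_mul, norm_liouvilleC, norm_exp_ofReal_mul_I, mul_one]
  simp

lemma norm_resonator_sq (Q : ℕ) (t : ℝ) :
    (‖resonator Q t‖ : ℂ) ^ 2 = ∑ a ∈ Q.divisors, ∑ b ∈ Q.divisors,
      liouvilleC a * liouvilleC b * cexp (((Real.log a - Real.log b) * t : ℝ) * I) := by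
  rw [← Complex.mul_conj', resonator, map_sum, Finset.sum_mul_sum]
  refine Finset.sum_congr rfl fun a _ ↦ Finset.sum_congr rfl fun b _ ↦ ?_
  rw [map_mul, ← Complex.exp_conj, map_mul, conj_I, conj_ofReal, mul_mul_mul_comm, ← Complex.exp_add]
  congr 2
  · simp [liouvilleC]
  · push_cast; ring

/-- The twisted second moment of the resonator over `[T, T + X]`. -/
noncomputable def resonatorMoment (Q : ℕ) (T X : ℝ) (n : ℕ) : ℂ :=
  ∫ t in T..(T + X), (‖resonator Q t‖ : ℂ) ^ 2 * cexp ((-Real.log n * t : ℝ) * I)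

lemma norm_resonatorMoment_sub_le {Q n : ℕ} (hn : 0 < n) (T X : ℝ) :
    ‖resonatorMoment Q T X n - X * ∑ a ∈ Q.divisors, ∑ b ∈ Q.divisors,
      (if a = b * n then liouvilleC a * liouvilleC b else 0)‖ ≤
      (Q.divisors.card : ℝ) ^ 2 * (2 * (Q + 1) ^ 2 / (1 + Real.log n)) := by
  have hlog : 0 ≤ Real.log n := Real.log_nonneg (by exact_mod_cast hn)
  have h1 : resonatorMoment Q T X n = ∑ a ∈ Q.divisors, ∑ b ∈ Q.divisors,
      liouvilleC a * liouvilleC b *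
        ∫ t in T..(T + X), cexp (((Real.log a - Real.log b - Real.log n) * t : ℝ) * I) := by
    have : ∀ t : ℝ, (‖resonator Q t‖ : ℂ) ^ 2 * cexp ((-Real.log n * t : ℝ) * I) =
        ∑ a ∈ Q.divisors, ∑ b ∈ Q.divisors, liouvilleC a * liouvilleC b *
          cexp (((Real.log a - Real.log b - Real.log n) * t : ℝ) * I) := by
      intro t
      rw [norm_resonator_sq, Finset.sum_mul]
      refine Finset.sum_congr rfl fun a _ ↦ ?_
      rw [Finset.sum_mul]
      refine Finset.sum_congr rfl fun b _ ↦ ?_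
      rw [mul_assoc, ← Complex.exp_add]
      congr 2
      push_cast; ring
    simp_rw [resonatorMoment, this]
    rw [intervalIntegral.integral_finsetSum
      fun a _ ↦ Continuous.intervalIntegrable (by fun_prop) _ _]
    refine Finset.sum_congr rfl fun a _ ↦ ?_
    rw [intervalIntegral.integral_finsetSum
      fun a _ ↦ Continuous.intervalIntegrable (by fun_prop) _ _]
    refine Finset.sum_congr rfl fun b _ ↦ ?_
    rw [intervalIntegral.integral_const_mul]
  rw [h1, Finset.mul_sum, ← Finset.sum_sub_distrib]
  have hb : ∀ a ∈ Q.divisors, ∀ b ∈ Q.divisors,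
      ‖liouvilleC a * liouvilleC b *
        (∫ t in T..(T + X), cexp (((Real.log a - Real.log b - Real.log n) * t : ℝ) * I)) -
        X * (if a = b * n then liouvilleC a * liouvilleC b else 0)‖ ≤
        2 * (Q + 1) ^ 2 / (1 + Real.log n) := by
    intro a ha b hb
    have ha0 := Nat.pos_of_mem_divisors ha
    have hb0 := Nat.pos_of_mem_divisors hb
    split_ifs with hab
    · have : Real.log a - Real.log b - Real.log n = 0 := by
        rw [hab, Nat.cast_mul, Real.log_mul (by positivity) (by positivity)]; ring
      simp only [this, zero_mul, ofReal_zero, Complex.exp_zero, intervalIntegral.integral_const,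
        add_sub_cancel_left, real_smul, mul_one]
      rw [mul_comm, sub_self, norm_zero]
      positivity
    · have h := one_add_log_le_mul_abs ha0 hb0 hn (Nat.divisor_le ha) hab
      have hne : Real.log a - Real.log b - Real.log n ≠ 0 := by
        intro h0
        rw [h0, abs_zero, mul_zero] at h
        linarith
      rw [mul_zero, sub_zero, norm_mul, norm_mul, norm_liouvilleC, norm_liouvilleC, one_mul, one_mul]
      refine (norm_integral_exp_mul_I_le _ _ _ hne).trans ?_
      rw [div_le_div_iff₀ (abs_pos.2 hne) (by positivity)]
      linarith
  calc _ ≤ ∑ a ∈ Q.divisors, ∑ b ∈ Q.divisors, 2 * ((Q : ℝ) + 1) ^ 2 / (1 + Real.log n) := by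
        refine (norm_sum_le _ _).trans (Finset.sum_le_sum fun a ha ↦ ?_)
        rw [Finset.mul_sum, ← Finset.sum_sub_distrib]
        exact (norm_sum_le _ _).trans (Finset.sum_le_sum fun b hb' ↦ hb a ha b hb')
    _ = _ := by
        simp only [Finset.sum_const, nsmul_eq_mul]; ring

lemma moebius_mul_sum_liouvilleC (Q n : ℕ) :
    (ArithmeticFunction.moebius n : ℂ) * ∑ a ∈ Q.divisors, ∑ b ∈ Q.divisors,
      (if a = b * n then liouvilleC a * liouvilleC b else 0) =
      if Squarefree n then ((Q.divisors.filter fun b ↦ b * n ∈ Q.divisors).card : ℂ) else 0 := by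
  split_ifs with hn
  · rw [Finset.sum_comm, Finset.mul_sum, Finset.card_filter]
    push_cast
    refine Finset.sum_congr rfl fun b hb ↦ ?_
    rw [Finset.sum_ite_eq' Q.divisors (b * n) fun a ↦ liouvilleC a * liouvilleC b]
    split_ifs
    · rw [ArithmeticFunction.moebius_apply_of_squarefree hn, liouvilleC, liouvilleC,
        ArithmeticFunction.cardFactors_mul (Nat.pos_of_mem_divisors hb).ne' hn.ne_zero]
      push_cast
      rw [← pow_add, ← pow_add]
      exact Even.neg_one_pow ⟨ArithmeticFunction.cardFactors n + ArithmeticFunction.cardFactors b, by ring⟩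
    · simp
  · rw [ArithmeticFunction.moebius_eq_zero_of_not_squarefree hn]; simp

lemma hasSum_integral_of_continuous_of_norm_le {f : ℕ → ℝ → ℂ} {g : ℝ → ℂ} {B : ℕ → ℝ} {a b : ℝ}
    (hf : ∀ n, Continuous (f n)) (hB : Summable B) (hfB : ∀ n, ∀ t ∈ Set.uIoc a b, ‖f n t‖ ≤ B n)
    (hg : ∀ t, HasSum (fun n ↦ f n t) (g t)) :
    HasSum (fun n ↦ ∫ t in a..b, f n t) (∫ t in a..b, g t) :=
  intervalIntegral.hasSum_integral_of_dominated_convergence (fun n _ ↦ B n)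
    (fun n ↦ (hf n).aestronglyMeasurable) (fun n ↦ ae_of_all _ (hfB n))
    (ae_of_all _ fun _ _ ↦ hB) (by simp) (ae_of_all _ fun t _ ↦ hg t)

lemma hasSum_inv_riemannZeta {σ : ℝ} (hσ : 1 < σ) (v : ℝ) :
    HasSum (fun n : ℕ ↦ (ArithmeticFunction.moebius n : ℂ) * ((n : ℝ) ^ (-σ) : ℝ) *
      cexp ((-Real.log n * v : ℝ) * I)) (riemannZeta (σ + v * I))⁻¹ := by
  have hs : 1 < (σ + v * I : ℂ).re := by simpa using hσ
  have h := (ArithmeticFunction.LSeriesSummable_moebius_iff.2 hs).LSeriesHasSum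
  have h2 := ArithmeticFunction.LSeries_zeta_mul_Lseries_moebius hs
  rw [ArithmeticFunction.LSeries_zeta_eq_riemannZeta hs] at h2
  rw [← eq_inv_of_mul_eq_one_right h2]
  have h' : HasSum (LSeries.term _ _) _ := h
  convert h' using 1
  funext n
  symm
  rcases Nat.eq_zero_or_pos n with rfl | hn
  · simp
  have hn' : (0 : ℝ) < n := by exact_mod_cast hn
  rw [LSeries.term_of_ne_zero hn.ne', div_eq_mul_inv, ← Complex.cpow_neg, mul_assoc,
    Complex.cpow_def_of_ne_zero (by exact_mod_cast hn.ne'), Real.rpow_def_of_pos hn', ofReal_exp,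
    ← Complex.exp_add, ← Complex.natCast_log]
  congr 2
  push_cast
  ring

lemma hasSum_integral_resonator_mul_inv_riemannZeta {σ δ : ℝ} (hσ : 1 < σ) (hδ : 0 < δ)
    (Q : ℕ) (T X : ℝ) :
    HasSum (fun n : ℕ ↦ (ArithmeticFunction.moebius n : ℂ) * ((n : ℝ) ^ (-σ) : ℝ) *
        kernelTransform δ (Real.log n) * resonatorMoment Q T X n)
      (∫ t in T..(T + X), (‖resonator Q t‖ : ℂ) ^ 2 *
        ∫ u in (0 : ℝ)..δ, I * (1 - u / δ) * (riemannZeta (σ + (t + u : ℝ) * I))⁻¹) := by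
  have hcoef : ∀ n : ℕ, ‖(ArithmeticFunction.moebius n : ℂ) * ((n : ℝ) ^ (-σ) : ℝ)‖ ≤ (n : ℝ) ^ (-σ) := by
    intro n
    have h0 : 0 ≤ (n : ℝ) ^ (-σ) := by positivity
    rw [norm_mul, norm_real, Real.norm_eq_abs, abs_of_nonneg h0]
    refine mul_le_of_le_one_left h0 ?_
    rw [Complex.norm_intCast]
    exact_mod_cast ArithmeticFunction.abs_moebius_le_one
  have hsum : Summable fun n : ℕ ↦ (n : ℝ) ^ (-σ) := Real.summable_nat_rpow.2 (by linarith)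
  have inner : ∀ t : ℝ, HasSum (fun n : ℕ ↦ (ArithmeticFunction.moebius n : ℂ) *
      ((n : ℝ) ^ (-σ) : ℝ) * cexp ((-Real.log n * t : ℝ) * I) * kernelTransform δ (Real.log n))
      (∫ u in (0 : ℝ)..δ, I * (1 - u / δ) * (riemannZeta (σ + (t + u : ℝ) * I))⁻¹) := by
    intro t
    have := hasSum_integral_of_continuous_of_norm_le (a := 0) (b := δ)
      (f := fun n u ↦ I * (1 - u / δ) * ((ArithmeticFunction.moebius n : ℂ) *
        ((n : ℝ) ^ (-σ) : ℝ) * cexp ((-Real.log n * (t + u) : ℝ) * I)))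
      (fun n ↦ by fun_prop) hsum ?_ (fun u ↦ (hasSum_inv_riemannZeta hσ (t + u)).mul_left _)
    · convert this using 1
      funext n
      symm
      rw [kernelTransform, ← intervalIntegral.integral_const_mul]
      refine intervalIntegral.integral_congr fun u _ ↦ ?_
      have he : cexp ((-Real.log n * (t + u) : ℝ) * I) =
          cexp ((-Real.log n * t : ℝ) * I) * cexp ((-Real.log n * u : ℝ) * I) := by
        rw [← Complex.exp_add]; congr 1; push_cast; ring
      simp only [he]
      ring
    · intro n u hu
      rw [Set.uIoc_of_le hδ.le] at hu
      rw [norm_mul, norm_mul, norm_I, one_mul, norm_mul, norm_exp_ofReal_mul_I, mul_one]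
      refine le_trans (mul_le_of_le_one_left (norm_nonneg _) ?_) (hcoef n)
      exact norm_one_sub_div_le hδ hu.1.le hu.2
  have := hasSum_integral_of_continuous_of_norm_le (a := T) (b := T + X)
    (f := fun n t ↦ (‖resonator Q t‖ : ℂ) ^ 2 * ((ArithmeticFunction.moebius n : ℂ) *
      ((n : ℝ) ^ (-σ) : ℝ) * cexp ((-Real.log n * t : ℝ) * I) * kernelTransform δ (Real.log n)))
    (fun n ↦ by have := continuous_resonator Q; fun_prop)
    (hsum.mul_left ((Q.divisors.card : ℝ) ^ 2 * (δ + 2))) ?_ (fun t ↦ (inner t).mul_left _)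
  · convert this using 1
    funext n
    rw [resonatorMoment, ← intervalIntegral.integral_const_mul]
    refine intervalIntegral.integral_congr fun t _ ↦ ?_
    ring
  · intro n t _
    rw [norm_mul, norm_mul, norm_mul, norm_exp_ofReal_mul_I, mul_one, norm_pow, norm_real, norm_norm]
    have h1 := hcoef n
    have h2 : ‖kernelTransform δ (Real.log n)‖ ≤ δ + 2 := by
      have h0 : 0 ≤ Real.log n := Real.log_natCast_nonneg n
      exact (norm_kernelTransform_le hδ h0).trans (div_le_self (by linarith) (by linarith))
    have h3 := norm_resonator_le Q t
    calc _ ≤ (Q.divisors.card : ℝ) ^ 2 * ((n : ℝ) ^ (-σ) * (δ + 2)) := by gcongr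
      _ = _ := by ring

lemma exists_norm_inv_riemannZeta_le {T Y η ε : ℝ} (hT : 0 < T) (hη : 0 < η) (hε : 0 < ε) :
    ∃ σ : ℝ, 1 < σ ∧ σ ≤ 1 + ε ∧ ∀ v ∈ Set.Icc T Y,
      ‖(riemannZeta (σ + v * I))⁻¹‖ ≤ ‖(riemannZeta (1 + v * I))⁻¹‖ + η := by
  set f : ℝ × ℝ → ℂ := fun p ↦ (riemannZeta (p.1 + p.2 * I))⁻¹ with hf
  have hc : ContinuousOn f (Set.Icc 1 2 ×ˢ Set.Icc T Y) := by
    rintro ⟨σ, v⟩ ⟨hσ, hv⟩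
    have hσ1 : 1 ≤ σ := hσ.1
    have hv1 : T ≤ v := hv.1
    have h1 : (σ + v * I : ℂ) ≠ 1 := fun h ↦ by
      have := congrArg Complex.im h
      simp at this
      linarith
    have h2 : riemannZeta (σ + v * I) ≠ 0 := riemannZeta_ne_zero_of_one_le_re (by simpa using hσ1)
    have h3 : ContinuousAt (fun p : ℝ × ℝ ↦ (p.1 + p.2 * I : ℂ)) (σ, v) := by fun_prop
    exact ((ContinuousAt.comp (f := fun p : ℝ × ℝ ↦ (p.1 + p.2 * I : ℂ))
      (differentiableAt_riemannZeta h1).continuousAt h3).inv₀ h2).continuousWithinAt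
  have hu := (isCompact_Icc.prod isCompact_Icc).uniformContinuousOn_of_continuous hc
  obtain ⟨d, hd, h⟩ := Metric.uniformContinuousOn_iff.1 hu η hη
  set e := min (min ε 1) (d / 2) with he
  have he0 : 0 < e := lt_min (lt_min hε one_pos) (by linarith)
  have he1 : e ≤ 1 := (min_le_left _ _).trans (min_le_right _ _)
  have he2 : e ≤ d / 2 := min_le_right _ _
  refine ⟨1 + e, by linarith, by linarith [(min_le_left _ _).trans (min_le_left _ _) (a := e)], ?_⟩
  intro v hv
  have hlt := h (1 + e, v) ⟨⟨by linarith, by linarith⟩, hv⟩ (1, v) ⟨⟨le_rfl, by norm_num⟩, hv⟩ (by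
    rw [Prod.dist_eq, dist_self, Real.dist_eq]
    simp only [add_sub_cancel_left, abs_of_pos he0]
    exact max_lt (by linarith) hd)
  rw [dist_eq_norm] at hlt
  simp only [hf, ofReal_one] at hlt
  linarith [norm_sub_norm_le (riemannZeta ((1 + e : ℝ) + v * I))⁻¹ (riemannZeta (1 + v * I))⁻¹]

lemma one_div_three_mul_le_rpow_neg {σ : ℝ} {n N : ℕ} (hn : 0 < n) (hnN : n ≤ N)
    (hσ : σ ≤ 1 + 1 / N) : 1 / (3 * (n : ℝ)) ≤ (n : ℝ) ^ (-σ) := by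
  have hn' : (0 : ℝ) < n := by exact_mod_cast hn
  have hN' : (n : ℝ) ≤ N := by exact_mod_cast hnN
  have hlog : 0 ≤ Real.log n := Real.log_natCast_nonneg n
  have h1 : σ * Real.log n ≤ Real.log n + 1 := by
    have h2 : 1 / (N : ℝ) * Real.log n ≤ 1 := by
      rw [one_div, inv_mul_le_one₀ (by linarith)]
      linarith [Real.log_le_sub_one_of_pos hn']
    nlinarith
  calc 1 / (3 * (n : ℝ)) ≤ 1 / (Real.exp 1 * n) := by
        gcongr; linarith [Real.exp_one_lt_d9]
    _ = Real.exp (-(Real.log n + 1)) := by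
        rw [Real.exp_neg, Real.exp_add, Real.exp_log hn', one_div, mul_comm]
    _ ≤ Real.exp (Real.log n * -σ) := by gcongr; linarith
    _ = _ := (Real.rpow_def_of_pos hn' _).symm

lemma le_re_moebius_term {σ δ : ℝ} (hσ : 1 < σ) (hδ : 0 < δ) (Q : ℕ) (T X : ℝ) (n : ℕ) :
    (if Squarefree n then (n : ℝ) ^ (-σ) * X * (kernelTransform δ (Real.log n)).re *
      ((Q.divisors.filter fun b ↦ b * n ∈ Q.divisors).card : ℝ) else 0) -
      2 * (δ + 2) * (Q.divisors.card : ℝ) ^ 2 * (Q + 1) ^ 2 *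
        (1 / ((n : ℝ) * (1 + Real.log n) ^ 2)) ≤
    ((ArithmeticFunction.moebius n : ℂ) * ((n : ℝ) ^ (-σ) : ℝ) *
        kernelTransform δ (Real.log n) * resonatorMoment Q T X n).re := by
  rcases Nat.eq_zero_or_pos n with rfl | hn
  · simp
  have hn' : (1 : ℝ) ≤ n := by exact_mod_cast hn
  have hlog : 0 ≤ Real.log n := Real.log_natCast_nonneg n
  set D := ∑ a ∈ Q.divisors, ∑ b ∈ Q.divisors,
      (if a = b * n then liouvilleC a * liouvilleC b else 0) with hD
  set E := resonatorMoment Q T X n - X * D with hE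
  set K := kernelTransform δ (Real.log n) with hK
  have hEle : ‖E‖ ≤ (Q.divisors.card : ℝ) ^ 2 * (2 * (Q + 1) ^ 2 / (1 + Real.log n)) :=
    norm_resonatorMoment_sub_le hn T X
  have hKle : ‖K‖ ≤ (δ + 2) / (1 + Real.log n) := norm_kernelTransform_le hδ hlog
  have hdec : (ArithmeticFunction.moebius n : ℂ) * ((n : ℝ) ^ (-σ) : ℝ) * K *
      resonatorMoment Q T X n = (((n : ℝ) ^ (-σ) * X : ℝ) : ℂ) *
        (K * ((ArithmeticFunction.moebius n : ℂ) * D)) +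
      (ArithmeticFunction.moebius n : ℂ) * ((n : ℝ) ^ (-σ) : ℝ) * K * E := by
    rw [hE]; push_cast; ring
  rw [hdec, add_re, re_ofReal_mul, moebius_mul_sum_liouvilleC]
  have hmain : (K * (if Squarefree n then
      ((Q.divisors.filter fun b ↦ b * n ∈ Q.divisors).card : ℂ) else 0)).re =
      if Squarefree n then K.re * ((Q.divisors.filter fun b ↦ b * n ∈ Q.divisors).card : ℝ)
        else 0 := by
    split_ifs
    · rw [← ofReal_natCast, re_mul_ofReal]
    · simp
  have herr : ‖(ArithmeticFunction.moebius n : ℂ) * ((n : ℝ) ^ (-σ) : ℝ) * K * E‖ ≤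
      2 * (δ + 2) * (Q.divisors.card : ℝ) ^ 2 * (Q + 1) ^ 2 *
        (1 / ((n : ℝ) * (1 + Real.log n) ^ 2)) := by
    have h0 : 0 ≤ (n : ℝ) ^ (-σ) := by positivity
    have h1 : ‖(ArithmeticFunction.moebius n : ℂ)‖ ≤ 1 := by
      rw [Complex.norm_intCast]
      exact_mod_cast ArithmeticFunction.abs_moebius_le_one
    have h2 : (n : ℝ) ^ (-σ) ≤ 1 / n := by
      rw [one_div, ← Real.rpow_neg_one]
      exact Real.rpow_le_rpow_of_exponent_le hn' (by linarith)
    rw [norm_mul, norm_mul, norm_mul, norm_real, Real.norm_eq_abs, abs_of_nonneg h0]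
    calc _ ≤ 1 * (1 / n) * ((δ + 2) / (1 + Real.log n)) *
          ((Q.divisors.card : ℝ) ^ 2 * (2 * (Q + 1) ^ 2 / (1 + Real.log n))) := by gcongr
      _ = _ := by field_simp
  have hre := (abs_le.1 ((Complex.abs_re_le_norm _).trans herr)).1
  rw [hmain]
  have : (n : ℝ) ^ (-σ) * X * (if Squarefree n then
      K.re * ((Q.divisors.filter fun b ↦ b * n ∈ Q.divisors).card : ℝ) else 0) =
      if Squarefree n then (n : ℝ) ^ (-σ) * X * K.re *
        ((Q.divisors.filter fun b ↦ b * n ∈ Q.divisors).card : ℝ) else 0 := by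
    split_ifs <;> ring
  rw [this]
  linarith

lemma le_re_integral_resonator_mul_inv_riemannZeta {σ δ T X : ℝ} (hσ : 1 < σ) (hδ : 0 < δ)
    {N n₀ : ℕ} (hσN : σ ≤ 1 + 1 / N) (hn₀ : ∀ n : ℕ, n₀ ≤ n → 2 ≤ δ * Real.log n)
    {Q : ℕ} (hQ : Q = N.factorial ^ N) (hX : X = (Q + 1) ^ 3) :
    X * Q.divisors.card * (1 / 18 * (1 / 2 * Real.log (1 + Real.log N) - n₀) - 4 * (δ + 2)) ≤
      (∫ t in T..(T + X), (‖resonator Q t‖ : ℂ) ^ 2 *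
        ∫ u in (0 : ℝ)..δ, I * (1 - u / δ) * (riemannZeta (σ + (t + u : ℝ) * I))⁻¹).re := by
  have hX0 : 0 ≤ X := by rw [hX]; positivity
  have hs := (Complex.hasSum_re
    (hasSum_integral_resonator_mul_inv_riemannZeta hσ hδ Q T X))
  set F := (Finset.Icc 1 N).filter Squarefree with hF
  set G := F.filter fun n ↦ n₀ ≤ n with hG
  refine ge_of_tendsto hs (Filter.eventually_atTop.2 ⟨G, fun s hs ↦ ?_⟩)
  refine le_trans ?_ (Finset.sum_le_sum fun n _ ↦ le_re_moebius_term hσ hδ Q T X n)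
  rw [Finset.sum_sub_distrib, ← Finset.mul_sum]
  have herr : 2 * (δ + 2) * (Q.divisors.card : ℝ) ^ 2 * (Q + 1) ^ 2 *
      ∑ n ∈ s, 1 / ((n : ℝ) * (1 + Real.log n) ^ 2) ≤ X * Q.divisors.card * (4 * (δ + 2)) := by
    have h1 : (Q.divisors.card : ℝ) ≤ Q + 1 := by
      exact_mod_cast (Nat.card_divisors_le_self Q).trans (Nat.le_succ Q)
    calc _ ≤ 2 * (δ + 2) * ((Q.divisors.card : ℝ) * (Q + 1)) * (Q + 1) ^ 2 * 2 := by
          rw [sq (Q.divisors.card : ℝ)]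
          gcongr
          exact sum_one_div_mul_sq_one_add_log_le s
      _ = _ := by rw [hX]; ring
  have hcard : ∑ n ∈ F with ¬ n₀ ≤ n, 1 / ((n : ℝ) * (1 + Real.log n)) ≤ n₀ := by
    calc _ ≤ ∑ n ∈ F with ¬ n₀ ≤ n, (1 : ℝ) := by
          refine Finset.sum_le_sum fun n hn ↦ ?_
          have : (1 : ℝ) ≤ n := by
            exact_mod_cast (Finset.mem_Icc.1 (Finset.mem_filter.1 (Finset.mem_filter.1 hn).1).1).1
          have : 0 ≤ Real.log n := Real.log_natCast_nonneg n
          rw [div_le_one (by positivity)]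
          nlinarith
      _ ≤ n₀ := by
          rw [Finset.sum_const, nsmul_one]
          have : (F.filter fun n ↦ ¬ n₀ ≤ n) ⊆ Finset.range n₀ := by
            intro n hn
            simpa using (Finset.mem_filter.1 hn).2
          exact_mod_cast (Finset.card_le_card this).trans (by simp)
  have hsplit := Finset.sum_filter_add_sum_filter_not F (fun n ↦ n₀ ≤ n)
    fun n : ℕ ↦ 1 / ((n : ℝ) * (1 + Real.log n))
  have hlog := log_one_add_log_le_sum_squarefree N
  have hnonneg : ∀ n : ℕ, 0 ≤ (if Squarefree n then (n : ℝ) ^ (-σ) * X *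
      (kernelTransform δ (Real.log n)).re *
      ((Q.divisors.filter fun b ↦ b * n ∈ Q.divisors).card : ℝ) else 0) := by
    intro n
    have := kernelTransform_re_nonneg hδ (Real.log_natCast_nonneg n)
    split_ifs
    · positivity
    · exact le_rfl
  have hmain : X * Q.divisors.card * (1 / 18 * ∑ n ∈ G, 1 / ((n : ℝ) * (1 + Real.log n))) ≤
      ∑ n ∈ s, (if Squarefree n then (n : ℝ) ^ (-σ) * X * (kernelTransform δ (Real.log n)).re *
      ((Q.divisors.filter fun b ↦ b * n ∈ Q.divisors).card : ℝ) else 0) := by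
    refine le_trans ?_ (Finset.sum_le_sum_of_subset_of_nonneg hs fun n _ _ ↦ hnonneg n)
    rw [Finset.mul_sum, Finset.mul_sum]
    refine Finset.sum_le_sum fun n hn ↦ ?_
    obtain ⟨hnF, hnn₀⟩ := Finset.mem_filter.1 hn
    obtain ⟨hnI, hsq⟩ := Finset.mem_filter.1 hnF
    obtain ⟨hn1, hnN⟩ := Finset.mem_Icc.1 hnI
    rw [if_pos hsq]
    have hk := hn₀ n hnn₀
    have hl : 0 < Real.log n := by
      by_contra! h
      nlinarith
    have h1 := one_div_three_mul_le_rpow_neg hn1 hnN hσN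
    have h2 := le_kernelTransform_re hδ hl hk
    have h3 : (Q.divisors.card : ℝ) / 3 ≤
        ((Q.divisors.filter fun b ↦ b * n ∈ Q.divisors).card : ℝ) := by
      have := card_divisors_le_three_mul hsq hnN
      rw [← hQ] at this
      linarith
    have hn0 : (0 : ℝ) < n := by exact_mod_cast hn1
    have h2' : 1 / (2 * (1 + Real.log n)) ≤ (kernelTransform δ (Real.log n)).re :=
      le_trans (by gcongr; linarith) h2
    calc _ = 1 / (3 * (n : ℝ)) * X * (1 / (2 * (1 + Real.log n))) *
          ((Q.divisors.card : ℝ) / 3) := by field_simp; ring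
      _ ≤ _ := by
        have := kernelTransform_re_nonneg hδ hl.le
        gcongr
  have hfin : X * Q.divisors.card * (1 / 18 * (1 / 2 * Real.log (1 + Real.log N) - n₀)) ≤
      X * Q.divisors.card * (1 / 18 * ∑ n ∈ G, 1 / ((n : ℝ) * (1 + Real.log n))) := by
    gcongr
    linarith
  linarith

lemma integral_norm_resonator_sq_le {Q : ℕ} {T X : ℝ} (hX : X = (Q + 1) ^ 3) :
    ∫ t in T..(T + X), ‖resonator Q t‖ ^ 2 ≤ 3 * (X * Q.divisors.card) := by
  have h := norm_resonatorMoment_sub_le (Q := Q) one_pos T X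
  have h1 : resonatorMoment Q T X 1 = ((∫ t in T..(T + X), ‖resonator Q t‖ ^ 2 : ℝ) : ℂ) := by
    rw [resonatorMoment, ← intervalIntegral.integral_ofReal]
    simp
  have h2 : ∑ a ∈ Q.divisors, ∑ b ∈ Q.divisors,
      (if a = b * 1 then liouvilleC a * liouvilleC b else 0) = Q.divisors.card := by
    have := moebius_mul_sum_liouvilleC Q 1
    rw [if_pos squarefree_one, Finset.filter_true_of_mem fun b hb ↦ by rwa [mul_one]] at this
    rw [← this, ArithmeticFunction.moebius_apply_one, Int.cast_one, one_mul]
  rw [h1, h2, ← ofReal_natCast, ← ofReal_mul, ← ofReal_sub, norm_real, Real.norm_eq_abs] at h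
  have h3 := (abs_le.1 h).2
  have h4 : (Q.divisors.card : ℝ) ≤ Q + 1 := by
    exact_mod_cast (Nat.card_divisors_le_self Q).trans (Nat.le_succ Q)
  have h5 : (Q.divisors.card : ℝ) ^ 2 * (2 * (Q + 1) ^ 2 / (1 + Real.log (1 : ℕ))) ≤
      2 * (X * Q.divisors.card) := by
    rw [hX, sq (Q.divisors.card : ℝ)]
    simp only [Nat.cast_one, Real.log_one, add_zero, div_one]
    calc _ ≤ (Q.divisors.card : ℝ) * (Q + 1) * (2 * (Q + 1) ^ 2) := by gcongr
      _ = _ := by ring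
  linarith

lemma log_log_log_le_s17 {T X t : ℝ} {N : ℕ} (ht : 16 ≤ t) (hTN : T ≤ N) (hN : 16 ≤ N)
    (hX : X = ((N.factorial ^ N : ℕ) + 1) ^ 3) (htX : t ≤ T + X) :
    Real.log (Real.log (Real.log t)) ≤ 2 * Real.log (1 + Real.log N) := by
  have hNr : (16 : ℝ) ≤ N := by exact_mod_cast hN
  have hlogN : 0 < Real.log N := Real.log_pos (by linarith)
  set P : ℝ := (N : ℝ) ^ (N * N) with hP
  have hQP : ((N.factorial ^ N : ℕ) : ℝ) ≤ P := by
    rw [hP, pow_mul]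
    push_cast
    gcongr
    exact_mod_cast Nat.factorial_le_pow N
  have hNP : (N : ℝ) ≤ P := le_self_pow₀ (by linarith) (by positivity)
  have h1 : t ≤ P ^ 4 := by
    have h2 : ((N.factorial ^ N : ℕ) + 1 : ℝ) ^ 3 ≤ (2 * P) ^ 3 := by
      gcongr; linarith
    have h3 : P ≤ P ^ 3 := le_self_pow₀ (by linarith) (by norm_num)
    have h4 : 0 ≤ P ^ 3 := by positivity
    calc t ≤ P + (2 * P) ^ 3 := by linarith
      _ ≤ 9 * P ^ 3 := by nlinarith
      _ ≤ P * P ^ 3 := by gcongr; linarith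
      _ = P ^ 4 := by ring
  have hlt : 1 < Real.log t := by
    rw [Real.lt_log_iff_exp_lt (by linarith)]
    linarith [Real.exp_one_lt_d9]
  have hllt : 0 < Real.log (Real.log t) := Real.log_pos hlt
  have h2 : Real.log t ≤ (N : ℝ) ^ 4 := by
    calc Real.log t ≤ Real.log (P ^ 4) := Real.log_le_log (by linarith) h1
      _ = 4 * (N * N * Real.log N) := by
        rw [hP, Real.log_pow, Real.log_pow]; push_cast; ring
      _ ≤ N * (N * N * N) := by
        gcongr
        · linarith
        · linarith [Real.log_le_sub_one_of_pos (by linarith : (0 : ℝ) < N)]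
      _ = _ := by ring
  have h3 : Real.log (Real.log t) ≤ 4 * Real.log N := by
    calc _ ≤ Real.log ((N : ℝ) ^ 4) := Real.log_le_log (by linarith) h2
      _ = _ := by rw [Real.log_pow]; norm_num
  calc _ ≤ Real.log ((1 + Real.log N) ^ 2) :=
        Real.log_le_log hllt (h3.trans (by nlinarith [sq_nonneg (1 - Real.log N)]))
    _ = _ := by rw [Real.log_pow]; norm_num

lemma continuousOn_norm_inv_riemannZeta {a : ℝ} (ha : 0 < a) :
    ContinuousOn (fun v : ℝ ↦ ‖(riemannZeta (1 + v * I))⁻¹‖) (Set.Ici a) := by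
  intro v hv
  have hv' : a ≤ v := hv
  have h1 : (1 + v * I : ℂ) ≠ 1 := fun h ↦ by
    have := congrArg Complex.im h
    simp at this
    linarith
  have h2 : riemannZeta (1 + v * I) ≠ 0 := riemannZeta_ne_zero_of_one_le_re (by simp)
  have h3 : ContinuousAt (fun v : ℝ ↦ (1 + v * I : ℂ)) v := by fun_prop
  exact ((ContinuousAt.comp (f := fun v : ℝ ↦ (1 + v * I : ℂ))
    (differentiableAt_riemannZeta h1).continuousAt h3).inv₀ h2).norm.continuousWithinAt

lemma norm_integral_kernel_mul_inv_riemannZeta_le {σ δ t : ℝ} (hδ : 0 < δ) (ht : 0 < t)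
    (h : ∀ v ∈ Set.Icc t (t + δ),
      ‖(riemannZeta (σ + v * I))⁻¹‖ ≤ ‖(riemannZeta (1 + v * I))⁻¹‖ + 1 / δ) :
    ‖∫ u in (0 : ℝ)..δ, I * (1 - u / δ) * (riemannZeta (σ + (t + u : ℝ) * I))⁻¹‖ ≤
      (∫ v in t..(t + δ), ‖(riemannZeta (1 + v * I))⁻¹‖) + 1 := by
  have hint : IntervalIntegrable
      (fun u : ℝ ↦ ‖(riemannZeta (1 + (t + u : ℝ) * I))⁻¹‖) volume 0 δ := by
    apply ContinuousOn.intervalIntegrable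
    refine (continuousOn_norm_inv_riemannZeta ht).comp
      (f := fun u : ℝ ↦ t + u) (by fun_prop) fun u hu ↦ ?_
    rw [Set.uIcc_of_le hδ.le] at hu
    exact le_add_of_nonneg_right hu.1
  refine (intervalIntegral.norm_integral_le_of_norm_le hδ.le (ae_of_all _ fun u hu ↦ ?_)
    (hint.add (_root_.intervalIntegrable_const (c := 1 / δ)))).trans (le_of_eq ?_)
  · rw [norm_mul, norm_mul, norm_I, one_mul]
    exact (mul_le_of_le_one_left (norm_nonneg _) (norm_one_sub_div_le hδ hu.1.le hu.2)).trans
      (h _ ⟨by linarith [hu.1], by linarith [hu.2]⟩)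
  · rw [intervalIntegral.integral_add hint _root_.intervalIntegrable_const,
      intervalIntegral.integral_comp_add_left
        (fun v : ℝ ↦ ‖(riemannZeta (1 + (v : ℝ) * I))⁻¹‖) t]
    simp [hδ.ne']

theorem stmt_17 (δ : ℝ) (hδ : 0 < δ)  :
    ∃ c > (0 : ℝ), ∀ T₀ : ℝ, (16 : ℝ) ≤ T₀ → ∃ T : ℝ, T₀ ≤ T ∧
      c * Real.log (Real.log (Real.log T)) ≤ ∫ t in T..(T + δ), ‖riemannZeta (1 + t * Complex.I)‖ ^ ((-1 : ℝ)) := by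
  refine ⟨1 / 1000, by norm_num, fun T₀ hT₀ ↦ ?_⟩
  by_contra! hcon
  have hcon' : ∀ T, T₀ ≤ T → ∫ t in T..(T + δ), ‖(riemannZeta (1 + t * I))⁻¹‖ <
      1 / 1000 * Real.log (Real.log (Real.log T)) := by
    intro T hT
    refine lt_of_eq_of_lt ?_ (hcon T hT)
    simp only [Real.rpow_neg_one, norm_inv]
  set n₀ := ⌈Real.exp (2 / δ)⌉₊ with hn₀def
  have hn₀ : ∀ n : ℕ, n₀ ≤ n → 2 ≤ δ * Real.log n := by
    intro n hn
    have h1 : Real.exp (2 / δ) ≤ n := (Nat.le_ceil _).trans (by exact_mod_cast hn)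
    have h2 := (Real.le_log_iff_exp_le ((Real.exp_pos _).trans_le h1)).2 h1
    rw [div_le_iff₀ hδ] at h2
    linarith
  have hL : Tendsto (fun N : ℕ ↦ Real.log (1 + Real.log N)) atTop atTop :=
    Real.tendsto_log_atTop.comp (tendsto_atTop_add_const_left _ _
      (Real.tendsto_log_atTop.comp tendsto_natCast_atTop_atTop))
  obtain ⟨N, hN16, hNT, hNL⟩ := ((eventually_ge_atTop 16).and
    ((tendsto_natCast_atTop_atTop.eventually_ge_atTop T₀).and
      (hL.eventually_ge_atTop (50 * (n₀ / 18 + 4 * (δ + 2) + 3) + 1)))).exists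
  set L := Real.log (1 + Real.log N) with hLdef
  set Q := N.factorial ^ N with hQ
  obtain ⟨X, hX⟩ : ∃ X : ℝ, X = ((Q : ℝ) + 1) ^ 3 := ⟨_, rfl⟩
  have hX0 : 0 < X := by rw [hX]; positivity
  have hτ : (0 : ℝ) < Q.divisors.card := by
    have : Q ≠ 0 := pow_ne_zero _ (Nat.factorial_ne_zero N)
    exact_mod_cast Finset.card_pos.2 ⟨1, Nat.one_mem_divisors.2 this⟩
  obtain ⟨σ, hσ, hσN, hσζ⟩ := exists_norm_inv_riemannZeta_le (T := T₀) (Y := T₀ + X + δ)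
    (η := 1 / δ) (ε := 1 / N) (by linarith) (by positivity)
    (by have : 0 < N := by omega
        positivity)
  have hlow := le_re_integral_resonator_mul_inv_riemannZeta (T := T₀) hσ hδ hσN hn₀ hQ hX
  have hup : ‖∫ t in T₀..(T₀ + X), (‖resonator Q t‖ : ℂ) ^ 2 *
      ∫ u in (0 : ℝ)..δ, I * (1 - u / δ) * (riemannZeta (σ + (t + u : ℝ) * I))⁻¹‖ ≤
      ∫ t in T₀..(T₀ + X), ‖resonator Q t‖ ^ 2 * (1 / 500 * L + 1) := by
    refine intervalIntegral.norm_integral_le_of_norm_le (by linarith)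
      (ae_of_all _ fun t ht ↦ ?_) (Continuous.intervalIntegrable
        (by have := continuous_resonator Q; fun_prop) _ _)
    rw [norm_mul, norm_pow, norm_real, norm_norm]
    have h1 := norm_integral_kernel_mul_inv_riemannZeta_le (σ := σ) hδ (by linarith [ht.1] : 0 < t)
      fun v hv ↦ hσζ v ⟨by linarith [ht.1, hv.1], by linarith [ht.2, hv.2]⟩
    have h2 := hcon' t ht.1.le
    have h3 := log_log_log_le_s17 (by linarith [ht.1]) hNT hN16 hX ht.2
    gcongr
    linarith
  rw [intervalIntegral.integral_mul_const] at hup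
  have h1 := hlow.trans ((Complex.re_le_norm _).trans hup)
  have hL0 : 0 ≤ L := le_trans (by positivity) hNL
  have h2 := h1.trans (mul_le_mul_of_nonneg_right (integral_norm_resonator_sq_le (T := T₀) hX)
    (by positivity : 0 ≤ 1 / 500 * L + 1))
  have h3 : X * Q.divisors.card * (1 / 18 * (1 / 2 * L - n₀) - 4 * (δ + 2)) ≤
      X * Q.divisors.card * (3 * (1 / 500 * L + 1)) := by linarith
  have h4 := le_of_mul_le_mul_left h3 (by positivity)
  linarith
end

section
/- For every fixed δ > 0 and every real p > 1 there exists a constant c > 0 such that for every T₀ ≥ 3 there exists T ≥ T₀ with ∫_T^{T+δ} |ζ(1+it)|^p dt ≥ c · (log log T)^{p−1}. (Equivalently, ∫_T^{T+δ} |ζ(1+it)|^p dt = Ω((log log T)^{p−1}) as T → ∞.) -/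
open Complex Real Filter MeasureTheory intervalIntegral

/-- Simultaneous Dirichlet approximation: finitely many angles can be brought close to `0`
modulo `2π` by a common positive multiplier. -/
lemma exists_forall_half_le_cos_mul (N : ℕ) (θ : ℕ → ℝ) :
    ∃ k : ℕ, 1 ≤ k ∧ k ≤ 6 ^ N ∧ ∀ n < N, 1 / 2 ≤ Real.cos (k * θ n) := by
  let x : ℕ → ℕ → ℝ := fun j n => Int.fract (j * (θ n / (2 * π)))
  have hx0 : ∀ j n, 0 ≤ x j n := fun j n => Int.fract_nonneg _
  have hx1 : ∀ j n, x j n < 1 := fun j n => Int.fract_lt_one _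
  let f : Fin (6 ^ N + 1) → (Fin N → Fin 6) := fun j n =>
    ⟨⌊6 * x j n⌋₊, by
      rw [Nat.floor_lt (by have := hx0 j n; positivity)]
      have := hx1 j n
      push_cast
      linarith⟩
  obtain ⟨a, b, hab, hf⟩ := Fintype.exists_ne_map_eq_of_card_lt f (by simp)
  wlog hlt : b < a generalizing a b
  · exact this b a hab.symm hf.symm (lt_of_le_of_ne (not_lt.mp hlt) hab)
  have hlt' : (b : ℕ) < a := hlt
  refine ⟨(a : ℕ) - b, by omega, by omega, fun n hn => ?_⟩
  have hfl : ⌊6 * x a n⌋₊ = ⌊6 * x b n⌋₊ := by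
    have := congrArg Fin.val (congrFun hf ⟨n, hn⟩)
    simpa [f] using this
  have ha := Nat.floor_le (show 0 ≤ 6 * x a n by have := hx0 a n; positivity)
  have hb := Nat.floor_le (show 0 ≤ 6 * x b n by have := hx0 b n; positivity)
  have ha' := Nat.lt_floor_add_one (6 * x a n)
  have hb' := Nat.lt_floor_add_one (6 * x b n)
  rw [hfl] at ha ha'
  have habs : |x a n - x b n| ≤ 1 / 6 := by rw [abs_le]; constructor <;> linarith
  have key : (((a : ℕ) - b : ℕ) : ℝ) * θ n = 2 * π * (x a n - x b n)
      + ((⌊(a : ℕ) * (θ n / (2 * π))⌋ - ⌊(b : ℕ) * (θ n / (2 * π))⌋ : ℤ) : ℝ) * (2 * π) := by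
    rw [Nat.cast_sub hlt'.le]
    simp only [x, Int.fract]
    push_cast
    field_simp
    ring
  rw [key, Real.cos_add_int_mul_two_pi, ← Real.cos_abs, ← Real.cos_pi_div_three]
  have h2 : |2 * π * (x a n - x b n)| ≤ π / 3 := by
    rw [abs_mul, abs_of_pos Real.two_pi_pos]
    nlinarith [Real.pi_pos]
  exact Real.cos_le_cos_of_nonneg_of_le_pi (abs_nonneg _) (by linarith [Real.pi_pos]) h2

/-- The cosine transform of the triangular function supported on `[-w, w]`. -/
noncomputable def triangleCosTransform (w x : ℝ) : ℝ :=
  ∫ t in (0 : ℝ)..w, (1 - t / w) * (2 * Real.cos (t * x))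

lemma triangleCosTransform_eq {w x : ℝ} (hw : 0 < w) (hx : x ≠ 0) :
    triangleCosTransform w x = 2 * (1 - Real.cos (w * x)) / (w * x ^ 2) := by
  have hd : ∀ t ∈ Set.uIcc 0 w, HasDerivAt
      (fun t : ℝ => 2 * ((1 - t / w) * (Real.sin (t * x) / x) - Real.cos (t * x) / (w * x ^ 2)))
      ((1 - t / w) * (2 * Real.cos (t * x))) t := by
    intro t _
    have h1 : HasDerivAt (fun t : ℝ => t * x) x t := by simpa using (hasDerivAt_id t).mul_const x
    have h2 : HasDerivAt (fun t : ℝ => 1 - t / w) (-(1 / w)) t := by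
      simpa using ((hasDerivAt_id t).div_const w).const_sub 1
    refine (((h2.mul (h1.sin.div_const x)).sub
      (h1.cos.div_const (w * x ^ 2))).const_mul 2).congr_deriv ?_
    field_simp
    ring
  rw [triangleCosTransform, integral_eq_sub_of_hasDerivAt hd
    (Continuous.intervalIntegrable (by fun_prop) _ _)]
  field_simp
  simp
  ring

lemma half_le_triangleCosTransform {w x : ℝ} (hw : 0 < w) (hx : 0 ≤ x) (hwx : w * x ≤ 1) :
    w / 2 ≤ triangleCosTransform w x := by
  have h : ∫ t in (0 : ℝ)..w, (1 - t / w) = w / 2 := by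
    rw [intervalIntegral.integral_sub (by simp) (Continuous.intervalIntegrable (by fun_prop) _ _),
      intervalIntegral.integral_div]
    simp
    field_simp
    ring
  rw [← h, triangleCosTransform]
  refine intervalIntegral.integral_mono_on hw.le (Continuous.intervalIntegrable (by fun_prop) _ _)
    (Continuous.intervalIntegrable (by fun_prop) _ _) fun t ht => ?_
  have h1 : 0 ≤ 1 - t / w := by
    have := (div_le_one hw).mpr ht.2
    linarith
  have h2 : 0 ≤ t * x := mul_nonneg ht.1 hx
  have h3 : t * x ≤ 1 := (mul_le_mul_of_nonneg_right ht.2 hx).trans hwx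
  have h4 := Real.one_sub_sq_div_two_le_cos (x := t * x)
  exact le_mul_of_one_le_right h1 (by nlinarith)

lemma triangleCosTransform_nonneg {w : ℝ} (hw : 0 < w) (x : ℝ) :
    0 ≤ triangleCosTransform w x := by
  rcases eq_or_ne x 0 with rfl | hx
  · exact (by positivity : 0 ≤ w / 2).trans
      (half_le_triangleCosTransform hw le_rfl (by simp))
  · rw [triangleCosTransform_eq hw hx]
    have := Real.cos_le_one (w * x)
    exact div_nonneg (by linarith) (by positivity)

lemma triangleCosTransform_le {w x : ℝ} (hw : 0 < w) (hx : x ≠ 0) :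
    triangleCosTransform w x ≤ 4 / w * (1 / x ^ 2) := by
  rw [triangleCosTransform_eq hw hx, div_mul_div_comm, mul_one]
  have := Real.neg_one_le_cos (w * x)
  gcongr
  linarith

lemma re_one_div_cpow (n : ℕ) (σ t : ℝ) :
    (1 / ((n : ℂ) + 1) ^ ((1 : ℂ) + σ + t * Complex.I)).re
      = ((n : ℝ) + 1) ^ (-(1 + σ)) * Real.cos (t * Real.log (n + 1)) := by
  have hn : (0 : ℝ) < (n : ℝ) + 1 := by positivity
  have hn' : ((n : ℂ) + 1) ≠ 0 := by exact_mod_cast hn.ne'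
  have hlog : Complex.log ((n : ℂ) + 1) = (Real.log (n + 1) : ℝ) := by
    rw [Complex.ofReal_log hn.le]; push_cast; rfl
  rw [one_div, ← Complex.cpow_neg, Complex.cpow_def_of_ne_zero hn', hlog, Complex.exp_re,
    Real.rpow_def_of_pos hn]
  simp [mul_comm]

/-- Real part of the sum of the values of `ζ` at the points `1 + σ + i (T ± t)`. -/
noncomputable def zetaSymm (σ T t : ℝ) : ℝ :=
  (riemannZeta (1 + σ + (T + t : ℝ) * Complex.I)).re
    + (riemannZeta (1 + σ + (T - t : ℝ) * Complex.I)).re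

lemma hasSum_zetaSymm {σ : ℝ} (hσ : 0 < σ) (T t : ℝ) :
    HasSum (fun n : ℕ => ((n : ℝ) + 1) ^ (-(1 + σ)) * Real.cos (T * Real.log (n + 1))
      * (2 * Real.cos (t * Real.log (n + 1)))) (zetaSymm σ T t) := by
  have h : ∀ u : ℝ, HasSum (fun n : ℕ => ((n : ℝ) + 1) ^ (-(1 + σ))
      * Real.cos (u * Real.log (n + 1))) (riemannZeta (1 + σ + u * Complex.I)).re := by
    intro u
    have hs : 1 < ((1 : ℂ) + σ + u * Complex.I).re := by simpa using hσ
    have hsum : Summable fun n : ℕ => 1 / ((n : ℂ) + 1) ^ ((1 : ℂ) + σ + u * Complex.I) := by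
      have := (summable_nat_add_iff 1).mpr (Complex.summable_one_div_nat_cpow.mpr hs)
      simpa using this
    have := Complex.hasSum_re hsum.hasSum
    rw [← zeta_eq_tsum_one_div_nat_add_one_cpow hs] at this
    simpa only [re_one_div_cpow] using this
  rw [zetaSymm]
  convert (h (T + t)).add (h (T - t)) using 2 with n
  rw [add_mul, sub_mul, Real.cos_add, Real.cos_sub]
  ring

lemma continuous_zetaSymm {T : ℝ} (hT : 2 ≤ T) :
    Continuous fun q : ℝ × ℝ => zetaSymm q.1 T (max (-1) (min 1 q.2)) := by
  have h : ∀ g : ℝ × ℝ → ℝ, Continuous g → (∀ q, 0 < g q) →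
      Continuous fun q : ℝ × ℝ => (riemannZeta (1 + q.1 + g q * Complex.I)).re := by
    intro g hg hpos
    refine Complex.continuous_re.comp (continuous_iff_continuousAt.mpr fun q => ?_)
    have hne : (1 : ℂ) + q.1 + g q * Complex.I ≠ 1 := by
      intro h
      have := congrArg Complex.im h
      simp at this
      exact (hpos q).ne' this
    exact ContinuousAt.comp (f := fun q : ℝ × ℝ => (1 : ℂ) + q.1 + g q * Complex.I)
      (differentiableAt_riemannZeta hne).continuousAt (by fun_prop)
  refine (h _ (by fun_prop) fun q => ?_).add (h _ (by fun_prop) fun q => ?_)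
  · have := le_max_left (-1) (min 1 q.2)
    linarith
  · have : max (-1) (min 1 q.2) ≤ 1 := max_le (by norm_num) (min_le_left _ _)
    linarith

lemma max_neg_one_min_one_eq {w t : ℝ} (hw : 0 ≤ w) (hw1 : w ≤ 1) (ht : t ∈ Set.uIcc 0 w) :
    max (-1) (min 1 t) = t := by
  rw [Set.uIcc_of_le hw] at ht
  rw [min_eq_right (ht.2.trans hw1), max_eq_right (by linarith [ht.1])]

lemma tendsto_integral_zetaSymm {T w : ℝ} (hT : 2 ≤ T) (hw : 0 ≤ w) (hw1 : w ≤ 1) :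
    Tendsto (fun σ : ℝ => ∫ t in (0 : ℝ)..w, (1 - t / w) * zetaSymm σ T t) (nhdsWithin 0 (Set.Ioi 0))
      (nhds (∫ t in (0 : ℝ)..w, (1 - t / w) * zetaSymm 0 T t)) := by
  have hc : Continuous fun σ : ℝ =>
      ∫ t in (0 : ℝ)..w, (1 - t / w) * zetaSymm σ T (max (-1) (min 1 t)) := by
    refine continuous_parametric_intervalIntegral_of_continuous' ?_ 0 w
    have := continuous_zetaSymm hT
    simp only [Function.uncurry_def]
    fun_prop
  have he : ∀ σ : ℝ, ∫ t in (0 : ℝ)..w, (1 - t / w) * zetaSymm σ T (max (-1) (min 1 t))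
      = ∫ t in (0 : ℝ)..w, (1 - t / w) * zetaSymm σ T t := fun σ =>
    intervalIntegral.integral_congr fun t ht => by
      simp only [max_neg_one_min_one_eq hw hw1 ht]
  simp only [he] at hc
  exact (hc.tendsto 0).mono_left nhdsWithin_le_nhds

lemma hasSum_integral_zetaSymm {σ w : ℝ} (hσ : 0 < σ) (hw : 0 < w) (T : ℝ) :
    HasSum (fun n : ℕ => ((n : ℝ) + 1) ^ (-(1 + σ)) * Real.cos (T * Real.log (n + 1))
      * triangleCosTransform w (Real.log (n + 1)))
      (∫ t in (0 : ℝ)..w, (1 - t / w) * zetaSymm σ T t) := by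
  have hs : Summable fun n : ℕ => ((n : ℝ) + 1) ^ (-(1 + σ)) := by
    have := (summable_nat_add_iff 1).mpr (Real.summable_nat_rpow.mpr (show -(1 + σ) < -1 by linarith))
    simpa using this
  have h := intervalIntegral.hasSum_integral_of_dominated_convergence (μ := volume)
    (a := 0) (b := w)
    (F := fun (n : ℕ) (t : ℝ) => (1 - t / w) * (((n : ℝ) + 1) ^ (-(1 + σ))
      * Real.cos (T * Real.log (n + 1)) * (2 * Real.cos (t * Real.log (n + 1)))))
    (f := fun t => (1 - t / w) * zetaSymm σ T t)
    (fun n _ => ((n : ℝ) + 1) ^ (-(1 + σ)) * 2)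
    (fun n => (by fun_prop : Continuous _).aestronglyMeasurable) ?_ ?_ ?_ ?_
  · refine h.congr_fun fun n => ?_
    rw [triangleCosTransform, ← intervalIntegral.integral_const_mul]
    congr 1
    ext t
    ring
  · refine fun n => Eventually.of_forall fun t ht => ?_
    rw [Set.uIoc_of_le hw.le] at ht
    have h1 : 0 ≤ 1 - t / w := by
      have := (div_le_one hw).mpr ht.2
      linarith
    have h2 : 1 - t / w ≤ 1 := by
      have := div_nonneg ht.1.le hw.le
      linarith
    have hn : 0 ≤ ((n : ℝ) + 1) ^ (-(1 + σ)) := by positivity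
    have hT := Real.abs_cos_le_one (T * Real.log (n + 1))
    have ht := Real.abs_cos_le_one (t * Real.log (n + 1))
    simp only [norm_mul, Real.norm_eq_abs, abs_of_nonneg h1, abs_of_nonneg hn, abs_two]
    calc (1 - t / w) * (((n : ℝ) + 1) ^ (-(1 + σ)) * |Real.cos (T * Real.log (n + 1))|
          * (2 * |Real.cos (t * Real.log (n + 1))|))
        ≤ 1 * (((n : ℝ) + 1) ^ (-(1 + σ)) * 1 * (2 * 1)) := by gcongr
      _ = _ := by ring
  · exact Eventually.of_forall fun t _ => hs.mul_right 2
  · exact intervalIntegrable_const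
  · exact Eventually.of_forall fun t _ => (hasSum_zetaSymm hσ T t).mul_left _

lemma one_div_mul_log_sq_le {n : ℕ} (hn : 2 ≤ n) :
    1 / (((n : ℝ) + 1) * Real.log (n + 1) ^ 2) ≤ 1 / Real.log n - 1 / Real.log (n + 1) := by
  have hn' : (2 : ℝ) ≤ n := by exact_mod_cast hn
  have h1 : 0 < Real.log n := Real.log_pos (by linarith)
  have h2 : Real.log n ≤ Real.log (n + 1) := Real.log_le_log (by linarith) (by linarith)
  have h3 : 1 / ((n : ℝ) + 1) ≤ Real.log (n + 1) - Real.log n := by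
    have := Real.one_sub_inv_le_log_of_pos (show 0 < ((n : ℝ) + 1) / n by positivity)
    rw [Real.log_div (by positivity) (by positivity)] at this
    refine le_trans (le_of_eq ?_) this
    field_simp
    ring
  have h4 : 0 < Real.log (n + 1) := h1.trans_le h2
  rw [div_sub_div _ _ h1.ne' h4.ne', one_mul, mul_one, one_div, mul_inv, ← one_div, sq,
    div_eq_mul_inv _ (Real.log n * _)]
  gcongr

/-- Lower bound for the partial sums of the smoothed Dirichlet series, when the oscillating factors
are close to `1` for the first `N` terms. -/
lemma le_sum_range_triangleCosTransform {σ w T : ℝ} {M N m : ℕ} (hσ : 0 < σ) (hw : 0 < w)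
    (hM : ∀ n < M, w * Real.log (n + 1) ≤ 1) (hMN : M ≤ N) (hN : 2 ≤ N) (hNm : N ≤ m)
    (hT : ∀ n < N, 1 / 2 ≤ Real.cos (T * Real.log (n + 1))) :
    w / 4 * ∑ n ∈ Finset.range M, ((n : ℝ) + 1) ^ (-(1 + σ))
        - 4 / w * (1 / Real.log N - 1 / Real.log m)
      ≤ ∑ n ∈ Finset.range m, ((n : ℝ) + 1) ^ (-(1 + σ)) * Real.cos (T * Real.log (n + 1))
          * triangleCosTransform w (Real.log (n + 1)) := by
  induction m, hNm using Nat.le_induction with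
  | base =>
    rw [sub_self, mul_zero, sub_zero, Finset.mul_sum]
    refine (Finset.sum_le_sum fun n hn => ?_).trans (Finset.sum_le_sum_of_subset_of_nonneg
      (Finset.range_subset_range.mpr hMN) fun n hn _ => ?_)
    · have hn' := Finset.mem_range.mp hn
      have h1 := half_le_triangleCosTransform hw (Real.log_nonneg
        (by linarith [(Nat.cast_nonneg n : (0 : ℝ) ≤ n)])) (hM n hn')
      have h2 := hT n (hn'.trans_le hMN)
      calc w / 4 * ((n : ℝ) + 1) ^ (-(1 + σ)) = ((n : ℝ) + 1) ^ (-(1 + σ)) * (1 / 2) * (w / 2) := by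
            ring
        _ ≤ _ := by gcongr
    · have h2 : 0 ≤ Real.cos (T * Real.log (n + 1)) :=
        le_trans (by norm_num) (hT n (Finset.mem_range.mp hn))
      have := triangleCosTransform_nonneg hw (Real.log (n + 1))
      positivity
  | succ n hn ih =>
    rw [Finset.sum_range_succ]
    have hn2 : 2 ≤ n := hN.trans hn
    have hn' : (2 : ℝ) ≤ n := by exact_mod_cast hn2
    have h1 := one_div_mul_log_sq_le hn2
    have hlog : 0 < Real.log ((n : ℝ) + 1) := Real.log_pos (by linarith)
    have h2 := triangleCosTransform_le hw hlog.ne'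
    have h0 := triangleCosTransform_nonneg hw (Real.log (n + 1))
    have h3 : ((n : ℝ) + 1) ^ (-(1 + σ)) ≤ 1 / ((n : ℝ) + 1) := by
      rw [one_div, ← Real.rpow_neg_one]
      exact Real.rpow_le_rpow_of_exponent_le (by linarith) (by linarith)
    have h4 := Real.neg_one_le_cos (T * Real.log (n + 1))
    have h5 : ((n : ℝ) + 1) ^ (-(1 + σ)) * triangleCosTransform w (Real.log (n + 1))
        ≤ 4 / w * (1 / Real.log n - 1 / Real.log (n + 1)) := by
      calc _ ≤ 1 / ((n : ℝ) + 1) * (4 / w * (1 / Real.log (n + 1) ^ 2)) := by gcongr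
        _ = 4 / w * (1 / (((n : ℝ) + 1) * Real.log (n + 1) ^ 2)) := by
          rw [one_div_mul_eq_div, ← one_div_mul_one_div]; ring
        _ ≤ _ := by gcongr
    have h6 : 0 ≤ ((n : ℝ) + 1) ^ (-(1 + σ)) * triangleCosTransform w (Real.log (n + 1)) := by
      positivity
    push_cast
    nlinarith

lemma le_integral_zetaSymm {w T : ℝ} {M N : ℕ} (hw : 0 < w) (hw1 : w ≤ 1) (hT2 : 2 ≤ T)
    (hM : ∀ n < M, w * Real.log (n + 1) ≤ 1) (hMN : M ≤ N) (hN : 2 ≤ N)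
    (hT : ∀ n < N, 1 / 2 ≤ Real.cos (T * Real.log (n + 1))) :
    w / 4 * Real.log (M + 1) - 4 / w * (1 / Real.log N)
      ≤ ∫ t in (0 : ℝ)..w, (1 - t / w) * zetaSymm 0 T t := by
  have hσ : ∀ σ : ℝ, 0 < σ → w / 4 * ∑ n ∈ Finset.range M, ((n : ℝ) + 1) ^ (-(1 + σ))
        - 4 / w * (1 / Real.log N) ≤ ∫ t in (0 : ℝ)..w, (1 - t / w) * zetaSymm σ T t := by
    intro σ hσ
    refine ge_of_tendsto (hasSum_integral_zetaSymm hσ hw T).tendsto_sum_nat ?_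
    filter_upwards [eventually_ge_atTop N] with m hm
    refine le_trans ?_ (le_sum_range_triangleCosTransform hσ hw hM hMN hN hm hT)
    have h1 : 0 ≤ 1 / Real.log m := one_div_nonneg.mpr (Real.log_natCast_nonneg m)
    gcongr
    linarith
  have hlim : Tendsto (fun σ : ℝ => w / 4 * ∑ n ∈ Finset.range M, ((n : ℝ) + 1) ^ (-(1 + σ))
        - 4 / w * (1 / Real.log N)) (nhdsWithin 0 (Set.Ioi 0))
      (nhds (w / 4 * ∑ n ∈ Finset.range M, ((n : ℝ) + 1) ^ (-(1 + (0 : ℝ)))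
        - 4 / w * (1 / Real.log N))) := by
    refine Tendsto.mono_left (Continuous.tendsto ?_ 0) nhdsWithin_le_nhds
    refine (continuous_const.mul (continuous_finsetSum _ fun n _ => ?_)).sub continuous_const
    exact Continuous.rpow continuous_const (by fun_prop) fun _ => Or.inl (by positivity)
  refine le_trans ?_ (le_of_tendsto_of_tendsto hlim (tendsto_integral_zetaSymm hT2 hw.le hw1)
    (eventually_nhdsWithin_of_forall hσ))
  have hH := log_add_one_le_harmonic M
  rw [harmonic] at hH
  push_cast at hH
  gcongr
  refine hH.trans (le_of_eq (Finset.sum_congr rfl fun n _ => ?_))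
  rw [add_zero, Real.rpow_neg_one]

lemma continuousOn_norm_zeta {a b : ℝ} (ha : 0 < a) :
    ContinuousOn (fun t : ℝ => ‖riemannZeta (1 + t * Complex.I)‖) (Set.Icc a b) := by
  intro t ht
  have hne : (1 : ℂ) + t * Complex.I ≠ 1 := by
    intro h
    have := congrArg Complex.im h
    simp at this
    linarith [ht.1]
  exact (ContinuousAt.comp (f := fun t : ℝ => (1 : ℂ) + t * Complex.I)
    (differentiableAt_riemannZeta hne).continuousAt (by fun_prop)).norm.continuousWithinAt

lemma integral_zetaSymm_le {w T : ℝ} (hw : 0 < w) (hw1 : w ≤ 1) (hT2 : 2 ≤ T) :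
    ∫ t in (0 : ℝ)..w, (1 - t / w) * zetaSymm 0 T t
      ≤ ∫ t in (T - w)..(T + w), ‖riemannZeta (1 + t * Complex.I)‖ := by
  have hc := continuousOn_norm_zeta (a := T - w) (b := T + w) (by linarith)
  have hi1 : IntervalIntegrable (fun t : ℝ => ‖riemannZeta (1 + t * Complex.I)‖) volume
      (T - w) T := ContinuousOn.intervalIntegrable_of_Icc (by linarith)
        (hc.mono (Set.Icc_subset_Icc le_rfl (by linarith)))
  have hi2 : IntervalIntegrable (fun t : ℝ => ‖riemannZeta (1 + t * Complex.I)‖) volume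
      T (T + w) := ContinuousOn.intervalIntegrable_of_Icc (by linarith)
        (hc.mono (Set.Icc_subset_Icc (by linarith) le_rfl))
  have hj1 : IntervalIntegrable
      (fun t : ℝ => ‖riemannZeta (1 + (T - t : ℝ) * Complex.I)‖) volume 0 w := by
    simpa using (hi1.comp_sub_left T).symm
  have hj2 : IntervalIntegrable
      (fun t : ℝ => ‖riemannZeta (1 + (T + t : ℝ) * Complex.I)‖) volume 0 w := by
    simpa using hi2.comp_add_left T
  have e1 : ∫ t in (0 : ℝ)..w, ‖riemannZeta (1 + (T - t : ℝ) * Complex.I)‖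
      = ∫ t in (T - w)..T, ‖riemannZeta (1 + t * Complex.I)‖ := by
    rw [intervalIntegral.integral_comp_sub_left
      (fun t : ℝ => ‖riemannZeta (1 + t * Complex.I)‖) T, sub_zero]
  have e2 : ∫ t in (0 : ℝ)..w, ‖riemannZeta (1 + (T + t : ℝ) * Complex.I)‖
      = ∫ t in T..(T + w), ‖riemannZeta (1 + t * Complex.I)‖ := by
    rw [intervalIntegral.integral_comp_add_left
      (fun t : ℝ => ‖riemannZeta (1 + t * Complex.I)‖) T, add_zero]
  rw [← intervalIntegral.integral_add_adjacent_intervals hi1 hi2, ← e1, ← e2,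
    ← intervalIntegral.integral_add hj1 hj2]
  have hleft : IntervalIntegrable (fun t => (1 - t / w) * zetaSymm 0 T t) volume 0 w := by
    have h : Continuous fun t : ℝ => (1 - t / w) * zetaSymm 0 T (max (-1) (min 1 t)) := by
      have := (continuous_zetaSymm hT2).comp (Continuous.prodMk_right (0 : ℝ))
      simp only [Function.comp_def] at this
      fun_prop
    refine IntervalIntegrable.congr (fun t ht => ?_) (h.intervalIntegrable 0 w)
    simp only [max_neg_one_min_one_eq hw.le hw1 (Set.uIoc_subset_uIcc ht)]
  refine intervalIntegral.integral_mono_on hw.le hleft (hj1.add hj2) fun t ht => ?_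
  have h1 : 0 ≤ 1 - t / w := by
    have := (div_le_one hw).mpr ht.2
    linarith
  have h2 : 1 - t / w ≤ 1 := by
    have := div_nonneg ht.1 hw.le
    linarith
  have ha := Complex.re_le_norm (riemannZeta (1 + (T + t : ℝ) * Complex.I))
  have hb := Complex.re_le_norm (riemannZeta (1 + (T - t : ℝ) * Complex.I))
  have hz : zetaSymm 0 T t ≤ ‖riemannZeta (1 + (T - t : ℝ) * Complex.I)‖
      + ‖riemannZeta (1 + (T + t : ℝ) * Complex.I)‖ := by
    simp only [zetaSymm, Complex.ofReal_zero, add_zero]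
    linarith
  have h0 : 0 ≤ ‖riemannZeta (1 + (T - t : ℝ) * Complex.I)‖
      + ‖riemannZeta (1 + (T + t : ℝ) * Complex.I)‖ := by positivity
  nlinarith

/-- The graph of `x ↦ x ^ p` lies above its tangents. -/
lemma rpow_tangent_le {a x p : ℝ} (ha : 0 < a) (hx : 0 ≤ x) (hp : 1 ≤ p) :
    a ^ (p - 1) * (p * x - (p - 1) * a) ≤ x ^ p := by
  have h := one_add_mul_self_le_rpow_one_add (s := x / a - 1)
    (by have := div_nonneg hx ha.le; linarith) hp
  rw [add_sub_cancel, Real.div_rpow hx ha.le, le_div_iff₀ (by positivity)] at h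
  refine le_trans (le_of_eq ?_) h
  rw [Real.rpow_sub_one ha.ne']
  field_simp
  ring

/-- A short-interval form of Jensen's inequality. -/
lemma rpow_mul_le_integral_rpow {f : ℝ → ℝ} {a b A p : ℝ} (hab : a < b) (hA : 0 < A) (hp : 1 ≤ p)
    (hf : ContinuousOn f (Set.Icc a b)) (h0 : ∀ t, 0 ≤ f t) (hle : A ≤ ∫ t in a..b, f t) :
    (A / (b - a)) ^ (p - 1) * A ≤ ∫ t in a..b, f t ^ p := by
  have hd : 0 < b - a := by linarith
  set r := A / (b - a) with hr
  have hrpos : 0 < r := by positivity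
  have hfi : IntervalIntegrable f volume a b := hf.intervalIntegrable_of_Icc hab.le
  have hfp : IntervalIntegrable (fun t => f t ^ p) volume a b :=
    (hf.rpow_const fun _ _ => Or.inr (by linarith)).intervalIntegrable_of_Icc hab.le
  have h := intervalIntegral.integral_mono_on hab.le
    (((hfi.const_mul p).sub (intervalIntegrable_const (c := (p - 1) * r))).const_mul (r ^ (p - 1)))
    hfp fun t _ => rpow_tangent_le hrpos (h0 t) hp
  refine le_trans ?_ h
  rw [intervalIntegral.integral_const_mul, intervalIntegral.integral_sub (hfi.const_mul p)
    intervalIntegrable_const, intervalIntegral.integral_const_mul, intervalIntegral.integral_const,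
    smul_eq_mul]
  have hrA : (b - a) * ((p - 1) * r) = (p - 1) * A := by rw [hr]; field_simp
  rw [hrA]
  gcongr
  nlinarith

theorem stmt_18 (δ : ℝ) (hδ : 0 < δ) (p : ℝ) (hp : 1 < p) :
    ∃ c > (0 : ℝ), ∀ T₀ : ℝ, (3 : ℝ) ≤ T₀ → ∃ T : ℝ, T₀ ≤ T ∧
      c * Real.log (Real.log T) ^ (p - 1) ≤ ∫ t in T..(T + δ), ‖riemannZeta (1 + t * Complex.I)‖ ^ (p) := by
  refine ⟨(1 / (16 * 33)) ^ (p - 1) * (1 / 8), by positivity, fun T₀ hT₀ => ?_⟩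
  obtain ⟨M, hM3, hMδ, hMT⟩ : ∃ M : ℕ, 3 ≤ M ∧ 2 / δ ≤ Real.log M ∧
      Real.log (T₀ + 1) + 2 ≤ M := by
    have h1 := (Real.tendsto_log_atTop.comp tendsto_natCast_atTop_atTop).eventually_ge_atTop (2 / δ)
    have h2 := (tendsto_natCast_atTop_atTop (R := ℝ)).eventually_ge_atTop (Real.log (T₀ + 1) + 2)
    obtain ⟨M, hM⟩ := ((eventually_ge_atTop 3).and (h1.and h2)).exists
    exact ⟨M, hM.1, hM.2.1, hM.2.2⟩
  have hM3' : (3 : ℝ) ≤ M := by exact_mod_cast hM3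
  set L := Real.log M with hL
  have hL1 : 1 ≤ L := by
    rw [hL, Real.le_log_iff_exp_le (by linarith)]
    linarith [Real.exp_one_lt_d9]
  have hL0 : 0 < L := by linarith
  set w := 1 / L with hw
  have hw0 : 0 < w := by positivity
  have hw1 : w ≤ 1 := by rw [hw, div_le_one hL0]; exact hL1
  have hwδ : 2 * w ≤ δ := by
    rw [div_le_iff₀ hδ] at hMδ
    rw [hw, mul_one_div, div_le_iff₀ hL0]
    linarith
  have hwL : w * L = 1 := by rw [hw]; field_simp
  set N := M ^ 32 with hN
  have hMN : M ≤ N := Nat.le_self_pow (by norm_num) M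
  have hlogN : Real.log N = 32 * L := by rw [hN]; push_cast; rw [Real.log_pow]; norm_num [hL]
  obtain ⟨k, hk1, hkN, hk⟩ := exists_forall_half_le_cos_mul N fun n => (T₀ + 1) * Real.log (n + 1)
  have hk1' : (1 : ℝ) ≤ k := by exact_mod_cast hk1
  set T := k * (T₀ + 1) with hT
  have hTge : T₀ + 1 ≤ T := by rw [hT]; nlinarith
  have hmain : 1 / 8 ≤ ∫ t in (T - w)..(T + w), ‖riemannZeta (1 + t * Complex.I)‖ := by
    refine le_trans ?_ ((le_integral_zetaSymm hw0 hw1 (by linarith) (M := M) (N := N) ?_ hMN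
      (by omega) ?_).trans (integral_zetaSymm_le hw0 hw1 (by linarith)))
    · rw [hlogN]
      have h1 : L ≤ Real.log (M + 1) := Real.log_le_log (by linarith) (by linarith)
      have h2 : 4 / w * (1 / (32 * L)) = 1 / 8 := by
        rw [hw]; field_simp; norm_num
      rw [h2]
      nlinarith
    · intro n hn
      have hn' : (n : ℝ) + 1 ≤ M := by exact_mod_cast hn
      refine le_trans ?_ hwL.le
      rw [hL]
      gcongr
    · intro n hn
      have := hk n hn
      rwa [← mul_assoc] at this
  refine ⟨T - w, by linarith, ?_⟩
  have hcont := continuousOn_norm_zeta (a := T - w) (b := T - w + δ) (by linarith)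
  have hJ := rpow_mul_le_integral_rpow (A := 1 / 8) (p := p) (by linarith : T - w < T + w)
    (by norm_num) hp.le (hcont.mono (Set.Icc_subset_Icc le_rfl (by linarith)))
    (fun _ => norm_nonneg _) hmain
  have hext : ∫ t in (T - w)..(T + w), ‖riemannZeta (1 + t * Complex.I)‖ ^ p
      ≤ ∫ t in (T - w)..(T - w + δ), ‖riemannZeta (1 + t * Complex.I)‖ ^ p := by
    refine intervalIntegral.integral_mono_interval le_rfl (by linarith) (by linarith)
      (Eventually.of_forall fun t => by positivity) ?_
    exact (hcont.rpow_const fun _ _ => Or.inr (by linarith)).intervalIntegrable_of_Icc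
      (by linarith)
  refine le_trans ?_ (hJ.trans hext)
  have hlogT1 : 1 ≤ Real.log (T - w) := by
    rw [Real.le_log_iff_exp_le (by linarith)]
    linarith [Real.exp_one_lt_d9]
  have hlogT : Real.log (T - w) ≤ M ^ 33 := by
    have h6 : Real.log 6 ≤ 2 := by
      rw [Real.log_le_iff_le_exp (by norm_num), show (2 : ℝ) = 1 + 1 by norm_num, Real.exp_add]
      nlinarith [Real.exp_one_gt_d9]
    have hNr : (N : ℝ) = (M : ℝ) ^ 32 := by rw [hN]; push_cast; rfl
    have hN1 : (1 : ℝ) ≤ (M : ℝ) ^ 32 := one_le_pow₀ (by linarith)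
    have hT0 : 0 ≤ Real.log (T₀ + 1) := Real.log_nonneg (by linarith)
    calc Real.log (T - w) ≤ Real.log ((6 : ℝ) ^ N * (T₀ + 1)) := by
          refine Real.log_le_log (by linarith) ?_
          have : (k : ℝ) ≤ (6 : ℝ) ^ N := by exact_mod_cast hkN
          have : T ≤ (6 : ℝ) ^ N * (T₀ + 1) := by rw [hT]; gcongr
          linarith
      _ = (M : ℝ) ^ 32 * Real.log 6 + Real.log (T₀ + 1) := by
          rw [Real.log_mul (by positivity) (by linarith), Real.log_pow, hNr]
      _ ≤ (M : ℝ) ^ 32 * 2 + (M : ℝ) ^ 32 * Real.log (T₀ + 1) := by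
          gcongr
          exact le_mul_of_one_le_left hT0 hN1
      _ = (M : ℝ) ^ 32 * (Real.log (T₀ + 1) + 2) := by ring
      _ ≤ (M : ℝ) ^ 32 * M := by gcongr
      _ = (M : ℝ) ^ 33 := by ring
  have hll : Real.log (Real.log (T - w)) ≤ 33 * L := by
    refine (Real.log_le_log (by linarith) hlogT).trans (le_of_eq ?_)
    rw [Real.log_pow]
    norm_num [hL]
  have hll0 : 0 ≤ Real.log (Real.log (T - w)) := Real.log_nonneg hlogT1
  rw [mul_right_comm, ← Real.mul_rpow (by norm_num) hll0]
  gcongr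
  have : 1 / 8 / (T + w - (T - w)) = L / 16 := by
    rw [hw]; field_simp; ring
  rw [this]
  linarith
end

section
/- For every fixed δ > 0 and every real p > 1 there exists a constant c > 0 such that for every T₀ ≥ 3 there exists T ≥ T₀ with ∫_T^{T+δ} |ζ(1+it)|^{−p} dt ≥ c · (log log T)^{p−1}. (Equivalently, ∫_T^{T+δ} |ζ(1+it)|^{−p} dt = Ω((log log T)^{p−1}) as T → ∞.) -/
open Complex Real Filter MeasureTheory intervalIntegral

lemma abs_integral_cos_mul_le (a b : ℝ) {x : ℝ} (hx : x ≠ 0) :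
    |∫ t in a..b, Real.cos (t * x)| ≤ 2 / |x| := by
  rw [intervalIntegral.integral_comp_mul_right (fun u => Real.cos u) hx, integral_cos, smul_eq_mul,
    abs_mul, abs_inv, div_eq_inv_mul]
  gcongr
  have h1 := Real.abs_sin_le_one (b * x)
  have h2 := Real.abs_sin_le_one (a * x)
  exact (abs_sub _ _).trans (by linarith)

lemma inv_le_abs_log_sub_log {a b : ℕ} {M : ℝ} (ha : 0 < a) (hb : 0 < b) (hab : a ≠ b)
    (haM : (a : ℝ) ≤ M) (hbM : (b : ℝ) ≤ M) : M⁻¹ ≤ |Real.log a - Real.log b| := by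
  wlog h : b < a generalizing a b
  · rw [abs_sub_comm]
    exact this hb ha hab.symm hbM haM (by omega)
  have ha' : (0 : ℝ) < a := by exact_mod_cast ha
  have hb' : (0 : ℝ) < b := by exact_mod_cast hb
  have h' : (b : ℝ) + 1 ≤ a := by exact_mod_cast h
  rw [← Real.log_div ha'.ne' hb'.ne']
  refine le_trans ?_ (le_abs_self _)
  refine le_trans ?_ (Real.one_sub_inv_le_log_of_pos (div_pos ha' hb'))
  calc M⁻¹ ≤ (a : ℝ)⁻¹ := by gcongr
    _ ≤ 1 - (a / b : ℝ)⁻¹ := by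
      field_simp
      linarith

lemma abs_integral_cos_log_sub_le {a b : ℕ} {M : ℝ} (ha : 0 < a) (hb : 0 < b)
    (haM : (a : ℝ) ≤ M) (hbM : (b : ℝ) ≤ M) (T : ℝ) :
    |(∫ t in T..(2 * T), Real.cos (t * (Real.log a - Real.log b))) - if a = b then T else 0|
      ≤ 2 * M := by
  have hM : 0 < M := lt_of_lt_of_le (by exact_mod_cast ha) haM
  split_ifs with h
  · subst h
    simp only [sub_self, mul_zero, Real.cos_zero, intervalIntegral.integral_const, smul_eq_mul]
    rw [show (2 * T - T) * 1 - T = 0 by ring]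
    simp [hM.le]
  · have h1 := inv_le_abs_log_sub_log ha hb h haM hbM
    have h0 : 0 < |Real.log a - Real.log b| := lt_of_lt_of_le (inv_pos.mpr hM) h1
    rw [sub_zero]
    refine (abs_integral_cos_mul_le _ _ (abs_pos.mp h0)).trans ?_
    rw [div_le_iff₀ h0]
    calc (2 : ℝ) = 2 * M * M⁻¹ := by field_simp
      _ ≤ _ := by gcongr

/-- The squared modulus of the Dirichlet polynomial `∑ n ∈ S, l n * n ^ (i t)`. -/
noncomputable def dirichletPolySq (S : Finset ℕ) (l : ℕ → ℝ) (t : ℝ) : ℝ :=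
  (∑ n ∈ S, l n * Real.cos (t * Real.log n)) ^ 2 + (∑ n ∈ S, l n * Real.sin (t * Real.log n)) ^ 2

lemma dirichletPolySq_nonneg (S : Finset ℕ) (l : ℕ → ℝ) (t : ℝ) : 0 ≤ dirichletPolySq S l t := by
  unfold dirichletPolySq
  positivity

@[fun_prop]
lemma continuous_dirichletPolySq (S : Finset ℕ) (l : ℕ → ℝ) :
    Continuous (dirichletPolySq S l) := by
  unfold dirichletPolySq
  fun_prop

lemma dirichletPolySq_mul_cos (S : Finset ℕ) (hS : ∀ n ∈ S, 0 < n) (l : ℕ → ℝ) {q : ℕ}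
    (hq : 0 < q) (t : ℝ) :
    dirichletPolySq S l t * Real.cos (t * Real.log q) =
      ∑ n ∈ S, ∑ m ∈ S,
        l n * l m * Real.cos (t * (Real.log (q * n : ℕ) - Real.log m)) := by
  have hsum : ∑ n ∈ S, ∑ m ∈ S, l n * l m *
      (Real.sin (t * Real.log n - t * Real.log m) * Real.sin (t * Real.log q)) = 0 := by
    have h := Finset.sum_comm (s := S) (t := S) (f := fun n m => l n * l m *
      (Real.sin (t * Real.log n - t * Real.log m) * Real.sin (t * Real.log q)))
    have h2 : ∑ m ∈ S, ∑ n ∈ S, l n * l m *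
        (Real.sin (t * Real.log n - t * Real.log m) * Real.sin (t * Real.log q)) =
        -∑ m ∈ S, ∑ n ∈ S, l m * l n *
        (Real.sin (t * Real.log m - t * Real.log n) * Real.sin (t * Real.log q)) := by
      simp only [← Finset.sum_neg_distrib]
      refine Finset.sum_congr rfl fun m _ => Finset.sum_congr rfl fun n _ => ?_
      rw [← neg_sub (t * Real.log m), Real.sin_neg]
      ring
    linarith
  have hexp : ∀ n ∈ S, ∀ m ∈ S, l n * l m * Real.cos (t * (Real.log (q * n : ℕ) - Real.log m)) =
      ((l n * Real.cos (t * Real.log n)) * (l m * Real.cos (t * Real.log m)) +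
      (l n * Real.sin (t * Real.log n)) * (l m * Real.sin (t * Real.log m))) *
        Real.cos (t * Real.log q) - l n * l m *
      (Real.sin (t * Real.log n - t * Real.log m) * Real.sin (t * Real.log q)) := by
    intro n hn m _
    have hn' : (n : ℝ) ≠ 0 := by exact_mod_cast (hS n hn).ne'
    have hq' : (q : ℝ) ≠ 0 := by exact_mod_cast hq.ne'
    rw [Nat.cast_mul, Real.log_mul hq' hn', show t * (Real.log q + Real.log n - Real.log m) =
      (t * Real.log n - t * Real.log m) + t * Real.log q by ring, Real.cos_add, Real.cos_sub]
    ring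
  rw [Finset.sum_congr rfl fun n hn => Finset.sum_congr rfl fun m hm => hexp n hn m hm]
  simp only [Finset.sum_sub_distrib, hsum, sub_zero, ← Finset.sum_mul, Finset.sum_add_distrib]
  rw [dirichletPolySq, sq, sq, Finset.sum_mul_sum, Finset.sum_mul_sum]

lemma abs_integral_dirichletPolySq_mul_cos_le (S : Finset ℕ) (hS : ∀ n ∈ S, 0 < n) {l : ℕ → ℝ}
    (hl : ∀ n, |l n| = 1) {q : ℕ} (hq : 0 < q) {M : ℝ} (hM : ∀ n ∈ S, ((q * n : ℕ) : ℝ) ≤ M)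
    (T : ℝ) :
    |(∫ t in T..(2 * T), dirichletPolySq S l t * Real.cos (t * Real.log q)) -
      T * ∑ n ∈ S, ∑ m ∈ S, (if q * n = m then l n * l m else 0)| ≤ (S.card : ℝ) ^ 2 * (2 * M) := by
  simp only [dirichletPolySq_mul_cos S hS l hq]
  have hint : ∀ n m : ℕ, IntervalIntegrable
      (fun t => l n * l m * Real.cos (t * (Real.log (q * n : ℕ) - Real.log m)))
      volume T (2 * T) := fun n m => Continuous.intervalIntegrable (by fun_prop) _ _
  rw [intervalIntegral.integral_finsetSum fun n _ => Continuous.intervalIntegrable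
    (by fun_prop) _ _]
  simp only [intervalIntegral.integral_finsetSum fun m _ => hint _ m,
    intervalIntegral.integral_const_mul, Finset.mul_sum, ← Finset.sum_sub_distrib]
  have hterm : ∀ n ∈ S, ∀ m ∈ S,
      |l n * l m * (∫ t in T..(2 * T), Real.cos (t * (Real.log (q * n : ℕ) - Real.log m))) -
        T * (if q * n = m then l n * l m else 0)| ≤ 2 * M := by
    intro n hn m hm
    have hmM : (m : ℝ) ≤ M := le_trans (by
      exact_mod_cast Nat.le_mul_of_pos_left m hq) (hM m hm)
    have h := abs_integral_cos_log_sub_le (Nat.mul_pos hq (hS n hn)) (hS m hm) (hM n hn) hmM T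
    rw [show T * (if q * n = m then l n * l m else 0) =
      l n * l m * (if q * n = m then T else 0) by split_ifs <;> ring, ← mul_sub, abs_mul, abs_mul,
      hl, hl, one_mul, one_mul]
    exact h
  calc _ ≤ ∑ n ∈ S, ∑ m ∈ S, 2 * M :=
        (Finset.abs_sum_le_sum_abs _ _).trans <| Finset.sum_le_sum fun n hn =>
          (Finset.abs_sum_le_sum_abs _ _).trans <| Finset.sum_le_sum fun m hm => hterm n hn m hm
    _ = _ := by
      simp only [Finset.sum_const, nsmul_eq_mul]
      ring

lemma card_divisors_sub_le {q k Q : ℕ} (hq : q.Prime) (hQ : Q ≠ 0) (hk : q ^ k ∣ Q) :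
    (k + 1) * Q.divisors.card ≤
      (k + 1) * (Q.divisors.filter fun n => q * n ∈ Q.divisors).card + Q.divisors.card := by
  obtain ⟨v, R, hR, rfl⟩ := Nat.exists_eq_pow_mul_and_not_dvd hQ q hq.ne_one
  have hR0 : R ≠ 0 := by rintro rfl; simp at hR
  have hcop : ∀ j, (q ^ j).Coprime R := fun j => Nat.Coprime.pow_left j ((hq.coprime_iff_not_dvd).2 hR)
  have hkv : k ≤ v := by
    have := (Nat.Coprime.dvd_mul_right (hcop k)).1 hk
    exact (Nat.pow_dvd_pow_iff_le_right hq.one_lt).1 this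
  have hcard : ∀ j, (q ^ j * R).divisors.card = (j + 1) * R.divisors.card := fun j => by
    rw [(hcop j).card_divisors_mul, Nat.divisors_prime_pow hq, Finset.card_map, Finset.card_range]
  have hfil : v * R.divisors.card ≤
      ((q ^ v * R).divisors.filter fun n => q * n ∈ (q ^ v * R).divisors).card := by
    rcases Nat.eq_zero_or_pos v with rfl | hv
    · simp
    · obtain ⟨w, rfl⟩ := Nat.exists_eq_add_of_le' hv
      rw [← hcard w]
      refine Finset.card_le_card fun n hn => ?_
      have hdvd := Nat.dvd_of_mem_divisors hn
      have h1 : q * n ∣ q ^ (w + 1) * R := by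
        rw [pow_succ, mul_comm (q ^ w), mul_assoc]
        exact mul_dvd_mul_left q hdvd
      simp only [Finset.mem_filter, Nat.mem_divisors]
      exact ⟨⟨(Dvd.intro_left q rfl).trans h1, hQ⟩, h1, hQ⟩
  rw [hcard v]
  nlinarith [Nat.mul_le_mul_right (R.divisors.card) hkv, Nat.mul_le_mul_left (k + 1) hfil]

/-- The Liouville function with real values. -/
noncomputable def liouvilleSign (n : ℕ) : ℝ := (-1) ^ ArithmeticFunction.cardFactors n

lemma sum_liouvilleSign_mul {q Q : ℕ} (hq : q.Prime) :
    ∑ n ∈ Q.divisors, ∑ m ∈ Q.divisors,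
      (if q * n = m then liouvilleSign n * liouvilleSign m else 0) =
      -((Q.divisors.filter fun n => q * n ∈ Q.divisors).card : ℝ) := by
  simp only [Finset.sum_ite_eq]
  rw [← Finset.sum_filter, Finset.cast_card, ← Finset.sum_neg_distrib]
  refine Finset.sum_congr rfl fun n hn => ?_
  have hn0 : n ≠ 0 := (Nat.pos_of_mem_divisors (Finset.mem_filter.1 hn).1).ne'
  rw [liouvilleSign, liouvilleSign, ArithmeticFunction.cardFactors_mul hq.ne_zero hn0,
    ArithmeticFunction.cardFactors_apply_prime hq, pow_add, pow_one, mul_left_comm, ← mul_pow]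
  norm_num

/-- The length of the interval on which `exists_cos_resonance` finds a resonance point. -/
noncomputable def resonanceLength (y : ℕ) : ℝ :=
  (4 * y + 8) * y * (((y.factorial ^ y : ℕ) : ℝ)) ^ 2

/-- There is a controlled `t` such that `p ^ (i t)` is close to `-1` on average over the
primes `p ≤ y`. -/
lemma exists_cos_resonance {y : ℕ} (hy : 1 ≤ y) {c : ℕ → ℝ}
    (hc1 : ∀ n, 1 ≤ n → c n ≤ 1) :
    ∃ t ∈ Set.Icc (resonanceLength y) (2 * resonanceLength y),
      ∑ q ∈ (Finset.Icc 1 y).filter Nat.Prime, c q * (1 + Real.cos (t * Real.log q)) ≤ 4 := by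
  set Q := y.factorial ^ y with hQdef
  set T := resonanceLength y with hT
  have hQ0 : Q ≠ 0 := pow_ne_zero _ y.factorial_ne_zero
  set S := Q.divisors with hS
  set D : ℝ := (S.card : ℝ) with hD
  set P := (Finset.Icc 1 y).filter Nat.Prime with hP
  have hSpos : ∀ n ∈ S, 0 < n := fun n hn => Nat.pos_of_mem_divisors hn
  have hl : ∀ n, |liouvilleSign n| = 1 := fun n => by simp [liouvilleSign]
  set W := dirichletPolySq S liouvilleSign with hW
  have hy' : (1 : ℝ) ≤ y := by exact_mod_cast hy
  have hQ1 : (1 : ℝ) ≤ Q := by exact_mod_cast Nat.one_le_iff_ne_zero.2 hQ0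
  have hTeq : T = (4 * y + 8) * y * (Q : ℝ) ^ 2 := rfl
  have hTpos : 0 < T := by rw [hTeq]; positivity
  have hDpos : 0 < D := by
    rw [hD, hS]; exact_mod_cast Finset.card_pos.2 (Nat.nonempty_divisors.2 hQ0)
  have hDQ : D ≤ Q := by rw [hD, hS]; exact_mod_cast Nat.card_divisors_le_self Q
  set E : ℝ := D ^ 2 * (2 * (y * Q)) with hE
  have hbound : ∀ q ∈ Finset.Icc 1 y, ∀ n ∈ S, ((q * n : ℕ) : ℝ) ≤ y * Q := by
    intro q hq n hn
    have h1 := (Finset.mem_Icc.1 hq).2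
    have h2 := Nat.divisor_le hn
    exact_mod_cast Nat.mul_le_mul h1 h2
  have hW0 : |(∫ t in T..(2 * T), W t) - T * D| ≤ E := by
    have h := abs_integral_dirichletPolySq_mul_cos_le S hSpos hl one_pos
      (hbound 1 (Finset.mem_Icc.2 ⟨le_rfl, hy⟩)) T
    have hs : ∑ n ∈ S, ∑ m ∈ S, (if 1 * n = m then liouvilleSign n * liouvilleSign m else 0)
        = D := by
      simp only [one_mul, Finset.sum_ite_eq]
      rw [hD, Finset.cast_card]
      refine Finset.sum_congr rfl fun n hn => ?_
      rw [if_pos hn, ← abs_mul_abs_self, hl, one_mul]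
    rw [hs] at h
    simpa only [Nat.cast_one, Real.log_one, mul_zero, Real.cos_zero, mul_one] using h
  obtain ⟨h0, h0'⟩ := abs_le.1 hW0
  have hq : ∀ q ∈ P, ∫ t in T..(2 * T), W t * (c q * (1 + Real.cos (t * Real.log q))) ≤
      T * D / (y + 1) + 2 * E := by
    intro q hqP
    obtain ⟨hqI, hqp⟩ := Finset.mem_filter.1 hqP
    have h := (abs_le.1 (abs_integral_dirichletPolySq_mul_cos_le S hSpos hl hqp.pos
      (hbound q hqI) T)).2
    rw [sum_liouvilleSign_mul hqp] at h
    have hdvd : q ^ y ∣ Q := pow_dvd_pow_of_dvd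
      (Nat.dvd_factorial hqp.pos (Finset.mem_Icc.1 hqI).2) y
    have hcard : ((y : ℝ) + 1) * D ≤
        (y + 1) * ((S.filter fun n => q * n ∈ S).card : ℝ) + D := by
      rw [hD]
      exact_mod_cast card_divisors_sub_le hqp hQ0 hdvd
    have hnn : 0 ≤ ∫ t in T..(2 * T), (W t + W t * Real.cos (t * Real.log q)) := by
      refine intervalIntegral.integral_nonneg (by linarith) fun t _ => ?_
      have h1 := dirichletPolySq_nonneg S liouvilleSign t
      have h2 := Real.neg_one_le_cos (t * Real.log q)
      nlinarith
    have hadd : ∫ t in T..(2 * T), (W t + W t * Real.cos (t * Real.log q)) =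
        (∫ t in T..(2 * T), W t) + ∫ t in T..(2 * T), W t * Real.cos (t * Real.log q) :=
      intervalIntegral.integral_add (Continuous.intervalIntegrable (by fun_prop) _ _)
        (Continuous.intervalIntegrable (by fun_prop) _ _)
    calc _ = c q * ∫ t in T..(2 * T), (W t + W t * Real.cos (t * Real.log q)) := by
          rw [← intervalIntegral.integral_const_mul]
          congr 1; ext t; ring
      _ ≤ 1 * ∫ t in T..(2 * T), (W t + W t * Real.cos (t * Real.log q)) :=
          mul_le_mul_of_nonneg_right (hc1 q hqp.one_le) hnn
      _ ≤ T * D / (y + 1) + 2 * E := by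
          rw [one_mul, hadd]
          have h3 : T * (D - ((S.filter fun n => q * n ∈ S).card : ℝ)) ≤ T * (D / (y + 1)) := by
            gcongr
            rw [le_div_iff₀ (by positivity)]
            linarith
          rw [← mul_div_assoc] at h3
          linarith
  by_contra! hcon
  have hlow : 4 * ∫ t in T..(2 * T), W t ≤
      ∫ t in T..(2 * T), ∑ q ∈ P, W t * (c q * (1 + Real.cos (t * Real.log q))) := by
    rw [← intervalIntegral.integral_const_mul]
    refine intervalIntegral.integral_mono_on (by linarith)
      (Continuous.intervalIntegrable (by fun_prop) _ _)
      (Continuous.intervalIntegrable (by fun_prop) _ _) fun t ht => ?_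
    rw [← Finset.mul_sum, mul_comm]
    exact mul_le_mul_of_nonneg_left (hcon t ht).le (dirichletPolySq_nonneg S liouvilleSign t)
  rw [intervalIntegral.integral_finsetSum fun q _ =>
    Continuous.intervalIntegrable (by fun_prop) _ _] at hlow
  have hPcard : (P.card : ℝ) ≤ y := by
    have := Finset.card_filter_le (Finset.Icc 1 y) Nat.Prime
    rw [Nat.card_Icc, Nat.add_sub_cancel] at this
    exact_mod_cast this
  have hup : ∑ q ∈ P, ∫ t in T..(2 * T), W t * (c q * (1 + Real.cos (t * Real.log q))) ≤
      y * (T * D / (y + 1) + 2 * E) := by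
    refine (Finset.sum_le_sum hq).trans ?_
    rw [Finset.sum_const, nsmul_eq_mul]
    gcongr
  have h5 : y * (T * D / (y + 1)) ≤ T * D := by
    rw [← mul_div_assoc, div_le_iff₀ (by positivity)]
    nlinarith [mul_pos hTpos hDpos]
  have h6 : (2 * y + 4) * E ≤ T * D := by
    rw [hE, hTeq]
    calc (2 * y + 4) * (D ^ 2 * (2 * (y * Q))) = ((4 * y + 8) * y * Q * D) * D := by ring
      _ ≤ ((4 * y + 8) * y * Q * D) * Q := by gcongr
      _ = _ := by ring
  nlinarith [mul_pos hTpos hDpos]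

/-- The real part of the prime zeta function at `σ + i t`. -/
noncomputable def primeCosSum (σ t : ℝ) : ℝ :=
  ∑' q : Nat.Primes, (q : ℝ) ^ (-σ) * Real.cos (t * Real.log q)

lemma summable_primes_rpow_neg {σ : ℝ} (hσ : 1 < σ) :
    Summable fun q : Nat.Primes => (q : ℝ) ^ (-σ) :=
  Nat.Primes.summable_rpow.2 (by linarith)

lemma summable_primes_rpow_neg_mul_cos {σ : ℝ} (hσ : 1 < σ) (t : ℝ) :
    Summable fun q : Nat.Primes => (q : ℝ) ^ (-σ) * Real.cos (t * Real.log q) := by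
  refine Summable.of_norm_bounded (summable_primes_rpow_neg hσ) fun q => ?_
  have hq : (0 : ℝ) < q := by exact_mod_cast q.2.pos
  rw [norm_mul, Real.norm_of_nonneg (by positivity), Real.norm_eq_abs]
  exact mul_le_of_le_one_right (by positivity) (Real.abs_cos_le_one _)

lemma primeCosSum_zero (σ : ℝ) : primeCosSum σ 0 = ∑' q : Nat.Primes, (q : ℝ) ^ (-σ) := by
  simp [primeCosSum]

lemma re_natCast_cpow_neg {n : ℕ} (hn : 0 < n) (σ t : ℝ) :
    ((n : ℂ) ^ (-(σ + t * I))).re = (n : ℝ) ^ (-σ) * Real.cos (t * Real.log n) := by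
  have hn' : (0 : ℝ) < n := by exact_mod_cast hn
  rw [Complex.cpow_def_of_ne_zero (by exact_mod_cast hn.ne'), ← Complex.natCast_log, Complex.exp_re,
    Real.rpow_def_of_pos hn']
  congr 1
  · simp [Complex.log_re, Complex.log_im]
  · rw [← Real.cos_neg]
    simp [Complex.log_re, Complex.log_im, mul_comm]

lemma abs_log_norm_riemannZeta_sub_le {σ : ℝ} (hσ : 1 < σ) (t : ℝ) :
    |Real.log ‖riemannZeta (σ + t * I)‖ - primeCosSum σ t| ≤
      ∑' q : Nat.Primes, (q : ℝ) ^ (-2 : ℝ) := by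
  set s : ℂ := σ + t * I with hs
  have hre : s.re = σ := by simp [hs]
  have hnorm : ∀ q : Nat.Primes, ‖((q : ℕ) : ℂ) ^ (-s)‖ = (q : ℝ) ^ (-σ) := fun q => by
    rw [Complex.norm_natCast_cpow_of_pos q.2.pos, Complex.neg_re, hre]
  have hsum1 : Summable fun q : Nat.Primes => -((q : ℕ) : ℂ) ^ (-s) :=
    Summable.of_norm (by simpa only [norm_neg, hnorm] using summable_primes_rpow_neg hσ)
  have hsum2 : Summable fun q : Nat.Primes => -Complex.log (1 - ((q : ℕ) : ℂ) ^ (-s)) := by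
    simpa only [sub_eq_add_neg] using (Complex.summable_log_one_add_of_summable hsum1).neg
  have hsum3 : Summable fun q : Nat.Primes => (q : ℝ) ^ (-2 : ℝ) :=
    summable_primes_rpow_neg one_lt_two
  have hlog : Real.log ‖riemannZeta s‖ =
      ∑' q : Nat.Primes, (-Complex.log (1 - ((q : ℕ) : ℂ) ^ (-s))).re := by
    rw [← riemannZeta_eulerProduct_exp_log (by rw [hre]; exact hσ), Complex.norm_exp,
      Real.log_exp, Complex.re_tsum hsum2]
  rw [hlog, primeCosSum, ← Summable.tsum_sub (Complex.hasSum_re hsum2.hasSum).summable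
    (summable_primes_rpow_neg_mul_cos hσ t), ← Real.norm_eq_abs]
  refine tsum_of_norm_bounded hsum3.hasSum fun q => ?_
  have hq2 : (2 : ℝ) ≤ q := by exact_mod_cast q.2.two_le
  have hz : ‖((q : ℕ) : ℂ) ^ (-s)‖ ≤ (q : ℝ)⁻¹ := by
    rw [hnorm, ← Real.rpow_neg_one]
    exact Real.rpow_le_rpow_of_exponent_le (by linarith) (by linarith)
  have hqi : (q : ℝ)⁻¹ ≤ 1 / 2 := by
    rw [one_div]; gcongr
  set z : ℂ := ((q : ℕ) : ℂ) ^ (-s) with hzdef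
  have h1 := Complex.norm_log_one_add_sub_self_le (z := -z) (by rw [norm_neg]; linarith)
  rw [norm_neg] at h1
  have h2 : ‖z‖ ^ 2 * (1 - ‖z‖)⁻¹ / 2 ≤ (q : ℝ) ^ (-2 : ℝ) := by
    have h3 : (1 - ‖z‖)⁻¹ ≤ 2 := by
      rw [inv_le_comm₀ (by linarith) two_pos]; linarith
    have h4 : (q : ℝ) ^ (-2 : ℝ) = ((q : ℝ)⁻¹) ^ 2 := by
      rw [Real.rpow_neg (by linarith), inv_pow]; norm_num
    rw [h4]
    calc ‖z‖ ^ 2 * (1 - ‖z‖)⁻¹ / 2 ≤ ‖z‖ ^ 2 * 2 / 2 := by gcongr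
      _ = ‖z‖ ^ 2 := by ring
      _ ≤ _ := by gcongr
  refine le_trans ?_ (h1.trans h2)
  rw [← re_natCast_cpow_neg q.2.pos, ← hs, ← hzdef, ← Complex.sub_re, Real.norm_eq_abs]
  refine (Complex.abs_re_le_norm _).trans_eq ?_
  rw [← norm_neg, ← sub_eq_add_neg]
  congr 1
  ring

lemma exists_riemannZeta_real_bounds : ∃ r > (0 : ℝ), ∀ x : ℝ, 0 < x → x ≤ r →
    1 / (2 * x) ≤ ‖riemannZeta ((1 + x : ℝ) + (0 : ℝ) * I)‖ ∧
      ‖riemannZeta ((1 + x : ℝ) + (0 : ℝ) * I)‖ ≤ 2 / x := by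
  have h1 := (continuous_norm.tendsto (1 : ℂ)).comp riemannZeta_residue_one
  rw [norm_one] at h1
  have h2 := h1.eventually (Icc_mem_nhds (show (1 / 2 : ℝ) < 1 by norm_num) one_lt_two)
  rw [eventually_nhdsWithin_iff, Metric.eventually_nhds_iff] at h2
  obtain ⟨e, he, h⟩ := h2
  refine ⟨e / 2, by positivity, fun x hx hxe => ?_⟩
  have h3 := @h ((1 + x : ℝ) + (0 : ℝ) * I) (by
    simp [dist_eq_norm, abs_of_pos hx]; linarith) (by
    simp [hx.ne'])
  have h4 : ((1 + x : ℝ) + (0 : ℝ) * I : ℂ) - 1 = (x : ℂ) := by push_cast; ring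
  simp only [Function.comp_apply, h4, norm_mul, Complex.norm_real, Real.norm_of_nonneg hx.le]
    at h3

  constructor
  · rw [div_le_iff₀ (by positivity)]; linarith [h3.1]
  · rw [le_div_iff₀ hx]; linarith [h3.2]

lemma primeCosSum_zero_bounds {r : ℝ} (hr : ∀ x : ℝ, 0 < x → x ≤ r →
    1 / (2 * x) ≤ ‖riemannZeta ((1 + x : ℝ) + (0 : ℝ) * I)‖ ∧
      ‖riemannZeta ((1 + x : ℝ) + (0 : ℝ) * I)‖ ≤ 2 / x) {x : ℝ} (hx : 0 < x) (hxr : x ≤ r) :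
    Real.log (1 / (2 * x)) - ∑' q : Nat.Primes, (q : ℝ) ^ (-2 : ℝ) ≤ primeCosSum (1 + x) 0 ∧
      primeCosSum (1 + x) 0 ≤ Real.log (2 / x) + ∑' q : Nat.Primes, (q : ℝ) ^ (-2 : ℝ) := by
  obtain ⟨h1, h2⟩ := hr x hx hxr
  have h3 := abs_le.1 (abs_log_norm_riemannZeta_sub_le (show 1 < 1 + x by linarith) 0)
  have hpos : (0 : ℝ) < 1 / (2 * x) := by positivity
  have h4 := Real.log_le_log hpos h1
  have h5 := Real.log_le_log (hpos.trans_le h1) h2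
  constructor <;> linarith [h3.1, h3.2]

lemma exists_norm_inv_riemannZeta_le_s19 : ∃ r > (0 : ℝ), ∃ K > (0 : ℝ), ∀ x t : ℝ, 0 < x → x ≤ r →
    ‖riemannZeta ((1 + x : ℝ) + t * I)‖⁻¹ ≤ K / x := by
  obtain ⟨r, hr0, hr⟩ := exists_riemannZeta_real_bounds
  set C := ∑' q : Nat.Primes, (q : ℝ) ^ (-2 : ℝ) with hC
  refine ⟨r, hr0, 2 * Real.exp (2 * C), by positivity, fun x t hx hxr => ?_⟩
  have hσ : 1 < 1 + x := by linarith
  have h1 := abs_le.1 (abs_log_norm_riemannZeta_sub_le hσ t)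
  have h2 := (primeCosSum_zero_bounds hr hx hxr).2
  have h3 : -primeCosSum (1 + x) 0 ≤ primeCosSum (1 + x) t := by
    rw [primeCosSum_zero, primeCosSum, ← tsum_neg]
    refine Summable.tsum_le_tsum (fun q => ?_) (summable_primes_rpow_neg hσ).neg
      (summable_primes_rpow_neg_mul_cos hσ t)
    have hq : (0 : ℝ) ≤ (q : ℝ) ^ (-(1 + x)) := by positivity
    nlinarith [Real.neg_one_le_cos (t * Real.log q)]
  have hne : riemannZeta ((1 + x : ℝ) + t * I) ≠ 0 :=
    riemannZeta_ne_zero_of_one_le_re (by simpa using hx.le)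
  have hpos := norm_pos_iff.2 hne
  rw [← Real.exp_log (inv_pos.2 hpos), Real.log_inv]
  calc Real.exp (-Real.log ‖riemannZeta ((1 + x : ℝ) + t * I)‖)
      ≤ Real.exp (Real.log (2 / x) + 2 * C) := by
        apply Real.exp_le_exp.2
        linarith [h1.1]
    _ = _ := by
        rw [Real.exp_add, Real.exp_log (by positivity)]
        ring

lemma tsum_primes_indicator_Icc (y : ℕ) (f : ℕ → ℝ) :
    ∑' q : Nat.Primes, (if (q : ℕ) ≤ y then f q else 0) =
      ∑ q ∈ (Finset.Icc 1 y).filter Nat.Prime, f q := by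
  have h := tsum_subtype {n : ℕ | n.Prime} (fun n => if n ≤ y then f n else 0)
  refine h.trans ?_
  rw [tsum_eq_sum (s := (Finset.Icc 1 y).filter Nat.Prime)]
  · refine Finset.sum_congr rfl fun n hn => ?_
    obtain ⟨h1, h2⟩ := Finset.mem_filter.1 hn
    rw [Set.indicator_of_mem (show n ∈ {n : ℕ | n.Prime} from h2),
      if_pos (Finset.mem_Icc.1 h1).2]
  · intro n hn
    by_cases hp : n.Prime
    · have : ¬ n ≤ y := fun hny =>
        hn (Finset.mem_filter.2 ⟨Finset.mem_Icc.2 ⟨hp.one_le, hny⟩, hp⟩)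
      simp [this]
    · exact Set.indicator_of_notMem hp _

/-- The Riemann zeta function takes values of the smallest possible order on the line
`Re s = 1 + 1 / log y`, at a controlled height. -/
lemma exists_norm_riemannZeta_le : ∃ K > (0 : ℝ), ∀ᶠ y : ℕ in atTop,
    ∃ t ∈ Set.Icc (resonanceLength y) (2 * resonanceLength y),
      ‖riemannZeta ((1 + (Real.log y)⁻¹ : ℝ) + t * I)‖ ≤ K * (Real.log y)⁻¹ := by
  obtain ⟨r, hr0, hr⟩ := exists_riemannZeta_real_bounds
  set C := ∑' q : Nat.Primes, (q : ℝ) ^ (-2 : ℝ) with hC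
  refine ⟨2 * Real.exp (4 + 4 * Real.log 8 + 10 * C), by positivity, ?_⟩
  have hlim : Tendsto (fun y : ℕ => Real.log y) atTop atTop :=
    Real.tendsto_log_atTop.comp tendsto_natCast_atTop_atTop
  filter_upwards [hlim.eventually_ge_atTop (2 / r), hlim.eventually_gt_atTop 0,
    eventually_ge_atTop 1] with y hy1 hlogpos hy
  set x := (Real.log y)⁻¹ with hx
  have hxpos : 0 < x := inv_pos.2 hlogpos
  have hxr : 2 * x ≤ r := by
    rw [hx, ← div_eq_mul_inv, div_le_iff₀ hlogpos]
    rw [div_le_iff₀ hr0] at hy1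
    linarith
  have hσ : 1 < 1 + x := by linarith
  have hσ2 : 1 < 1 + 2 * x := by linarith
  obtain ⟨t, ht, hres⟩ := exists_cos_resonance hy (c := fun n => (n : ℝ) ^ (-(1 + x)))
    (fun n hn => Real.rpow_le_one_of_one_le_of_nonpos (by exact_mod_cast hn) (by linarith))
  refine ⟨t, ht, ?_⟩
  have hb1 := primeCosSum_zero_bounds hr hxpos (by linarith)
  have hb2 := (primeCosSum_zero_bounds hr (x := 2 * x) (by linarith) hxr).1
  have hlog := (abs_le.1 (abs_log_norm_riemannZeta_sub_le hσ t)).2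
  have hs := summable_primes_rpow_neg hσ
  have hs2 := summable_primes_rpow_neg hσ2
  have hsc := summable_primes_rpow_neg_mul_cos hσ t
  have hfin : Summable fun q : Nat.Primes =>
      if (q : ℕ) ≤ y then (q : ℝ) ^ (-(1 + x)) * (1 + Real.cos (t * Real.log q)) else 0 := by
    refine Summable.of_norm_bounded (hs.mul_left 2) fun q => ?_
    have hq : (0 : ℝ) ≤ (q : ℝ) ^ (-(1 + x)) := by positivity
    have h1 := Real.neg_one_le_cos (t * Real.log q)
    have h2 := Real.cos_le_one (t * Real.log q)
    split_ifs
    · rw [Real.norm_of_nonneg (mul_nonneg hq (by linarith))]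
      nlinarith
    · simpa using hq
  have hmain : primeCosSum (1 + x) 0 + primeCosSum (1 + x) t ≤
      4 + 4 * (primeCosSum (1 + x) 0 - primeCosSum (1 + 2 * x) 0) := by
    rw [← tsum_primes_indicator_Icc y
      (fun q => (q : ℝ) ^ (-(1 + x)) * (1 + Real.cos (t * Real.log q)))] at hres
    refine le_trans ?_ (add_le_add_left hres _)
    rw [primeCosSum_zero, primeCosSum_zero, primeCosSum, ← Summable.tsum_add hs hsc,
      ← Summable.tsum_sub hs hs2, ← tsum_mul_left,
      ← Summable.tsum_add hfin ((hs.sub hs2).mul_left 4)]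
    refine Summable.tsum_le_tsum (fun q => ?_) (hs.add hsc) (hfin.add ((hs.sub hs2).mul_left 4))
    have hq1 : (1 : ℝ) ≤ q := by exact_mod_cast q.2.one_le
    have hq : (0 : ℝ) ≤ (q : ℝ) ^ (-(1 + x)) := by positivity
    have hsplit : (q : ℝ) ^ (-(1 + 2 * x)) = (q : ℝ) ^ (-(1 + x)) * (q : ℝ) ^ (-x) := by
      rw [← Real.rpow_add (by linarith)]; ring_nf
    have h2 := Real.cos_le_one (t * Real.log q)
    have hqx : (q : ℝ) ^ (-x) ≤ 1 := Real.rpow_le_one_of_one_le_of_nonpos hq1 (by linarith)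
    rw [hsplit]
    split_ifs with hqy
    · nlinarith
    · have hyq : (y : ℝ) ≤ q := by exact_mod_cast (not_le.1 hqy).le
      have hhalf : (q : ℝ) ^ (-x) ≤ 1 / 2 := by
        calc (q : ℝ) ^ (-x) ≤ (y : ℝ) ^ (-x) :=
              Real.rpow_le_rpow_of_nonpos (by exact_mod_cast hy) hyq (by linarith)
          _ = Real.exp (-1) := by
              rw [Real.rpow_def_of_pos (by exact_mod_cast hy), hx]
              congr 1
              field_simp
          _ ≤ 1 / 2 := by
              rw [Real.exp_neg, one_div]
              gcongr
              linarith [Real.add_one_le_exp 1]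
      nlinarith
  have hne : riemannZeta ((1 + x : ℝ) + t * I) ≠ 0 :=
    riemannZeta_ne_zero_of_one_le_re (by simpa using hxpos.le)
  have hl1 : Real.log (2 / x) = Real.log 8 + Real.log (1 / (2 * (2 * x))) := by
    rw [← Real.log_mul (by norm_num) (by positivity)]
    congr 1
    field_simp
    norm_num
  have hl2 : Real.log (1 / (2 * x)) = -Real.log (2 * x) := by rw [one_div, Real.log_inv]
  rw [← Real.exp_log (norm_pos_iff.2 hne)]
  calc Real.exp (Real.log ‖riemannZeta ((1 + x : ℝ) + t * I)‖)
      ≤ Real.exp (4 + 4 * Real.log 8 + 10 * C + Real.log (2 * x)) := by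
        apply Real.exp_le_exp.2
        linarith [hb1.1, hb1.2]
    _ = _ := by
        rw [Real.exp_add, Real.exp_log (by positivity)]
        ring

/-- The integral of `f` over the boundary of the rectangle `[-ε, b] × [-h, h]`. -/
noncomputable def rectIntegral (f : ℂ → ℂ) (ε b h : ℝ) : ℂ :=
  (∫ x in (-ε)..b, f (x + (-h : ℝ) * I)) - (∫ x in (-ε)..b, f (x + h * I)) +
    I * (∫ y in (-h)..h, f (b + y * I)) - I * ∫ y in (-h)..h, f ((-ε : ℝ) + y * I)

lemma inv_add_mul_I_re (x y : ℝ) : ((x + y * I : ℂ)⁻¹).re = x / (x ^ 2 + y ^ 2) := by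
  simp [Complex.inv_re, Complex.normSq_apply, sq]

lemma inv_add_mul_I_im (x y : ℝ) : ((x + y * I : ℂ)⁻¹).im = -y / (x ^ 2 + y ^ 2) := by
  simp [Complex.inv_im, Complex.normSq_apply, sq]

lemma intervalIntegral_complex_re {f : ℝ → ℂ} {a b : ℝ} (hf : IntervalIntegrable f volume a b) :
    (∫ x in a..b, f x).re = ∫ x in a..b, (f x).re :=
  (Complex.reCLM.intervalIntegral_comp_comm hf).symm

lemma intervalIntegral_complex_im {f : ℝ → ℂ} {a b : ℝ} (hf : IntervalIntegrable f volume a b) :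
    (∫ x in a..b, f x).im = ∫ x in a..b, (f x).im :=
  (Complex.imCLM.intervalIntegral_comp_comm hf).symm

lemma add_mul_I_ne_zero {x y : ℝ} (h : x ≠ 0 ∨ y ≠ 0) : (x + y * I : ℂ) ≠ 0 := by
  intro h0
  have h1 := congrArg Complex.re h0
  have h2 := congrArg Complex.im h0
  simp at h1 h2
  tauto

lemma le_norm_rectIntegral_inv {ε b h : ℝ} (hε : 0 < ε) (hb : 0 < b) (hh : 0 < h) :
    2 * h * b / (b ^ 2 + h ^ 2) ≤ ‖rectIntegral (fun s => s⁻¹) ε b h‖ := by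
  refine le_trans ?_ ((le_abs_self _).trans (Complex.abs_im_le_norm _))
  have hhor : ∀ y : ℝ, y ≠ 0 →
      IntervalIntegrable (fun x : ℝ => (x + y * I : ℂ)⁻¹) volume (-ε) b := fun y hy =>
    Continuous.intervalIntegrable
      (Continuous.inv₀ (by fun_prop) fun x => add_mul_I_ne_zero (Or.inr hy)) _ _
  have hver : ∀ x : ℝ, x ≠ 0 →
      IntervalIntegrable (fun y : ℝ => (x + y * I : ℂ)⁻¹) volume (-h) h := fun x hx =>
    Continuous.intervalIntegrable
      (Continuous.inv₀ (by fun_prop) fun y => add_mul_I_ne_zero (Or.inl hx)) _ _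
  simp only [rectIntegral, Complex.sub_im, Complex.add_im, Complex.I_mul_im]
  rw [intervalIntegral_complex_im (hhor (-h) (by linarith)),
    intervalIntegral_complex_im (hhor h hh.ne'), intervalIntegral_complex_re (hver b hb.ne'),
    intervalIntegral_complex_re (hver (-ε) (by linarith))]
  simp only [inv_add_mul_I_re, inv_add_mul_I_im]
  have h1 : 0 ≤ ∫ x in (-ε)..b, -(-h) / (x ^ 2 + (-h) ^ 2) :=
    intervalIntegral.integral_nonneg (by linarith) fun x _ => by rw [neg_neg]; positivity
  have h2 : ∫ x in (-ε)..b, -h / (x ^ 2 + h ^ 2) ≤ 0 := by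
    simp only [neg_div, intervalIntegral.integral_neg, Left.neg_nonpos_iff]
    exact intervalIntegral.integral_nonneg (by linarith) fun x _ => by positivity
  have h3 : ∫ y in (-h)..h, -ε / ((-ε) ^ 2 + y ^ 2) ≤ 0 := by
    simp only [neg_div, intervalIntegral.integral_neg, Left.neg_nonpos_iff]
    exact intervalIntegral.integral_nonneg (by linarith) fun x _ => by positivity
  have h4 : 2 * h * b / (b ^ 2 + h ^ 2) ≤ ∫ y in (-h)..h, b / (b ^ 2 + y ^ 2) := by
    have hc : ∫ _y in (-h)..h, b / (b ^ 2 + h ^ 2) = 2 * h * b / (b ^ 2 + h ^ 2) := by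
      rw [intervalIntegral.integral_const, smul_eq_mul]
      ring
    rw [← hc]
    refine intervalIntegral.integral_mono_on (by linarith) (by simp)
      (Continuous.intervalIntegrable (Continuous.div (by fun_prop) (by fun_prop)
        fun y => by positivity) _ _) fun y hy => ?_
    have : y ^ 2 ≤ h ^ 2 := sq_le_sq' hy.1 hy.2
    gcongr
  linarith

/-- A quantitative form of Cauchy's formula on a rectangle. -/
lemma norm_mul_le_of_rect {G : ℂ → ℂ} {ε b h B : ℝ} (hε : 0 < ε) (hb : 0 < b) (hh : 0 < h)
    (hG : DifferentiableOn ℂ G (Set.Icc (-ε) b ×ℂ Set.Icc (-h) h))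
    (hright : ∀ y ∈ Set.Ioc (-h) h, ‖G (b + y * I)‖ ≤ B)
    (hbot : ∀ x ∈ Set.Ioc (-ε) b, ‖G (x + (-h : ℝ) * I)‖ ≤ B)
    (htop : ∀ x ∈ Set.Ioc (-ε) b, ‖G (x + h * I)‖ ≤ B) :
    ‖G 0‖ * (2 * h * b / (b ^ 2 + h ^ 2)) ≤
      B * (2 * (b + ε) / h + 2 * h / b) +
        ∫ y in (-h)..h, ‖G ((-ε : ℝ) + y * I)‖ / ‖((-ε : ℝ) + y * I : ℂ)‖ := by
  have hεb : -ε ≤ b := by linarith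
  have hhh : -h ≤ h := by linarith
  have hnhds : Set.Icc (-ε) b ×ℂ Set.Icc (-h) h ∈ nhds (0 : ℂ) := by
    rw [← mem_interior_iff_mem_nhds, Complex.interior_reProdIm, interior_Icc, interior_Icc]
    simp [Complex.mem_reProdIm, hε, hb, hh]
  have hcauchy := Complex.integral_boundary_rect_eq_zero_of_differentiableOn (dslope G 0)
    ⟨-ε, -h⟩ ⟨b, h⟩ (by
      simp only [Set.uIcc_of_le hεb, Set.uIcc_of_le hhh]
      exact (Complex.differentiableOn_dslope hnhds).2 hG)
  simp only [smul_eq_mul] at hcauchy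
  have hedge : ∀ (γ : ℝ → ℂ) (u v : ℝ), u ≤ v → Continuous γ → (∀ x, γ x ≠ 0) →
      (∀ x ∈ Set.Icc u v, γ x ∈ Set.Icc (-ε) b ×ℂ Set.Icc (-h) h) →
      ∫ x in u..v, dslope G 0 (γ x) =
        (∫ x in u..v, G (γ x) / γ x) - G 0 * ∫ x in u..v, (γ x)⁻¹ := by
    intro γ u v huv hγ hγ0 hmem
    rw [← intervalIntegral.integral_const_mul, ← intervalIntegral.integral_sub]
    · refine intervalIntegral.integral_congr fun x _ => ?_
      rw [dslope_of_ne _ (hγ0 x), slope_def_field, sub_zero, sub_div, div_eq_mul_inv (G 0)]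
    · refine ContinuousOn.intervalIntegrable_of_Icc huv (ContinuousOn.div ?_ hγ.continuousOn
        fun x _ => hγ0 x)
      exact hG.continuousOn.comp hγ.continuousOn hmem
    · exact ((hγ.inv₀ hγ0).const_mul _).intervalIntegrable _ _
  have hmemR : ∀ y ∈ Set.Icc (-h) h, ∀ x ∈ Set.Icc (-ε) b,
      (x + y * I : ℂ) ∈ Set.Icc (-ε) b ×ℂ Set.Icc (-h) h := fun y hy x hx => by
    simpa [Complex.mem_reProdIm] using And.intro hx hy
  rw [hedge (fun x : ℝ => x + (-h : ℝ) * I) (-ε) b hεb (by fun_prop)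
      (fun x => add_mul_I_ne_zero (Or.inr (by linarith)))
      (hmemR _ (Set.left_mem_Icc.2 hhh)),
    hedge (fun x : ℝ => x + h * I) (-ε) b hεb (by fun_prop)
      (fun x => add_mul_I_ne_zero (Or.inr hh.ne')) (hmemR _ (Set.right_mem_Icc.2 hhh)),
    hedge (fun y : ℝ => b + y * I) (-h) h hhh (by fun_prop)
      (fun x => add_mul_I_ne_zero (Or.inl hb.ne'))
      (fun y hy => hmemR y hy b (Set.right_mem_Icc.2 hεb)),
    hedge (fun y : ℝ => (-ε : ℝ) + y * I) (-h) h hhh (by fun_prop)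
      (fun x => add_mul_I_ne_zero (Or.inl (by linarith)))
      (fun y hy => hmemR y hy (-ε) (Set.left_mem_Icc.2 hεb))] at hcauchy
  have hJ : G 0 * rectIntegral (fun s => s⁻¹) ε b h = rectIntegral (fun s => G s / s) ε b h := by
    simp only [rectIntegral]
    linear_combination -hcauchy
  have hB : 0 ≤ B := (norm_nonneg _).trans (hright h ⟨by linarith, le_rfl⟩)
  have hbound : ∀ {u v m : ℝ} {γ : ℝ → ℂ}, u ≤ v → 0 < m → (∀ x ∈ Set.Ioc u v, ‖G (γ x)‖ ≤ B) →
      (∀ x, m ≤ ‖γ x‖) → ‖∫ x in u..v, G (γ x) / γ x‖ ≤ B / m * (v - u) := by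
    intro u v m γ huv hm h1 h2
    refine (intervalIntegral.norm_integral_le_of_norm_le_const (C := B / m) fun x hx => ?_).trans_eq
      (by rw [abs_of_nonneg (sub_nonneg.2 huv)])
    rw [Set.uIoc_of_le huv] at hx
    rw [norm_div]
    exact div_le_div₀ hB (h1 x hx) hm (h2 x)
  have e1 := hbound hεb hh hbot fun x => by
    have := Complex.abs_im_le_norm (x + (-h : ℝ) * I)
    simpa [abs_of_pos hh] using this
  have e2 := hbound hεb hh htop fun x => by
    have := Complex.abs_im_le_norm (x + h * I)
    simpa [abs_of_pos hh] using this
  have e3 := hbound hhh hb hright fun y => by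
    have := Complex.abs_re_le_norm (b + y * I)
    simpa [abs_of_pos hb] using this
  have e4 : ‖∫ y in (-h)..h, G ((-ε : ℝ) + y * I) / ((-ε : ℝ) + y * I : ℂ)‖ ≤
      ∫ y in (-h)..h, ‖G ((-ε : ℝ) + y * I)‖ / ‖((-ε : ℝ) + y * I : ℂ)‖ := by
    simp only [← norm_div]
    exact intervalIntegral.norm_integral_le_integral_norm hhh
  calc _ ≤ ‖G 0‖ * ‖rectIntegral (fun s => s⁻¹) ε b h‖ := by
        gcongr
        exact le_norm_rectIntegral_inv hε hb hh
    _ = ‖rectIntegral (fun s => G s / s) ε b h‖ := by rw [← norm_mul, hJ]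
    _ ≤ _ := by
        unfold rectIntegral
        refine (norm_sub_le _ _).trans ?_
        refine (add_le_add_left ((norm_add_le _ _).trans
          (add_le_add_left (norm_sub_le _ _) _)) _).trans ?_
        simp only [norm_mul, Complex.norm_I, one_mul]
        refine (add_le_add (add_le_add (add_le_add e1 e2) e3) e4).trans_eq ?_
        ring

lemma half_add_abs_le_norm {ε : ℝ} (hε : 0 < ε) (y : ℝ) :
    (ε + |y|) / 2 ≤ ‖((-ε : ℝ) + y * I : ℂ)‖ := by
  have h1 := Complex.abs_re_le_norm ((-ε : ℝ) + y * I : ℂ)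
  have h2 := Complex.abs_im_le_norm ((-ε : ℝ) + y * I : ℂ)
  simp only [Complex.add_re, Complex.add_im, Complex.ofReal_re, Complex.ofReal_im, Complex.mul_re,
    Complex.mul_im, Complex.I_re, Complex.I_im, mul_zero, mul_one, sub_zero, add_zero, zero_add,
    abs_neg, abs_of_pos hε] at h1 h2
  linarith

lemma integral_add_abs_rpow_neg_le {ε h q : ℝ} (hε : 0 < ε) (hh : 0 < h) (hq : 1 < q) :
    ∫ y in (-h)..h, (ε + |y|) ^ (-q) ≤ 2 / (q - 1) * ε ^ (1 - q) := by
  have hcont : Continuous fun y : ℝ => (ε + |y|) ^ (-q) :=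
    Continuous.rpow_const (by fun_prop) fun y => Or.inl (by positivity)
  have hright : ∫ y in (0 : ℝ)..h, (ε + |y|) ^ (-q) ≤ 1 / (q - 1) * ε ^ (1 - q) := by
    have h1 : ∫ y in (0 : ℝ)..h, (ε + |y|) ^ (-q) = ∫ y in (0 : ℝ)..h, (ε + y) ^ (-q) := by
      refine intervalIntegral.integral_congr fun y hy => ?_
      rw [Set.uIcc_of_le hh.le] at hy
      simp only [abs_of_nonneg hy.1]
    rw [h1, intervalIntegral.integral_comp_add_left (fun y => y ^ (-q)), integral_rpow]
    · have h2 : 0 ≤ (ε + h) ^ (-q + 1) := by positivity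
      have h3 : 0 < q - 1 := by linarith
      rw [add_zero, show -q + 1 = -(q - 1) by ring, show 1 - q = -(q - 1) by ring, div_neg,
        ← neg_div, neg_sub, one_div_mul_eq_div]
      gcongr
      rw [show -q + 1 = -(q - 1) by ring] at h2
      linarith
    · refine Or.inr ⟨by linarith, ?_⟩
      rw [Set.uIcc_of_le (by linarith)]
      intro h0
      linarith [h0.1]
  have hleft : ∫ y in (-h)..0, (ε + |y|) ^ (-q) = ∫ y in (0 : ℝ)..h, (ε + |y|) ^ (-q) := by
    have h1 := intervalIntegral.integral_comp_neg (a := 0) (b := h)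
      (fun y : ℝ => (ε + |y|) ^ (-q))
    simpa using h1.symm
  rw [← intervalIntegral.integral_add_adjacent_intervals (hcont.intervalIntegrable (-h) 0)
    (hcont.intervalIntegrable 0 h), hleft]
  calc _ ≤ 1 / (q - 1) * ε ^ (1 - q) + 1 / (q - 1) * ε ^ (1 - q) := add_le_add hright hright
    _ = _ := by ring

lemma ContinuousOn.memLp_Ioc {f : ℝ → ℝ} {a b : ℝ} (hf : ContinuousOn f (Set.Icc a b))
    (p : ENNReal) : MemLp f p (volume.restrict (Set.Ioc a b)) := by
  obtain ⟨C, hC⟩ := isCompact_Icc.exists_bound_of_continuousOn hf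
  refine MemLp.of_bound ((hf.mono Set.Ioc_subset_Icc_self).aestronglyMeasurable
    measurableSet_Ioc) C ?_
  filter_upwards [ae_restrict_mem measurableSet_Ioc] with x hx
  exact hC x (Set.Ioc_subset_Icc_self hx)

lemma integral_div_norm_le {f : ℝ → ℝ} {ε h p q : ℝ} (hpq : p.HolderConjugate q) (hε : 0 < ε)
    (hh : 0 < h) (hf : ContinuousOn f (Set.Icc (-h) h)) (hf0 : ∀ y, 0 ≤ f y) :
    ∫ y in (-h)..h, f y / ‖((-ε : ℝ) + y * I : ℂ)‖ ≤
      2 * (∫ y in (-h)..h, f y ^ p) ^ (1 / p) * (2 / (q - 1)) ^ (1 / q) * ε ^ (-(1 / p)) := by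
  have hhh : -h ≤ h := by linarith
  have hq1 : 1 < q := hpq.symm.lt
  have hpos : ∀ y : ℝ, 0 < ε + |y| := fun y => by positivity
  have hg : Continuous fun y : ℝ => (ε + |y|)⁻¹ :=
    Continuous.inv₀ (by fun_prop) fun y => (hpos y).ne'
  have hholder := MeasureTheory.integral_mul_le_Lp_mul_Lq_of_nonneg
    (μ := volume.restrict (Set.Ioc (-h) h)) hpq (f := f) (g := fun y => (ε + |y|)⁻¹)
    (Eventually.of_forall hf0) (Eventually.of_forall fun y => (inv_pos.2 (hpos y)).le)
    (hf.memLp_Ioc _) (hg.continuousOn.memLp_Ioc _)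
  simp only [← intervalIntegral.integral_of_le hhh] at hholder
  have hgq : ∫ y in (-h)..h, ((ε + |y|)⁻¹) ^ q ≤ 2 / (q - 1) * ε ^ (1 - q) := by
    refine le_trans (le_of_eq ?_) (integral_add_abs_rpow_neg_le hε hh hq1)
    refine intervalIntegral.integral_congr fun y _ => ?_
    rw [← Real.rpow_neg_one, ← Real.rpow_mul (hpos y).le, neg_one_mul]
  have hgq0 : 0 ≤ ∫ y in (-h)..h, ((ε + |y|)⁻¹) ^ q :=
    intervalIntegral.integral_nonneg hhh fun y _ => by
      have := hpos y
      positivity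
  have hfp0 : 0 ≤ ∫ y in (-h)..h, f y ^ p :=
    intervalIntegral.integral_nonneg hhh fun y _ => Real.rpow_nonneg (hf0 y) _
  have hnorm0 : ∀ y : ℝ, 0 < ‖((-ε : ℝ) + y * I : ℂ)‖ := fun y =>
    lt_of_lt_of_le (by have := hpos y; positivity) (half_add_abs_le_norm hε y)
  have hstep : ∫ y in (-h)..h, f y / ‖((-ε : ℝ) + y * I : ℂ)‖ ≤
      2 * ∫ y in (-h)..h, f y * (ε + |y|)⁻¹ := by
    rw [← intervalIntegral.integral_const_mul]
    refine intervalIntegral.integral_mono_on hhh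
      (ContinuousOn.intervalIntegrable_of_Icc hhh (hf.div (by fun_prop) fun y _ => (hnorm0 y).ne'))
      (ContinuousOn.intervalIntegrable_of_Icc hhh ((hf.mul hg.continuousOn).const_mul 2))
      fun y _ => ?_
    rw [div_le_iff₀ (hnorm0 y)]
    have h1 := half_add_abs_le_norm hε y
    have h2 := hf0 y
    have h3 := hpos y
    calc f y = 2 * (f y * (ε + |y|)⁻¹) * ((ε + |y|) / 2) := by field_simp
      _ ≤ _ := by gcongr
  have hexp : (1 - q) * (1 / q) = -(1 / p) := by
    have h1 := hpq.inv_add_inv_eq_one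
    have h2 : q ≠ 0 := by linarith
    rw [sub_mul, mul_one_div_cancel h2, one_div, one_div]
    linarith
  have hq0 : 0 ≤ 2 / (q - 1) := div_nonneg zero_le_two (by linarith)
  calc _ ≤ 2 * ((∫ y in (-h)..h, f y ^ p) ^ (1 / p) *
        (∫ y in (-h)..h, ((ε + |y|)⁻¹) ^ q) ^ (1 / q)) := by
        refine hstep.trans ?_
        gcongr
    _ ≤ 2 * ((∫ y in (-h)..h, f y ^ p) ^ (1 / p) *
        (2 / (q - 1) * ε ^ (1 - q)) ^ (1 / q)) := by
        have : 0 ≤ 1 / q := by positivity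
        gcongr
    _ = _ := by
        rw [Real.mul_rpow hq0 (by positivity), ← Real.rpow_mul hε.le, hexp]
        ring

/-- A small value of zeta slightly to the right of the line `Re s = 1` forces a large local
negative moment of zeta on that line. -/
lemma exists_le_integral_norm_riemannZeta_rpow_neg {h p K : ℝ} (hh : 0 < h) (hp : 1 < p)
    (hK : 0 < K) :
    ∃ c > (0 : ℝ), ∃ ε₀ > (0 : ℝ), ∀ ε τ : ℝ, 0 < ε → ε ≤ ε₀ → h < τ →
      ‖riemannZeta ((1 + ε : ℝ) + τ * I)‖ ≤ K * ε →
      c * ε ^ (1 - p) ≤ ∫ t in (τ - h)..(τ + h), ‖riemannZeta (1 + t * I)‖ ^ (-p) := by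
  obtain ⟨r, hr0, K₁, hK₁, hinv⟩ := exists_norm_inv_riemannZeta_le_s19
  obtain ⟨q, hpq⟩ : ∃ q, p.HolderConjugate q := ⟨_, Real.HolderConjugate.conjExponent hp⟩
  have hq1 : 1 < q := hpq.symm.lt
  set B := K₁ * (r + 2 * h) ^ 2 / r with hB
  set κ := h * r / (r ^ 2 + h ^ 2) with hκ
  set A := κ * h ^ 2 / K with hA
  set B' := B * (2 * r / h + 4 * h / r) with hB'
  set C := 8 * h ^ 2 * (2 / (q - 1)) ^ (1 / q) with hC
  have hq0 : 0 < 2 / (q - 1) := div_pos two_pos (by linarith)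
  have hBpos : 0 < B := by positivity
  have hB'pos : 0 < B' := by positivity
  have hApos : 0 < A := by positivity
  have hCpos : 0 < C := by positivity
  refine ⟨(A / (2 * C)) ^ p, by positivity, min (r / 2) (A / (2 * B')), by positivity, ?_⟩
  intro ε τ hε hεle hτ hsmall
  have hεr : ε ≤ r / 2 := hεle.trans (min_le_left _ _)
  have hεA : ε ≤ A / (2 * B') := hεle.trans (min_le_right _ _)
  set b := r - ε with hb
  have hbpos : 0 < b := by linarith
  have hbr : r / 2 ≤ b := by linarith
  have hhh : -h ≤ h := by linarith
  set G : ℂ → ℂ := fun s => (riemannZeta ((1 + ε : ℝ) + τ * I + s))⁻¹ *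
    ((s + (ε + h * I)) * (s + (ε - h * I))) with hG
  have hne : ∀ x : ℝ, -ε ≤ x → ∀ y : ℝ,
      riemannZeta ((1 + ε : ℝ) + τ * I + (x + y * I)) ≠ 0 := fun x hx y =>
    riemannZeta_ne_zero_of_one_le_re (by simp; linarith)
  have hdiff : DifferentiableOn ℂ G (Set.Icc (-ε) b ×ℂ Set.Icc (-h) h) := by
    intro s hs
    obtain ⟨hsre, hsim⟩ := Complex.mem_reProdIm.1 hs
    have hs1 : ((1 + ε : ℝ) + τ * I + s : ℂ) ≠ 1 := by
      intro h1
      have h2 := congrArg Complex.im h1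
      simp at h2
      linarith [hsim.1]
    have hz : riemannZeta ((1 + ε : ℝ) + τ * I + s) ≠ 0 := by
      have := hne s.re hsre.1 s.im
      rwa [Complex.re_add_im] at this
    have hd : DifferentiableAt ℂ (fun s => riemannZeta ((1 + ε : ℝ) + τ * I + s)) s :=
      DifferentiableAt.comp (g := riemannZeta) s (differentiableAt_riemannZeta hs1)
        (by fun_prop)
    exact ((hd.inv hz).mul (by fun_prop)).differentiableWithinAt
  have hnormle : ∀ x y u v : ℝ, |x| ≤ u → |y| ≤ v →
      ‖(x + y * I : ℂ)‖ ≤ u + v := fun x y u v hu hv => by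
    refine (norm_add_le _ _).trans (add_le_add ?_ ?_)
    · simpa using hu
    · simpa using hv
  have hGnorm : ∀ x y : ℝ, ‖G (x + y * I)‖ =
      ‖riemannZeta ((1 + (x + ε) : ℝ) + (τ + y : ℝ) * I)‖⁻¹ *
        (‖((x + ε : ℝ) + (y + h : ℝ) * I : ℂ)‖ * ‖((x + ε : ℝ) + (y - h : ℝ) * I : ℂ)‖) := by
    intro x y
    rw [hG, norm_mul, norm_mul, norm_inv]
    congr 2
    · congr 2; push_cast; ring
    · congr 1; push_cast; ring
    · congr 1; push_cast; ring
  have hinv' : ∀ x y : ℝ, x ∈ Set.Ioc (-ε) b →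
      ‖riemannZeta ((1 + (x + ε) : ℝ) + (τ + y : ℝ) * I)‖⁻¹ ≤ K₁ / (x + ε) := fun x y hx =>
    hinv _ _ (by linarith [hx.1]) (by linarith [hx.2])
  have hBle : K₁ * (r + 2 * h) ≤ B := by
    rw [hB, le_div_iff₀ hr0]
    nlinarith [mul_pos (mul_pos hK₁ hh) hh, mul_pos (mul_pos hK₁ hh) hr0]
  have hright : ∀ y ∈ Set.Ioc (-h) h, ‖G (b + y * I)‖ ≤ B := by
    intro y hy
    rw [hGnorm]
    have h1 := hinv' b y ⟨by linarith, le_rfl⟩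
    have hbe : b + ε = r := by rw [hb]; ring
    rw [hbe] at h1 ⊢
    have h2 := hnormle r (y + h) r (2 * h) (abs_of_pos hr0).le
      (abs_le.2 ⟨by linarith [hy.1], by linarith [hy.2]⟩)
    have h3 := hnormle r (y - h) r (2 * h) (abs_of_pos hr0).le
      (abs_le.2 ⟨by linarith [hy.1], by linarith [hy.2]⟩)
    calc _ ≤ K₁ / r * ((r + 2 * h) * (r + 2 * h)) := by gcongr
      _ = B := by rw [hB]; ring
  have hbot : ∀ x ∈ Set.Ioc (-ε) b, ‖G (x + (-h : ℝ) * I)‖ ≤ B := by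
    intro x hx
    rw [hGnorm]
    have h1 := hinv' x (-h) hx
    have hxe : 0 < x + ε := by linarith [hx.1]
    have hxr : x + ε ≤ r := by linarith [hx.2]
    have h2 : ‖((x + ε : ℝ) + (-h + h : ℝ) * I : ℂ)‖ ≤ x + ε := by
      simpa using hnormle (x + ε) (-h + h) (x + ε) 0 (abs_of_pos hxe).le (by simp)
    have h3 := hnormle (x + ε) (-h - h) r (2 * h) (by rwa [abs_of_pos hxe])
      (abs_le.2 ⟨by linarith, by linarith⟩)
    calc _ ≤ K₁ / (x + ε) * ((x + ε) * (r + 2 * h)) := by gcongr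
      _ = K₁ * (r + 2 * h) := by field_simp
      _ ≤ B := hBle
  have htop : ∀ x ∈ Set.Ioc (-ε) b, ‖G (x + h * I)‖ ≤ B := by
    intro x hx
    rw [hGnorm]
    have h1 := hinv' x h hx
    have hxe : 0 < x + ε := by linarith [hx.1]
    have hxr : x + ε ≤ r := by linarith [hx.2]
    have h2 : ‖((x + ε : ℝ) + (h - h : ℝ) * I : ℂ)‖ ≤ x + ε := by
      simpa using hnormle (x + ε) (h - h) (x + ε) 0 (abs_of_pos hxe).le (by simp)
    have h3 := hnormle (x + ε) (h + h) r (2 * h) (by rwa [abs_of_pos hxe])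
      (abs_le.2 ⟨by linarith, by linarith⟩)
    calc _ ≤ K₁ / (x + ε) * ((r + 2 * h) * (x + ε)) := by gcongr
      _ = K₁ * (r + 2 * h) := by field_simp
      _ ≤ B := hBle
  have hmain := norm_mul_le_of_rect hε hbpos hh hdiff hright hbot htop
  set f : ℝ → ℝ := fun y => ‖riemannZeta (1 + (τ + y : ℝ) * I)‖⁻¹ with hf
  have hzline : ∀ t : ℝ, riemannZeta (1 + t * I) ≠ 0 := fun t =>
    riemannZeta_ne_zero_of_one_le_re (by simp)
  have hfcont : ContinuousOn f (Set.Icc (-h) h) := by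
    intro y hy
    refine ContinuousAt.continuousWithinAt (ContinuousAt.inv₀ (ContinuousAt.norm ?_)
      (norm_ne_zero_iff.2 (hzline _)))
    have h1 : (1 + (τ + y : ℝ) * I : ℂ) ≠ 1 := by
      intro h1
      have h2 := congrArg Complex.im h1
      simp at h2
      linarith [hy.1]
    exact ContinuousAt.comp (g := riemannZeta) (f := fun y : ℝ => (1 + (τ + y : ℝ) * I : ℂ))
      (differentiableAt_riemannZeta h1).continuousAt (by fun_prop)
  have hf0 : ∀ y, 0 ≤ f y := fun y => by positivity
  have hleft : ∀ y ∈ Set.Icc (-h) h, ‖G ((-ε : ℝ) + y * I)‖ ≤ 4 * h ^ 2 * f y := by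
    intro y hy
    rw [hGnorm]
    have h2 : ‖((-ε + ε : ℝ) + (y + h : ℝ) * I : ℂ)‖ ≤ 2 * h := by
      simpa using hnormle (-ε + ε) (y + h) 0 (2 * h) (by simp)
        (abs_le.2 ⟨by linarith [hy.1], by linarith [hy.2]⟩)
    have h3 : ‖((-ε + ε : ℝ) + (y - h : ℝ) * I : ℂ)‖ ≤ 2 * h := by
      simpa using hnormle (-ε + ε) (y - h) 0 (2 * h) (by simp)
        (abs_le.2 ⟨by linarith [hy.1], by linarith [hy.2]⟩)
    have h1 : ‖riemannZeta ((1 + (-ε + ε) : ℝ) + (τ + y : ℝ) * I)‖⁻¹ = f y := by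
      simp [hf]
    rw [h1]
    calc _ ≤ f y * (2 * h * (2 * h)) := by have := hf0 y; gcongr
      _ = _ := by ring
  have hnorm0 : ∀ y : ℝ, (0 : ℝ) < ‖((-ε : ℝ) + y * I : ℂ)‖ := fun y =>
    norm_pos_iff.2 (add_mul_I_ne_zero (Or.inl (by linarith)))
  set J := ∫ y in (-h)..h, f y ^ p with hJ
  have hJ0 : 0 ≤ J := intervalIntegral.integral_nonneg hhh fun y _ => Real.rpow_nonneg (hf0 y) _
  have hleftint : ∫ y in (-h)..h, ‖G ((-ε : ℝ) + y * I)‖ / ‖((-ε : ℝ) + y * I : ℂ)‖ ≤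
      C * J ^ (1 / p) * ε ^ (-(1 / p)) := by
    calc _ ≤ ∫ y in (-h)..h, 4 * h ^ 2 * (f y / ‖((-ε : ℝ) + y * I : ℂ)‖) := by
          refine intervalIntegral.integral_mono_on hhh ?_ ?_ fun y hy => ?_
          · refine ContinuousOn.intervalIntegrable_of_Icc hhh (ContinuousOn.div
              (ContinuousOn.norm ?_) (by fun_prop) fun y _ => (hnorm0 y).ne')
            refine hdiff.continuousOn.comp (by fun_prop) fun y hy => ?_
            rw [Complex.mem_reProdIm]
            simp only [Complex.add_re, Complex.add_im, Complex.ofReal_re, Complex.ofReal_im,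
              Complex.mul_re, Complex.mul_im, Complex.I_re, Complex.I_im, mul_zero, mul_one,
              sub_zero, add_zero, zero_add]
            exact ⟨⟨le_rfl, by linarith⟩, hy⟩
          · exact ContinuousOn.intervalIntegrable_of_Icc hhh
              ((hfcont.div (by fun_prop) fun y _ => (hnorm0 y).ne').const_mul _)
          · rw [← mul_div_assoc]
            have := hnorm0 y
            gcongr
            exact hleft y hy
      _ = 4 * h ^ 2 * ∫ y in (-h)..h, f y / ‖((-ε : ℝ) + y * I : ℂ)‖ :=
          intervalIntegral.integral_const_mul _ _
      _ ≤ 4 * h ^ 2 * (2 * J ^ (1 / p) * (2 / (q - 1)) ^ (1 / q) * ε ^ (-(1 / p))) := by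
          gcongr
          exact integral_div_norm_le hpq hε hh hfcont hf0
      _ = _ := by rw [hC]; ring
  have hG0 : h ^ 2 / (K * ε) ≤ ‖G 0‖ := by
    have h1 := hGnorm 0 0
    simp only [Complex.ofReal_zero, zero_mul, add_zero, zero_add, zero_sub] at h1
    rw [h1]
    have h2 := Complex.abs_im_le_norm ((ε : ℝ) + (h : ℝ) * I : ℂ)
    have h3 := Complex.abs_im_le_norm ((ε : ℝ) + (-h : ℝ) * I : ℂ)
    simp [abs_of_pos hh] at h2 h3
    have hz : 0 < ‖riemannZeta ((1 + ε : ℝ) + τ * I)‖ := by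
      have := hne 0 (by linarith) 0
      simpa using this
    calc h ^ 2 / (K * ε) = (K * ε)⁻¹ * (h * h) := by ring
      _ ≤ _ := by
        gcongr
        simpa using h3
  have hκle : κ ≤ 2 * h * b / (b ^ 2 + h ^ 2) := by
    calc κ = 2 * h * (r / 2) / (r ^ 2 + h ^ 2) := by rw [hκ]; ring
      _ ≤ _ := by
        gcongr
        linarith
  have hside : B * (2 * (b + ε) / h + 2 * h / b) ≤ B' := by
    rw [hB']
    have h1 : b + ε = r := by rw [hb]; ring
    have h2 : 2 * h / b ≤ 4 * h / r := by
      rw [div_le_div_iff₀ hbpos hr0]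
      nlinarith
    rw [h1]
    gcongr
  have hB'ε : B' ≤ A / ε / 2 := by
    rw [le_div_iff₀ (by positivity)] at hεA
    rw [le_div_iff₀ two_pos, le_div_iff₀ hε]
    linarith
  have hlow : A / ε ≤ ‖G 0‖ * (2 * h * b / (b ^ 2 + h ^ 2)) := by
    calc A / ε = h ^ 2 / (K * ε) * κ := by rw [hA]; field_simp
      _ ≤ _ := by gcongr
  have hfinal : A / ε / 2 ≤ C * J ^ (1 / p) * ε ^ (-(1 / p)) := by linarith
  have hp0 : 0 < p := by linarith
  have hroot : A / (2 * C) * ε ^ (1 / p - 1) ≤ J ^ (1 / p) := by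
    have h1 : ε ^ (-(1 / p)) * ε ^ (1 / p) = 1 := by
      rw [← Real.rpow_add hε]; simp
    have h2 : ε ^ (1 / p - 1) = ε ^ (1 / p) / ε := by
      rw [Real.rpow_sub hε, Real.rpow_one]
    calc A / (2 * C) * ε ^ (1 / p - 1) = A / ε / 2 * (ε ^ (1 / p) / C) := by
          rw [h2]; field_simp
      _ ≤ C * J ^ (1 / p) * ε ^ (-(1 / p)) * (ε ^ (1 / p) / C) := by gcongr
      _ = J ^ (1 / p) * (ε ^ (-(1 / p)) * ε ^ (1 / p)) := by field_simp
      _ = J ^ (1 / p) := by rw [h1, mul_one]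
  have hJfinal : (A / (2 * C)) ^ p * ε ^ (1 - p) ≤ J := by
    have h1 := Real.rpow_le_rpow (by positivity) hroot hp0.le
    rw [Real.mul_rpow (by positivity) (by positivity), ← Real.rpow_mul hε.le,
      ← Real.rpow_mul hJ0, one_div_mul_cancel hp0.ne', Real.rpow_one,
      show (1 / p - 1) * p = 1 - p by field_simp] at h1
    exact h1
  refine hJfinal.trans_eq ?_
  have hshift := intervalIntegral.integral_comp_add_left (a := -h) (b := h)
    (fun t : ℝ => ‖riemannZeta (1 + t * I)‖ ^ (-p)) τ
  rw [← sub_eq_add_neg] at hshift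
  rw [← hshift, hJ]
  refine intervalIntegral.integral_congr fun y _ => ?_
  simp only [hf]
  rw [Real.inv_rpow (norm_nonneg _), Real.rpow_neg (norm_nonneg _)]

lemma natCast_le_resonanceLength (y : ℕ) : (y : ℝ) ≤ resonanceLength y := by
  have h1 : (1 : ℝ) ≤ ((y.factorial ^ y : ℕ) : ℝ) := by
    exact_mod_cast Nat.one_le_iff_ne_zero.2 (pow_ne_zero _ y.factorial_ne_zero)
  have hy : (0 : ℝ) ≤ y := Nat.cast_nonneg y
  rw [resonanceLength]
  calc (y : ℝ) = 1 * y * 1 ^ 2 := by ring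
    _ ≤ _ := by gcongr; linarith

lemma resonanceLength_le {y : ℕ} (hy : 5 ≤ y) :
    2 * resonanceLength y ≤ Real.exp ((y : ℝ) ^ 4) := by
  have hy5 : (5 : ℝ) ≤ y := by exact_mod_cast hy
  have hylt : (y : ℝ) ≤ Real.exp y := by linarith [Real.add_one_le_exp (y : ℝ)]
  have hfac : ((y.factorial ^ y : ℕ) : ℝ) ≤ Real.exp ((y : ℝ) ^ 3) := by
    have h1 : (y.factorial : ℝ) ≤ (y : ℝ) ^ y := by exact_mod_cast Nat.factorial_le_pow y
    rw [Nat.cast_pow]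
    calc (y.factorial : ℝ) ^ y ≤ ((Real.exp y ^ y)) ^ y := by
          gcongr
          exact h1.trans (by gcongr)
      _ = Real.exp ((y : ℝ) ^ 3) := by
          rw [← Real.exp_nat_mul, ← Real.exp_nat_mul]
          ring_nf
  have h24 : (24 : ℝ) ≤ Real.exp 24 := by linarith [Real.add_one_le_exp (24 : ℝ)]
  calc 2 * resonanceLength y
      = 2 * ((4 * y + 8) * y * ((y.factorial ^ y : ℕ) : ℝ) ^ 2) := rfl
    _ ≤ 2 * ((4 * y + 8 * y) * y * (Real.exp ((y : ℝ) ^ 3)) ^ 2) := by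
        gcongr
        linarith
    _ = 24 * (y * y) * (Real.exp ((y : ℝ) ^ 3)) ^ 2 := by ring
    _ ≤ Real.exp 24 * (Real.exp y * Real.exp y) * (Real.exp ((y : ℝ) ^ 3)) ^ 2 := by gcongr
    _ = Real.exp (24 + (y + y) + 2 * (y : ℝ) ^ 3) := by
        rw [Real.exp_add, Real.exp_add, Real.exp_add, two_mul, Real.exp_add, sq]
    _ ≤ Real.exp ((y : ℝ) ^ 4) := by
        apply Real.exp_le_exp.2
        have h3 : 25 * (y : ℝ) ≤ (y : ℝ) ^ 3 := by
          have : 5 ^ 2 * (y : ℝ) ≤ (y : ℝ) ^ 2 * y := by gcongr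
          linarith
        have h4 : 5 * (y : ℝ) ^ 3 ≤ (y : ℝ) ^ 4 := by
          rw [pow_succ _ 3, mul_comm]; gcongr
        linarith

theorem stmt_19 (δ : ℝ) (hδ : 0 < δ) (p : ℝ) (hp : 1 < p) :
    ∃ c > (0 : ℝ), ∀ T₀ : ℝ, (3 : ℝ) ≤ T₀ → ∃ T : ℝ, T₀ ≤ T ∧
      c * Real.log (Real.log T) ^ (p - 1) ≤ ∫ t in T..(T + δ), ‖riemannZeta (1 + t * Complex.I)‖ ^ (-p) := by
  obtain ⟨K, hK, hres⟩ := exists_norm_riemannZeta_le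
  obtain ⟨c, hc, ε₀, hε₀, hloc⟩ :=
    exists_le_integral_norm_riemannZeta_rpow_neg (half_pos hδ) hp hK
  refine ⟨c / 4 ^ (p - 1), by positivity, fun T₀ hT₀ => ?_⟩
  have hlim : Tendsto (fun y : ℕ => Real.log y) atTop atTop :=
    Real.tendsto_log_atTop.comp tendsto_natCast_atTop_atTop
  obtain ⟨y, ⟨τ, hτ, hsmall⟩, hy5, hyT, hylog, hypos⟩ :=
    (hres.and ((eventually_ge_atTop 5).and
      ((tendsto_natCast_atTop_atTop.eventually_ge_atTop (T₀ + δ)).and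
        ((hlim.eventually_ge_atTop ε₀⁻¹).and (hlim.eventually_gt_atTop 0))))).exists
  have hτ1 : T₀ + δ ≤ τ := hyT.trans ((natCast_le_resonanceLength y).trans hτ.1)
  have hmain := hloc (Real.log y)⁻¹ τ (inv_pos.2 hypos) (inv_le_of_inv_le₀ hε₀ hylog)
    (by linarith) hsmall
  refine ⟨τ - δ / 2, by linarith, ?_⟩
  rw [show τ - δ / 2 + δ = τ + δ / 2 by ring]
  refine le_trans ?_ hmain
  have hT3 : 3 ≤ τ - δ / 2 := by linarith
  have hlog1 : 1 ≤ Real.log (τ - δ / 2) := by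
    rw [Real.le_log_iff_exp_le (by linarith)]
    linarith [Real.exp_one_lt_d9]
  have hlog2 : Real.log (τ - δ / 2) ≤ (y : ℝ) ^ 4 := by
    rw [Real.log_le_iff_le_exp (by linarith)]
    linarith [hτ.2, resonanceLength_le hy5]
  have hloglog : Real.log (Real.log (τ - δ / 2)) ≤ 4 * Real.log y := by
    have := Real.log_le_log (by linarith) hlog2
    rwa [Real.log_pow] at this
  have hloglog0 : 0 ≤ Real.log (Real.log (τ - δ / 2)) := Real.log_nonneg hlog1
  have hp1 : 0 ≤ p - 1 := by linarith
  calc c / 4 ^ (p - 1) * Real.log (Real.log (τ - δ / 2)) ^ (p - 1)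
      ≤ c / 4 ^ (p - 1) * (4 * Real.log y) ^ (p - 1) := by gcongr
    _ = c * (Real.log y)⁻¹ ^ (1 - p) := by
        rw [Real.mul_rpow (by norm_num) hypos.le, Real.inv_rpow hypos.le, ← Real.rpow_neg hypos.le,
          neg_sub]
        field_simp
end
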